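/- arXiv:math/0511596 — 13 statements merged into one kernel-verified Lean document; each statement's English description precedes it below -/
import Mathlib

section
/- Let r_1,…,r_m and c_1,…,c_n be positive integers with r_1+…+r_m = c_1+…+c_n = N, let W=(w_ij) be an m×n matrix of non-negative reals, and let A(γ) be the block matrix associated with an m×n matrix γ. Then the integral over the positive orthant ℝ^{mn}_+ of per A(γ) · exp(−Σ_{ij} γ_ij) with respect to Lebesgue measure dγ equals r_1!⋯r_m!·c_1!⋯c_n!·T(R,C;W). (Equivalently: if the γ_ij are independent standard exponential random variables, then E per A(γ) = r_1!⋯r_m!·c_1!⋯c_n!·T(R,C;W).) -/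
open MeasureTheory

namespace ContingencyTable

open Finset

section Counting

variable {α β ι κ : Type*} [Fintype α] [Fintype β] [DecidableEq ι] [DecidableEq κ]

/-- The table of joint multiplicities of two labellings of the same finite set. -/
def jointCount (f : α → ι) (g : α → κ) (i : ι) (j : κ) : ℕ :=
  #{a | f a = i ∧ g a = j}

lemma jointCount_eq_card_pair (f : α → ι) (g : α → κ) (p : ι × κ) :
    jointCount f g p.1 p.2 = #{a | (f a, g a) = p} := by
  simp [jointCount, Prod.ext_iff]

lemma jointCount_comp_equiv (f : β → ι) (g : β → κ) (e : α ≃ β) :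
    jointCount (f ∘ e) (g ∘ e) = jointCount f g := by
  funext i j
  exact card_equiv e (by simp)

lemma sum_jointCount_right [Fintype κ] (f : α → ι) (g : α → κ) (i : ι) :
    ∑ j, jointCount f g i j = #{a | f a = i} := by
  rw [card_eq_sum_card_fiberwise (f := g) (t := univ) (by simp [Set.MapsTo])]
  simp [jointCount, filter_filter]

lemma sum_jointCount_left [Fintype ι] (f : α → ι) (g : α → κ) (j : κ) :
    ∑ i, jointCount f g i j = #{a | g a = j} := by
  rw [card_eq_sum_card_fiberwise (f := f) (t := univ) (by simp [Set.MapsTo])]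
  simp [jointCount, filter_filter, and_comm]

lemma prod_comp_eq_prod_pow_jointCount [Fintype ι] [Fintype κ] {M : Type*} [CommMonoid M]
    (f : α → ι) (g : α → κ) (x : ι → κ → M) : ∏ a, x (f a) (g a) = ∏ i, ∏ j, x i j ^ jointCount f g i j := by
  rw [← Fintype.prod_prod_type' (fun i j ↦ x i j ^ jointCount f g i j),
    ← prod_fiberwise univ (fun a ↦ (f a, g a))]
  refine prod_congr rfl fun p _ ↦ ?_
  rw [jointCount_eq_card_pair]
  refine prod_eq_pow_card fun a ha ↦ ?_
  simp [← (mem_filter.mp ha).2]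

lemma exists_equiv_comp_eq (f : α → ι) (g : β → ι)
    (h : ∀ i, #{a | f a = i} = #{b | g b = i}) : ∃ e : α ≃ β, g ∘ e = f := by
  have h' (i : ι) : Nonempty ({a // f a = i} ≃ {b // g b = i}) :=
    ⟨Fintype.equivOfCardEq (by simpa [Fintype.card_subtype] using h i)⟩
  exact ⟨Equiv.ofFiberEquiv fun i ↦ (h' i).some, funext fun a ↦ Equiv.ofFiberEquiv_map _ a⟩

/-- The permutations carrying one labelling to another with the same multiplicities. -/
lemma card_perm_comp_eq [DecidableEq α] [Fintype ι] (f g : α → ι)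
    (h : ∀ i, #{a | f a = i} = #{a | g a = i}) :
    #{e : Equiv.Perm α | g ∘ e = f} = ∏ i, (#{a | f a = i}).factorial := by
  obtain ⟨e₀, rfl⟩ := exists_equiv_comp_eq f g h
  have := DomMulAct.stabilizer_card (g ∘ e₀)
  simp only [Fintype.card_subtype] at this
  rw [← this]
  refine card_equiv (Equiv.mulLeft e₀⁻¹) fun e ↦ ?_
  simp [Function.comp_def]

/-- A table whose row sums are the multiplicities of `f` is the joint table of `f` and some `g`. -/
lemma exists_jointCount_eq [Fintype ι] [Fintype κ] (f : α → ι) (D : ι → κ → ℕ)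
    (hD : ∀ i, ∑ j, D i j = #{a | f a = i}) : ∃ g : α → κ, jointCount f g = D := by
  let fst : (Σ p : ι × κ, Fin (D p.1 p.2)) → ι := fun x ↦ x.1.1
  let snd : (Σ p : ι × κ, Fin (D p.1 p.2)) → κ := fun x ↦ x.1.2
  have hcount : jointCount fst snd = D := by
    funext i j
    rw [jointCount_eq_card_pair fst snd (i, j), ← Fintype.card_subtype,
      Fintype.card_congr (Equiv.sigmaSubtype (i, j)), Fintype.card_fin]
  obtain ⟨e, rfl⟩ := exists_equiv_comp_eq f fst fun i ↦ by
    rw [← hD, ← sum_jointCount_right fst snd, hcount]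
  exact ⟨snd ∘ e, (jointCount_comp_equiv fst snd e).trans hcount⟩

/-- The labellings `g` having a prescribed joint table with `f`. -/
lemma card_jointCount_eq_mul [DecidableEq α] [Fintype ι] [Fintype κ] (f : α → ι) (D : ι → κ → ℕ)
    (hD : ∀ i, ∑ j, D i j = #{a | f a = i}) :
    #{g : α → κ | jointCount f g = D} * ∏ i, ∏ j, (D i j).factorial =
      ∏ i, (#{a | f a = i}).factorial := by
  obtain ⟨g₀, rfl⟩ := exists_jointCount_eq f D hD
  rw [← card_perm_comp_eq f f fun _ ↦ rfl,
    card_eq_sum_card_fiberwise (f := fun e : Equiv.Perm α ↦ g₀ ∘ e)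
      (t := {g | jointCount f g = jointCount f g₀}), ← smul_eq_mul, ← sum_const]
  · refine sum_congr rfl fun g hg ↦ ?_
    rw [mem_filter_univ] at hg
    have hpair := card_perm_comp_eq (fun a ↦ (f a, g a)) (fun a ↦ (f a, g₀ a)) fun p ↦ by
      rw [← jointCount_eq_card_pair, ← jointCount_eq_card_pair, hg]
    simp only [← jointCount_eq_card_pair, hg, Fintype.prod_prod_type] at hpair
    rw [← hpair, filter_filter]
    congr 1
    ext e
    simp [funext_iff, forall_and]
  · intro e he
    rw [mem_coe, mem_filter_univ] at he ⊢
    simpa only [he] using jointCount_comp_equiv f g₀ e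

/-- The permutations `e` for which `f` and `g ∘ e` have a prescribed joint table. -/
lemma card_perm_jointCount_eq_mul [DecidableEq α] [Fintype ι] [Fintype κ] (f : α → ι) (g : α → κ)
    (D : ι → κ → ℕ) (hrow : ∀ i, ∑ j, D i j = #{a | f a = i})
    (hcol : ∀ j, ∑ i, D i j = #{a | g a = j}) :
    #{e : Equiv.Perm α | jointCount f (g ∘ e) = D} * ∏ i, ∏ j, (D i j).factorial =
      (∏ i, (#{a | f a = i}).factorial) * ∏ j, (#{a | g a = j}).factorial := by
  rw [← card_jointCount_eq_mul f D hrow, mul_right_comm]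
  congr 1
  rw [card_eq_sum_card_fiberwise (f := fun e : Equiv.Perm α ↦ g ∘ e)
    (t := {h | jointCount f h = D}) (by simp [Set.MapsTo]), ← smul_eq_mul, ← sum_const]
  refine sum_congr rfl fun h hh ↦ ?_
  rw [mem_filter_univ] at hh
  have hfib (j : κ) : #{a | h a = j} = #{a | g a = j} := by
    rw [← hcol, ← hh, sum_jointCount_left]
  simp only [← hfib]
  rw [← card_perm_comp_eq h g hfib, filter_filter]
  congr 1
  ext e
  simp only [mem_filter_univ, and_iff_right_iff_imp]
  rintro rfl
  exact hh

end Counting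

section Integral

lemma integrableOn_pow_mul_exp_neg (k : ℕ) :
    IntegrableOn (fun x : ℝ ↦ x ^ k * Real.exp (-x)) (Set.Ioi 0) := by
  simpa [mul_comm] using Real.GammaIntegral_convergent (s := k + 1) (by positivity)

lemma integral_pow_mul_exp_neg (k : ℕ) :
    ∫ x in Set.Ioi (0 : ℝ), x ^ k * Real.exp (-x) = k.factorial := by
  rw [← Real.Gamma_nat_eq_factorial, Real.Gamma_eq_integral (by positivity)]
  simp [mul_comm]

variable {ι κ : Type*} [Fintype ι] [Fintype κ]

lemma volume_restrict_pos_orthant :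
    (volume : Measure (ι → κ → ℝ)).restrict {γ | ∀ i j, 0 < γ i j} =
      Measure.pi fun _ ↦ Measure.pi fun _ ↦ volume.restrict (Set.Ioi 0) := by
  have hset : {γ : ι → κ → ℝ | ∀ i j, 0 < γ i j} =
      Set.univ.pi fun _ ↦ Set.univ.pi fun _ ↦ Set.Ioi 0 := by
    ext; simp
  simp only [hset, volume_pi, Measure.restrict_pi_pi]

lemma monomial_mul_exp_neg_eq (D : ι → κ → ℕ) (γ : ι → κ → ℝ) :
    (∏ i, ∏ j, γ i j ^ D i j) * Real.exp (-∑ i, ∑ j, γ i j) =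
      ∏ i, ∏ j, (γ i j ^ D i j * Real.exp (-γ i j)) := by
  simp only [prod_mul_distrib, ← Real.exp_sum, sum_neg_distrib]

lemma integrableOn_monomial_mul_exp_neg (D : ι → κ → ℕ) :
    IntegrableOn (fun γ : ι → κ → ℝ ↦
      (∏ i, ∏ j, γ i j ^ D i j) * Real.exp (-∑ i, ∑ j, γ i j)) {γ | ∀ i j, 0 < γ i j} := by
  simp only [IntegrableOn, volume_restrict_pos_orthant, monomial_mul_exp_neg_eq]
  exact Integrable.fintype_prod fun i ↦
    Integrable.fintype_prod (f := fun j (x : ℝ) ↦ x ^ D i j * Real.exp (-x))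
      fun j ↦ integrableOn_pow_mul_exp_neg (D i j)

lemma integral_monomial_mul_exp_neg (D : ι → κ → ℕ) :
    ∫ γ in {γ : ι → κ → ℝ | ∀ i j, 0 < γ i j},
      (∏ i, ∏ j, γ i j ^ D i j) * Real.exp (-∑ i, ∑ j, γ i j) =
      ∏ i, ∏ j, ((D i j).factorial : ℝ) := by
  simp only [volume_restrict_pos_orthant, monomial_mul_exp_neg_eq]
  rw [integral_fintype_prod_eq_prod
    (fun i (x : κ → ℝ) ↦ ∏ j, (x j ^ D i j * Real.exp (-x j)))]
  refine prod_congr rfl fun i _ ↦ ?_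
  rw [integral_fintype_prod_eq_prod (fun j (x : ℝ) ↦ x ^ D i j * Real.exp (-x))]
  exact prod_congr rfl fun j _ ↦ integral_pow_mul_exp_neg (D i j)

end Integral

end ContingencyTable

open ContingencyTable in
/-- The total weight `T(R,C;W)` of contingency tables with margins
`R = (r_i)`, `C = (c_j)` and weights `W = (w_ij)` satisfies
`∫_{ℝ^{mn}_+} per A(γ) · exp(−Σ γ_ij) dγ = r_1!⋯r_m!·c_1!⋯c_n!·T(R,C;W)`,
where `A(γ)` is the `N × N` block matrix whose `(p,q)` entry is `w_ij γ_ij` for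
`p ∈ R_i`, `q ∈ C_j`. -/
theorem expected_permanent_eq_weight_of_contingency_tables
    (m n N : ℕ) (r : Fin m → ℕ) (c : Fin n → ℕ)
    (hr : ∀ i, 0 < r i) (hc : ∀ j, 0 < c j)
    (hrN : ∑ i, r i = N) (hcN : ∑ j, c j = N)
    (W : Fin m → Fin n → ℝ) (hW : ∀ i j, 0 ≤ W i j)
    (ρ : Fin N → Fin m) (κ : Fin N → Fin n)
    (hρ : ∀ i, Nat.card {p : Fin N // ρ p = i} = r i)
    (hκ : ∀ j, Nat.card {q : Fin N // κ q = j} = c j) :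
    (∫ γ in {γ : Fin m → Fin n → ℝ | ∀ i j, 0 < γ i j},
        (∑ π : Equiv.Perm (Fin N), ∏ k, W (ρ k) (κ (π k)) * γ (ρ k) (κ (π k))) *
          Real.exp (-∑ i, ∑ j, γ i j))
      = (∏ i, (Nat.factorial (r i) : ℝ)) * (∏ j, (Nat.factorial (c j) : ℝ)) *
        ∑ᶠ D ∈ {D : Fin m → Fin n → ℕ |
            (∀ i, ∑ j, D i j = r i) ∧ (∀ j, ∑ i, D i j = c j)},
          ∏ i, ∏ j, W i j ^ D i j := by
  classical
  have hr' (i : Fin m) : Finset.card {p | ρ p = i} = r i := by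
    rw [← hρ, Nat.card_eq_fintype_card, Fintype.card_subtype]
  have hc' (j : Fin n) : Finset.card {q | κ q = j} = c j := by
    rw [← hκ, Nat.card_eq_fintype_card, Fintype.card_subtype]
  have hfin : {D : Fin m → Fin n → ℕ |
      (∀ i, ∑ j, D i j = r i) ∧ (∀ j, ∑ i, D i j = c j)}.Finite :=
    (Set.finite_Iic fun i _ ↦ r i).subset fun D hD i j ↦
      (Finset.single_le_sum (f := D i) (fun _ _ ↦ Nat.zero_le _) (Finset.mem_univ j)).trans_eq
        (hD.1 i)
  have hterm (π : Equiv.Perm (Fin N)) (γ : Fin m → Fin n → ℝ) :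
      ∏ k, W (ρ k) (κ (π k)) * γ (ρ k) (κ (π k)) =
        (∏ i, ∏ j, W i j ^ jointCount ρ (κ ∘ π) i j) *
          ∏ i, ∏ j, γ i j ^ jointCount ρ (κ ∘ π) i j := by
    rw [Finset.prod_mul_distrib, ← prod_comp_eq_prod_pow_jointCount,
      ← prod_comp_eq_prod_pow_jointCount]
    rfl
  simp only [hterm, Finset.sum_mul, mul_assoc]
  rw [integral_finsetSum _ fun π _ ↦ (integrableOn_monomial_mul_exp_neg _).const_mul _]
  simp only [integral_const_mul, integral_monomial_mul_exp_neg]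
  rw [finsum_mem_eq_finite_toFinset_sum _ hfin, ← mul_assoc, Finset.mul_sum,
    ← Finset.sum_fiberwise_of_maps_to (g := fun π : Equiv.Perm (Fin N) ↦ jointCount ρ (κ ∘ π))
      (t := hfin.toFinset)]
  · refine Finset.sum_congr rfl fun D hD ↦ ?_
    rw [hfin.mem_toFinset] at hD
    have hcount := card_perm_jointCount_eq_mul ρ κ D (fun i ↦ (hD.1 i).trans (hr' i).symm)
      fun j ↦ (hD.2 j).trans (hc' j).symm
    simp only [hr', hc'] at hcount
    rw [Finset.sum_congr rfl fun π hπ ↦ by rw [(Finset.mem_filter.mp hπ).2], Finset.sum_const,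
      nsmul_eq_mul, mul_left_comm, mul_comm]
    congr 1
    exact_mod_cast hcount
  · intro π _
    rw [hfin.mem_toFinset]
    refine ⟨fun i ↦ (sum_jointCount_right _ _ i).trans (hr' i), fun j ↦ ?_⟩
    rw [sum_jointCount_left, ← hc']
    exact Finset.card_equiv π (by simp)
end

section
/- Let r_1,…,r_m and c_1,…,c_n be positive integers with r_1+…+r_m = c_1+…+c_n = N, let W=(w_ij) be an m×n matrix of reals, and let A be the N×N matrix whose block R_i×C_j is filled with the constant w_ij. Then per A / (r_1!⋯r_m!·c_1!⋯c_n!) = Σ_D ∏_{ij} w_ij^{d_ij}/d_ij!, the sum over all contingency tables D=(d_ij) with margins R=(r_i) and C=(c_j). -/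
open Finset in
/-- Two maps with equal fibre sizes differ by a permutation of the source, and the number of such
permutations is the product of the factorials of the fibre sizes. -/
theorem card_perm_comp_eq {α β : Type*} [Fintype α] [DecidableEq α] [Fintype β] [DecidableEq β]
    (f g : α → β) (h : ∀ b, #{a | f a = b} = #{a | g a = b}) :
    #{π : Equiv.Perm α | f ∘ π = g} = ∏ b, (#{a | g a = b}).factorial := by
  have e (b : β) : {a // g a = b} ≃ {a // f a = b} :=
    Fintype.equivOfCardEq (by simp only [Fintype.card_subtype, h])
  obtain ⟨π₀, rfl⟩ : ∃ π₀ : Equiv.Perm α, f ∘ π₀ = g :=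
    ⟨Equiv.ofFiberEquiv e, funext (Equiv.ofFiberEquiv_map e)⟩
  have hs := DomMulAct.stabilizer_card f
  simp only [Fintype.card_subtype, h] at hs
  rw [← hs]
  refine (card_equiv (Equiv.mulRight π₀) fun σ ↦ ?_).symm
  simp only [mem_filter_univ, Equiv.coe_mulRight, Equiv.Perm.coe_mul, ← Function.comp_assoc]
  exact (π₀.surjective.injective_comp_right.eq_iff).symm

/-- There is a map with prescribed fibre sizes adding up to the size of the source. -/
theorem exists_map_card_fiber_eq {α β : Type*} [Fintype α] [Fintype β] [DecidableEq β]
    (d : β → ℕ) (hd : ∑ b, d b = Fintype.card α) :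
    ∃ f : α → β, ∀ b, (Finset.univ.filter fun a ↦ f a = b).card = d b := by
  have e : α ≃ Σ b, Fin (d b) := Fintype.equivOfCardEq (by simp [hd])
  refine ⟨fun a ↦ (e a).1, fun b ↦ ?_⟩
  rw [← Fintype.card_subtype, ← Fintype.card_fin (d b)]
  exact Fintype.card_congr
    ((e.subtypeEquiv fun _ ↦ Iff.rfl).trans (Equiv.sigmaSubtype b))

open Finset in
/-- The number of permutations whose contingency table with respect to the labellings `ρ` and `κ`
is `D`, in multiplied-out form. -/
theorem card_perm_table_mul {α ι J : Type*} [Fintype α] [DecidableEq α] [Fintype ι] [DecidableEq ι]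
    [Fintype J] [DecidableEq J] (ρ : α → ι) (κ : α → J) (D : ι → J → ℕ)
    (hρ : ∀ i, ∑ j, D i j = #{a | ρ a = i}) (hκ : ∀ j, ∑ i, D i j = #{a | κ a = j}) :
    #{π : Equiv.Perm α | (fun i j ↦ #{a | ρ a = i ∧ κ (π a) = j}) = D}
        * ∏ i, ∏ j, (D i j).factorial
      = (∏ i, (#{a | ρ a = i}).factorial) * ∏ j, (#{a | κ a = j}).factorial := by
  obtain ⟨f, hf⟩ := exists_map_card_fiber_eq (α := α) (fun p : ι × J ↦ D p.1 p.2) (by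
    rw [Fintype.sum_prod_type]
    simp only [hρ]
    exact (card_eq_sum_card_fiberwise fun _ _ ↦ mem_univ _).symm)
  have hf₁ (i : ι) : #{a | ρ a = i} = #{a | (Prod.fst ∘ f) a = i} := by
    rw [← hρ, card_eq_sum_card_fiberwise (f := fun a ↦ (f a).2) (t := univ) (fun _ _ ↦ mem_univ _)]
    refine sum_congr rfl fun j _ ↦ ?_
    rw [← hf (i, j), filter_filter]
    simp [Prod.ext_iff]
  have hf₂ (j : J) : #{a | κ a = j} = #{a | (Prod.snd ∘ f) a = j} := by
    rw [← hκ, card_eq_sum_card_fiberwise (f := fun a ↦ (f a).1) (t := univ) (fun _ _ ↦ mem_univ _)]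
    refine sum_congr rfl fun i _ ↦ ?_
    rw [← hf (i, j), filter_filter]
    simp [Prod.ext_iff, and_comm]
  have count (π : Equiv.Perm α) :
      #{σ : Equiv.Perm α | ρ ∘ σ = Prod.fst ∘ f ∧ κ ∘ (π * σ) = Prod.snd ∘ f}
        = if (fun i j ↦ #{a | ρ a = i ∧ κ (π a) = j}) = D then ∏ i, ∏ j, (D i j).factorial
          else 0 := by
    have hiff (σ : Equiv.Perm α) : (ρ ∘ σ = Prod.fst ∘ f ∧ κ ∘ (π * σ) = Prod.snd ∘ f) ↔
        (fun a ↦ (ρ a, κ (π a))) ∘ σ = f := by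
      simp only [funext_iff, Function.comp_apply, Prod.ext_iff, Equiv.Perm.coe_mul, forall_and]
    simp only [hiff]
    split_ifs with hD
    · rw [card_perm_comp_eq, Fintype.prod_prod_type]
      · simp only [hf]
      · rintro ⟨i, j⟩
        rw [hf, ← hD]
        simp only [Prod.mk.injEq]
    · rw [card_eq_zero, filter_eq_empty_iff]
      rintro σ - hσ
      refine hD (funext₂ fun i j ↦ ?_)
      rw [← hf (i, j)]
      refine (card_equiv σ fun a ↦ ?_).symm
      simp [← hσ]
  calc _ = ∑ π : Equiv.Perm α,
        #{σ : Equiv.Perm α | ρ ∘ σ = Prod.fst ∘ f ∧ κ ∘ (π * σ) = Prod.snd ∘ f} := by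
        simp only [count, ← sum_filter, sum_const, smul_eq_mul]
    _ = ∑ σ ∈ univ.filter fun σ : Equiv.Perm α ↦ ρ ∘ σ = Prod.fst ∘ f,
        #{π : Equiv.Perm α | κ ∘ (π * σ) = Prod.snd ∘ f} := by
        simp only [card_filter, ite_and, sum_filter]
        rw [sum_comm]
        refine sum_congr rfl fun σ _ ↦ ?_
        split_ifs <;> simp
    _ = ∑ σ ∈ univ.filter fun σ : Equiv.Perm α ↦ ρ ∘ σ = Prod.fst ∘ f,
        #{π : Equiv.Perm α | κ ∘ π = Prod.snd ∘ f} :=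
        sum_congr rfl fun σ _ ↦ card_equiv (Equiv.mulRight σ) fun π ↦ by
          simp only [mem_filter_univ, Equiv.coe_mulRight]
    _ = _ := by
        rw [sum_const, smul_eq_mul, card_perm_comp_eq _ _ hf₁, card_perm_comp_eq _ _ hf₂]
        simp only [hf₁, hf₂]


/-- If the `N × N` matrix `A` has its block `R_i × C_j` filled with the
constant `w_ij`, then `per A / (r_1!⋯r_m!·c_1!⋯c_n!) = Σ_D ∏_{ij} w_ij^{d_ij}/d_ij!`,
the sum over all contingency tables `D` with margins `R`, `C` (the Fisher–Yates
statistics). -/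
theorem permanent_of_block_constant_matrix
    (m n N : ℕ) (r : Fin m → ℕ) (c : Fin n → ℕ)
    (hr : ∀ i, 0 < r i) (hc : ∀ j, 0 < c j)
    (hrN : ∑ i, r i = N) (hcN : ∑ j, c j = N)
    (W : Fin m → Fin n → ℝ)
    (ρ : Fin N → Fin m) (κ : Fin N → Fin n)
    (hρ : ∀ i, Nat.card {p : Fin N // ρ p = i} = r i)
    (hκ : ∀ j, Nat.card {q : Fin N // κ q = j} = c j) :
    (∑ π : Equiv.Perm (Fin N), ∏ k, W (ρ k) (κ (π k)))
        / ((∏ i, (Nat.factorial (r i) : ℝ)) * ∏ j, (Nat.factorial (c j) : ℝ))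
      = ∑ᶠ D ∈ {D : Fin m → Fin n → ℕ |
            (∀ i, ∑ j, D i j = r i) ∧ (∀ j, ∑ i, D i j = c j)},
          ∏ i, ∏ j, W i j ^ D i j / (Nat.factorial (D i j) : ℝ) := by
  classical
  simp only [Nat.card_eq_fintype_card, Fintype.card_subtype] at hρ hκ
  have hfin : {D : Fin m → Fin n → ℕ |
      (∀ i, ∑ j, D i j = r i) ∧ (∀ j, ∑ i, D i j = c j)}.Finite :=
    (Set.finite_Iic fun i _ ↦ r i).subset fun D hD i j ↦
      (Finset.single_le_sum (fun _ _ ↦ Nat.zero_le _) (Finset.mem_univ j)).trans_eq (hD.1 i)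
  rw [finsum_mem_eq_finite_toFinset_sum _ hfin, div_eq_iff (by positivity), Finset.sum_mul]
  let table (π : Equiv.Perm (Fin N)) (i : Fin m) (j : Fin n) : ℕ :=
    (Finset.univ.filter fun a ↦ ρ a = i ∧ κ (π a) = j).card
  have htable (π : Equiv.Perm (Fin N)) : table π ∈ hfin.toFinset := by
    rw [Set.Finite.mem_toFinset]
    refine ⟨fun i ↦ ?_, fun j ↦ ?_⟩
    · rw [← hρ, Finset.card_eq_sum_card_fiberwise (f := fun a ↦ κ (π a)) (t := Finset.univ)
        (fun _ _ ↦ Finset.mem_univ _)]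
      simp only [Finset.filter_filter, table]
    · have hπ : (Finset.univ.filter fun a ↦ κ (π a) = j).card = c j := by
        rw [← hκ]
        exact Finset.card_equiv π fun a ↦ by simp
      rw [← hπ, Finset.card_eq_sum_card_fiberwise (f := ρ) (t := Finset.univ)
        (fun _ _ ↦ Finset.mem_univ _)]
      simp only [Finset.filter_filter, table, and_comm]
  have hprod (π : Equiv.Perm (Fin N)) :
      ∏ k, W (ρ k) (κ (π k)) = ∏ i, ∏ j, W i j ^ table π i j := by
    rw [← Fintype.prod_prod_type' fun i j ↦ W i j ^ table π i j,
      ← Finset.prod_fiberwise Finset.univ fun k ↦ (ρ k, κ (π k))]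
    refine Finset.prod_congr rfl fun p _ ↦ ?_
    simp only [table, ← Prod.mk_inj, Prod.mk.eta]
    refine Finset.prod_eq_pow_card fun k hk ↦ ?_
    rw [← (Finset.mem_filter.mp hk).2]
  rw [← Finset.sum_fiberwise_of_maps_to fun π _ ↦ htable π]
  refine Finset.sum_congr rfl fun D hD ↦ ?_
  obtain ⟨hDr, hDc⟩ := hfin.mem_toFinset.mp hD
  have hcard := card_perm_table_mul ρ κ D (by simpa only [hρ] using hDr)
    (by simpa only [hκ] using hDc)
  simp only [hρ, hκ] at hcard
  have hcard' := congrArg (Nat.cast : ℕ → ℝ) hcard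
  push_cast at hcard'
  rw [← hcard', Finset.sum_congr rfl fun π hπ ↦ by rw [hprod, (Finset.mem_filter.mp hπ).2],
    Finset.sum_const, nsmul_eq_mul]
  simp only [Finset.prod_div_distrib]
  have hne : ∏ i, ∏ j, ((D i j).factorial : ℝ) ≠ 0 := by positivity
  field_simp
  exact mul_comm _ _
end

section
/- For every N×N matrix A=(a_ij) with strictly positive real entries there exist positive reals ξ_1,…,ξ_N and η_1,…,η_N and an N×N matrix B=(b_ij) with strictly positive entries such that: (1) a_ij = b_ij·ξ_i·η_j for all i,j; (2) ∏_{j=1}^N η_j = 1; and (3) B is doubly stochastic, i.e., all row sums and all column sums of B equal 1. -/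
open Real in
/-- The logarithm of the product of the row sums of `(A i j * exp (y j))`, minus `∑ j, y j`.
Its critical points are the scalings that make `A` doubly stochastic. -/
noncomputable def scalingPotential {ι : Type*} [Fintype ι] (A : ι → ι → ℝ) (y : ι → ℝ) : ℝ :=
  ∑ i, log (∑ j, A i j * exp (y j)) - ∑ j, y j

namespace scalingPotential

open Real

variable {ι : Type*} [Fintype ι] {A : ι → ι → ℝ}

lemma rowSum_pos (hA : ∀ i j, 0 < A i j) (y : ι → ℝ) (i : ι) :
    0 < ∑ j, A i j * exp (y j) :=
  Finset.sum_pos (fun j _ ↦ mul_pos (hA i j) (exp_pos _)) ⟨i, Finset.mem_univ i⟩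

lemma continuous (hA : ∀ i j, 0 < A i j) : Continuous (scalingPotential A) := by
  unfold scalingPotential
  refine Continuous.sub (continuous_finsetSum _ fun i _ ↦ ?_) (by fun_prop)
  exact Continuous.log (by fun_prop) fun y ↦ (rowSum_pos hA y i).ne'

lemma sub_const (hA : ∀ i j, 0 < A i j) (y : ι → ℝ) (c : ℝ) :
    scalingPotential A (fun j ↦ y j - c) = scalingPotential A y := by
  have h (i : ι) : log (∑ j, A i j * exp (y j - c)) = log (∑ j, A i j * exp (y j)) - c := by
    simp_rw [exp_sub, ← mul_div_assoc, ← Finset.sum_div]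
    rw [log_div (rowSum_pos hA y i).ne' (exp_pos c).ne', log_exp]
  simp only [scalingPotential, h, Finset.sum_sub_distrib]
  ring

lemma sum_log_add_le (hA : ∀ i j, 0 < A i j) {y : ι → ℝ} (hy : ∑ j, y j = 0) (j : ι) :
    ∑ i, log (A i j) + Fintype.card ι * y j ≤ scalingPotential A y := by
  have h (i : ι) : log (A i j) + y j ≤ log (∑ j, A i j * exp (y j)) := by
    have hle : A i j * exp (y j) ≤ ∑ j, A i j * exp (y j) :=
      Finset.single_le_sum (f := fun j ↦ A i j * exp (y j))
        (fun k _ ↦ (mul_pos (hA i k) (exp_pos _)).le) (Finset.mem_univ j)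
    have := log_le_log (mul_pos (hA i j) (exp_pos _)) hle
    rwa [log_mul (hA i j).ne' (exp_pos _).ne', log_exp] at this
  have := Finset.sum_le_sum fun i (_ : i ∈ Finset.univ) ↦ h i
  simpa [scalingPotential, hy, Finset.sum_add_distrib] using this

lemma isCompact_sublevel (hA : ∀ i j, 0 < A i j) (r : ℝ) :
    IsCompact {y : ι → ℝ | ∑ j, y j = 0 ∧ scalingPotential A y ≤ r} := by
  set u : ι → ℝ := fun j ↦ (r - ∑ i, log (A i j)) / Fintype.card ι
  refine (isCompact_Icc (a := fun j ↦ u j - ∑ k, u k) (b := u)).of_isClosed_subset ?_ ?_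
  · exact (isClosed_eq (by fun_prop) continuous_const).inter
      (isClosed_le (continuous hA) continuous_const)
  · rintro y ⟨hy, hr⟩
    have hle (j : ι) : y j ≤ u j := by
      have : Nonempty ι := ⟨j⟩
      rw [le_div_iff₀ (by exact_mod_cast Fintype.card_pos)]
      linarith [sum_log_add_le hA hy j]
    refine ⟨fun j ↦ ?_, hle⟩
    have := Finset.single_le_sum (f := fun k ↦ u k - y k)
      (fun k _ ↦ sub_nonneg.2 (hle k)) (Finset.mem_univ j)
    rw [Finset.sum_sub_distrib, hy] at this
    change u j - ∑ k, u k ≤ y j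
    linarith

lemma exists_forall_le (hA : ∀ i j, 0 < A i j) :
    ∃ y : ι → ℝ, ∑ j, y j = 0 ∧ ∀ z, scalingPotential A y ≤ scalingPotential A z := by
  obtain ⟨y, ⟨hy, hy0⟩, hmin⟩ := (isCompact_sublevel hA (scalingPotential A 0)).exists_isMinOn
    ⟨0, by simp⟩ (continuous hA).continuousOn
  refine ⟨y, hy, fun z ↦ ?_⟩
  rw [← sub_const hA z ((∑ j, z j) / Fintype.card ι)]
  set w : ι → ℝ := fun j ↦ z j - (∑ j, z j) / Fintype.card ι with hw
  have hw0 : ∑ j, w j = 0 := by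
    rcases isEmpty_or_nonempty ι with _ | _
    · simp
    · have : (Fintype.card ι : ℝ) ≠ 0 := by exact_mod_cast Fintype.card_ne_zero
      simp [hw, Finset.sum_sub_distrib, mul_div_cancel₀ _ this]
  rcases le_total (scalingPotential A w) (scalingPotential A 0) with h | h
  · exact hmin ⟨hw0, h⟩
  · exact hy0.trans h

lemma colSum_eq_one (hA : ∀ i j, 0 < A i j) {y : ι → ℝ}
    (hmin : ∀ z, scalingPotential A y ≤ scalingPotential A z) (j : ι) :
    ∑ i, A i j * exp (y j) / ∑ k, A i k * exp (y k) = 1 := by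
  classical
  have hcoord (k : ι) : HasDerivAt (fun t : ℝ ↦ y k + t * (if k = j then 1 else 0))
      (if k = j then 1 else 0) 0 := by
    simpa using ((hasDerivAt_id (0 : ℝ)).mul_const (if k = j then (1 : ℝ) else 0)).const_add (y k)
  have hrow (i : ι) : HasDerivAt
      (fun t : ℝ ↦ log (∑ k, A i k * exp (y k + t * (if k = j then 1 else 0))))
      (A i j * exp (y j) / ∑ k, A i k * exp (y k)) 0 := by
    have h := HasDerivAt.fun_sum (u := Finset.univ)
      fun k _ ↦ ((hcoord k).exp.const_mul (A i k))
    simpa using h.log (by simpa using (rowSum_pos hA y i).ne')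
  have hderiv : HasDerivAt
      (fun t : ℝ ↦ scalingPotential A fun k ↦ y k + t * (if k = j then 1 else 0))
      (∑ i, A i j * exp (y j) / ∑ k, A i k * exp (y k) - 1) 0 := by
    have h := (HasDerivAt.fun_sum (u := Finset.univ) fun i _ ↦ hrow i).sub
      (HasDerivAt.fun_sum (u := Finset.univ) fun k _ ↦ hcoord k)
    rw [Finset.sum_ite_eq', if_pos (Finset.mem_univ j)] at h
    exact h
  have hloc : IsLocalMin
      (fun t : ℝ ↦ scalingPotential A fun k ↦ y k + t * (if k = j then 1 else 0)) 0 :=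
    Filter.Eventually.of_forall fun t ↦ by simpa using hmin _
  exact sub_eq_zero.1 (hloc.hasDerivAt_eq_zero hderiv)

end scalingPotential

/-- matrix scaling, existence. Every `N × N` matrix with strictly
positive entries can be scaled: `a_ij = b_ij ξ_i η_j` with `ξ_i, η_j > 0`, `B` positive
and doubly stochastic, and `∏_j η_j = 1`. -/
theorem exists_matrix_scaling
    (N : ℕ) (A : Fin N → Fin N → ℝ) (hA : ∀ i j, 0 < A i j) :
    ∃ (ξ η : Fin N → ℝ) (B : Fin N → Fin N → ℝ),
      (∀ i, 0 < ξ i) ∧ (∀ j, 0 < η j) ∧ (∀ i j, 0 < B i j) ∧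
      (∀ i j, A i j = B i j * ξ i * η j) ∧
      (∏ j, η j = 1) ∧
      (∀ i, ∑ j, B i j = 1) ∧ (∀ j, ∑ i, B i j = 1) := by
  obtain ⟨y, hy, hmin⟩ := scalingPotential.exists_forall_le hA
  have hpos := scalingPotential.rowSum_pos hA y
  refine ⟨fun i ↦ ∑ k, A i k * Real.exp (y k), fun j ↦ Real.exp (-y j),
    fun i j ↦ A i j * Real.exp (y j) / ∑ k, A i k * Real.exp (y k), hpos,
    fun j ↦ Real.exp_pos _, fun i j ↦ div_pos (mul_pos (hA i j) (Real.exp_pos _)) (hpos i),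
    fun i j ↦ ?_, ?_, fun i ↦ ?_, scalingPotential.colSum_eq_one hA hmin⟩
  · rw [div_mul_cancel₀ _ (hpos i).ne', mul_assoc, ← Real.exp_add, add_neg_cancel, Real.exp_zero,
      mul_one]
  · rw [← Real.exp_sum, Finset.sum_neg_distrib, hy, neg_zero, Real.exp_zero]
  · rw [← Finset.sum_div, div_self (hpos i).ne']
end

section
/- Let A=(a_ij) be an N×N matrix with strictly positive entries. Suppose ξ_1,…,ξ_N, η_1,…,η_N and ξ'_1,…,ξ'_N, η'_1,…,η'_N are positive reals and B, B' are doubly stochastic N×N matrices with a_ij = b_ij·ξ_i·η_j = b'_ij·ξ'_i·η'_j for all i,j, and with ∏_j η_j = ∏_j η'_j = 1. Then B = B', ξ_i = ξ'_i for all i, and η_j = η'_j for all j. In particular, the quantity σ(A) = ∏_{i=1}^N ξ_i·η_i is well defined, i.e., it takes the same value for any scaling of A (even without the normalization ∏_j η_j = 1). -/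
/-- A scaling of a positive `N × N` matrix `A`: positive vectors `ξ, η` and a doubly
stochastic matrix `B` with `a_ij = b_ij ξ_i η_j` for all `i, j`. -/
def IsScaling (N : ℕ) (A : Fin N → Fin N → ℝ) (ξ η : Fin N → ℝ)
    (B : Fin N → Fin N → ℝ) : Prop :=
  (∀ i, 0 < ξ i) ∧ (∀ j, 0 < η j) ∧ (∀ i j, 0 ≤ B i j) ∧
  (∀ i, ∑ j, B i j = 1) ∧ (∀ j, ∑ i, B i j = 1) ∧
  (∀ i j, A i j = B i j * ξ i * η j)

/-- If a positive matrix with unit row and column sums keeps unit row and column sums after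
rescaling its rows by a positive vector `x` and its columns by `y`, then the rescaling is
trivial. -/
lemma mul_eq_one_of_rescaled_sums_eq_one {m n : Type*} [Fintype m] [Fintype n]
    {B : m → n → ℝ} {x : m → ℝ} {y : n → ℝ} (hB : ∀ i j, 0 < B i j) (hx : ∀ i, 0 < x i)
    (hrow : ∀ i, ∑ j, B i j = 1) (hcol : ∀ j, ∑ i, B i j = 1)
    (hrow' : ∀ i, ∑ j, B i j * (x i * y j) = 1) (hcol' : ∀ j, ∑ i, B i j * (x i * y j) = 1)
    (i : m) (j : n) : x i * y j = 1 := by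
  have : Nonempty n := ⟨j⟩
  obtain ⟨k, hk⟩ := Finite.exists_max y
  have hge : ∀ i, 1 ≤ x i * y k := fun i => by
    calc 1 = ∑ j, B i j * (x i * y j) := (hrow' i).symm
      _ ≤ ∑ j, B i j * (x i * y k) := Finset.sum_le_sum fun j _ =>
        mul_le_mul_of_nonneg_left (mul_le_mul_of_nonneg_left (hk j) (hx i).le) (hB i j).le
      _ = x i * y k := by rw [← Finset.sum_mul, hrow, one_mul]
  have heq : ∀ i, x i * y k = 1 := fun i => by
    have hle : ∀ i ∈ Finset.univ, B i k ≤ B i k * (x i * y k) := fun i _ =>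
      le_mul_of_one_le_right (hB i k).le (hge i)
    have h := (Finset.sum_eq_sum_iff_of_le hle).1 ((hcol k).trans (hcol' k).symm) i
      (Finset.mem_univ i)
    exact (left_eq_mul₀ (hB i k).ne').1 h
  have hconst : ∀ i', x i' = x i := fun i' => by
    have hy : y k ≠ 0 := fun h => by simpa [h] using heq i
    exact mul_right_cancel₀ hy ((heq i').trans (heq i).symm)
  have h := hcol' j
  simp only [hconst] at h
  rwa [← Finset.sum_mul, hcol, one_mul] at h

/-- Any two scalings of a positive matrix have the same scaling factors `ξ i * η j`. -/
lemma IsScaling.mul_eq_mul {N : ℕ} {A : Fin N → Fin N → ℝ} {ξ η ξ' η' : Fin N → ℝ}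
    {B B' : Fin N → Fin N → ℝ} (hA : ∀ i j, 0 < A i j) (hs : IsScaling N A ξ η B)
    (hs' : IsScaling N A ξ' η' B') (i j : Fin N) : ξ i * η j = ξ' i * η' j := by
  obtain ⟨hξ, hη, hB, hrow, hcol, h⟩ := hs
  obtain ⟨hξ', hη', -, hrow', hcol', h'⟩ := hs'
  have hBpos : ∀ i j, 0 < B i j := fun i j => (hB i j).lt_of_ne fun h0 => by
    have := hA i j
    simp [h i j, ← h0] at this
  have hB' : ∀ i j, B i j * (ξ i / ξ' i * (η j / η' j)) = B' i j := fun i j => by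
    have := hξ' i
    have := hη' j
    have := (h i j).symm.trans (h' i j)
    field_simp
    linarith
  have key := mul_eq_one_of_rescaled_sums_eq_one (x := fun i => ξ i / ξ' i)
    (y := fun j => η j / η' j) hBpos (fun i => div_pos (hξ i) (hξ' i)) hrow hcol
    (fun i => by simp only [hB', hrow']) (fun j => by simp only [hB', hcol']) i j
  rwa [div_mul_div_comm, div_eq_one_iff_eq (mul_pos (hξ' i) (hη' j)).ne'] at key

/-- matrix scaling, uniqueness. A scaling of a positive matrix with the
normalization `∏_j η_j = 1` is unique; in particular `σ(A) = ∏_i ξ_i η_i` takes the same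
value for any scaling of `A`, even without the normalization. -/
theorem matrix_scaling_unique
    (N : ℕ) (A : Fin N → Fin N → ℝ) (hA : ∀ i j, 0 < A i j)
    (ξ η ξ' η' : Fin N → ℝ) (B B' : Fin N → Fin N → ℝ)
    (hs : IsScaling N A ξ η B) (hs' : IsScaling N A ξ' η' B')
    (hη : ∏ j, η j = 1) (hη' : ∏ j, η' j = 1) :
    B = B' ∧ ξ = ξ' ∧ η = η' ∧
    ∀ (ξ₂ η₂ ξ₃ η₃ : Fin N → ℝ) (B₂ B₃ : Fin N → Fin N → ℝ),
      IsScaling N A ξ₂ η₂ B₂ → IsScaling N A ξ₃ η₃ B₃ →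
        ∏ i, ξ₂ i * η₂ i = ∏ i, ξ₃ i * η₃ i := by
  have key := hs.mul_eq_mul hA hs'
  have hηη : η = η' := by
    funext j
    have hprod : ∏ k, ξ j * η k = ∏ k, ξ' j * η' k := Finset.prod_congr rfl fun k _ => key j k
    rw [Finset.prod_mul_distrib, Finset.prod_mul_distrib, hη, hη', mul_one, mul_one,
      Finset.prod_const, Finset.prod_const] at hprod
    have hcard : (Finset.univ : Finset (Fin N)).card ≠ 0 :=
      Finset.card_ne_zero.2 ⟨j, Finset.mem_univ j⟩
    have hξj := (pow_left_inj₀ (hs.1 j).le (hs'.1 j).le hcard).1 hprod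
    exact mul_left_cancel₀ (hs.1 j).ne' ((key j j).trans (by rw [hξj]))
  subst hηη
  refine ⟨?_, ?_, rfl, fun ξ₂ η₂ ξ₃ η₃ B₂ B₃ h₂ h₃ =>
    Finset.prod_congr rfl fun i _ => h₂.mul_eq_mul hA h₃ i i⟩
  · funext i j
    obtain ⟨hξ, hη, -, -, -, h⟩ := hs
    obtain ⟨-, -, -, -, -, h'⟩ := hs'
    have hij := (h i j).symm.trans (h' i j)
    rw [mul_assoc, mul_assoc, ← key i j] at hij
    exact mul_right_cancel₀ (mul_pos (hξ i) (hη j)).ne' hij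
  · funext i
    exact mul_right_cancel₀ (hs.2.1 i).ne' (key i i)
end

section
/- The function σ is log-concave on positive matrices: if A_1 and A_2 are N×N matrices with strictly positive entries, α_1, α_2 ≥ 0 with α_1+α_2 = 1, and (ξ^{(1)},η^{(1)},B_1), (ξ^{(2)},η^{(2)},B_2), (ξ,η,B) are scalings of A_1, A_2, and α_1 A_1 + α_2 A_2 respectively, then ln(∏_i ξ_i η_i) ≥ α_1·ln(∏_i ξ^{(1)}_i η^{(1)}_i) + α_2·ln(∏_i ξ^{(2)}_i η^{(2)}_i). -/
/-- The logarithm of `σ(A)` is bounded above by a functional affine in `A`,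
`∑ᵢⱼ aᵢⱼ / (xᵢ yⱼ) - N + log ∏ᵢ xᵢ yᵢ`, for all positive vectors `x, y`. -/
theorem IsScaling.log_prod_le {N : ℕ} {A B : Fin N → Fin N → ℝ} {ξ η : Fin N → ℝ}
    (h : IsScaling N A ξ η B) {x y : Fin N → ℝ} (hx : ∀ i, 0 < x i) (hy : ∀ j, 0 < y j) :
    Real.log (∏ i, ξ i * η i) ≤
      ∑ i, ∑ j, A i j / (x i * y j) - N + Real.log (∏ i, x i * y i) := by
  obtain ⟨hξ, hη, hB, hrow, hcol, hA⟩ := h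
  have log_prod_eq : ∀ u v : Fin N → ℝ, (∀ i, 0 < u i) → (∀ i, 0 < v i) →
      Real.log (∏ i, u i * v i) = ∑ i, ∑ j, B i j * (Real.log (u i) + Real.log (v j)) := by
    intro u v hu hv
    rw [Real.log_prod fun i _ => (mul_pos (hu i) (hv i)).ne']
    simp_rw [mul_add, Finset.sum_add_distrib]
    rw [Finset.sum_comm (f := fun i j => B i j * Real.log (v j))]
    simp_rw [← Finset.sum_mul, hrow, hcol, one_mul, ← Finset.sum_add_distrib]
    exact Finset.sum_congr rfl fun i _ => Real.log_mul (hu i).ne' (hv i).ne'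
  have hN : (N : ℝ) = ∑ i, ∑ j, B i j := by simp [hrow]
  rw [log_prod_eq ξ η hξ hη, log_prod_eq x y hx hy, hN]
  simp_rw [← Finset.sum_sub_distrib, ← Finset.sum_add_distrib]
  refine Finset.sum_le_sum fun i _ => Finset.sum_le_sum fun j _ => ?_
  have hξη := mul_pos (hξ i) (hη j)
  have hxy := mul_pos (hx i) (hy j)
  have hlog := Real.log_le_sub_one_of_pos (div_pos hξη hxy)
  rw [Real.log_div hξη.ne' hxy.ne', Real.log_mul (hξ i).ne' (hη j).ne',
    Real.log_mul (hx i).ne' (hy j).ne'] at hlog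
  rw [hA, mul_assoc, mul_div_assoc]
  linarith [mul_le_mul_of_nonneg_left hlog (hB i j)]

/-- `σ` is log-concave on positive matrices:
`ln σ(α₁A₁ + α₂A₂) ≥ α₁ ln σ(A₁) + α₂ ln σ(A₂)`. -/
theorem sigma_log_concave
    (N : ℕ) (A₁ A₂ : Fin N → Fin N → ℝ)
    (hA₁ : ∀ i j, 0 < A₁ i j) (hA₂ : ∀ i j, 0 < A₂ i j)
    (α₁ α₂ : ℝ) (hα₁ : 0 ≤ α₁) (hα₂ : 0 ≤ α₂) (hα : α₁ + α₂ = 1)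
    (ξ₁ η₁ ξ₂ η₂ ξ η : Fin N → ℝ) (B₁ B₂ B : Fin N → Fin N → ℝ)
    (hs₁ : IsScaling N A₁ ξ₁ η₁ B₁) (hs₂ : IsScaling N A₂ ξ₂ η₂ B₂)
    (hs : IsScaling N (fun i j => α₁ * A₁ i j + α₂ * A₂ i j) ξ η B) :
    α₁ * Real.log (∏ i, ξ₁ i * η₁ i) + α₂ * Real.log (∏ i, ξ₂ i * η₂ i)
      ≤ Real.log (∏ i, ξ i * η i) := by
  obtain ⟨hξ, hη, -, hrow, -, hA⟩ := hs
  have hsum : α₁ * ∑ i, ∑ j, A₁ i j / (ξ i * η j) + α₂ * ∑ i, ∑ j, A₂ i j / (ξ i * η j) = N := by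
    have hN : (N : ℝ) = ∑ i, ∑ j, B i j := by simp [hrow]
    rw [hN]
    simp_rw [Finset.mul_sum, ← Finset.sum_add_distrib]
    refine Finset.sum_congr rfl fun i _ => Finset.sum_congr rfl fun j _ => ?_
    rw [← mul_div_assoc, ← mul_div_assoc, ← add_div,
      div_eq_iff (mul_pos (hξ i) (hη j)).ne', ← mul_assoc]
    exact hA i j
  have hle₁ := mul_le_mul_of_nonneg_left (hs₁.log_prod_le hξ hη) hα₁
  have hle₂ := mul_le_mul_of_nonneg_left (hs₂.log_prod_le hξ hη) hα₂
  obtain rfl : α₂ = 1 - α₁ := by linarith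
  linarith
end

section
/- Let A=(a_ij) be an N×N matrix with strictly positive entries and let (ξ,η,B) be a scaling of A with ∏_j η_j = 1. Then ln σ(A) = Σ_{i=1}^N ln ξ_i equals the minimum of f_A(t) over t in the hyperplane H; moreover the minimum is attained at the point t* with coordinates τ_j = −ln η_j. -/
/-- Jensen's inequality for the exponential, in logarithmic form: a weighted mean is at most the
logarithm of the weighted mean of exponentials. -/
theorem sum_mul_le_log_sum_mul_exp {ι : Type*} [Fintype ι] {w : ι → ℝ} (hw : ∀ j, 0 ≤ w j)
    (hsum : ∑ j, w j = 1) (x : ι → ℝ) :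
    ∑ j, w j * x j ≤ Real.log (∑ j, w j * Real.exp (x j)) := by
  have hexp := convexOn_exp.map_sum_le (t := Finset.univ) (w := w) (p := x)
    (fun j _ => hw j) hsum (fun j _ => Set.mem_univ _)
  simp only [smul_eq_mul] at hexp
  exact (Real.le_log_iff_exp_le ((Real.exp_pos _).trans_le hexp)).2 hexp

/-- For a positive `N × N` matrix `A` with scaling `(ξ, η, B)` normalized
by `∏_j η_j = 1`, one has `ln σ(A) = Σ_i ln ξ_i = min_{t ∈ H} f_A(t)`, where
`f_A(t) = Σ_i ln (Σ_j a_ij e^{τ_j})` and `H = {t : Σ_i τ_i = 0}`; the minimum is attained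
at the point `t*` with coordinates `τ_j = −ln η_j`. -/
theorem log_sigma_eq_min_of_fA
    (N : ℕ) (A : Fin N → Fin N → ℝ) (hA : ∀ i j, 0 < A i j)
    (ξ η : Fin N → ℝ) (B : Fin N → Fin N → ℝ)
    (hξ : ∀ i, 0 < ξ i) (hη : ∀ j, 0 < η j) (hB : ∀ i j, 0 ≤ B i j)
    (hrow : ∀ i, ∑ j, B i j = 1) (hcol : ∀ j, ∑ i, B i j = 1)
    (hAB : ∀ i j, A i j = B i j * ξ i * η j)
    (hnorm : ∏ j, η j = 1) :
    Real.log (∏ i, ξ i * η i) = ∑ i, Real.log (ξ i) ∧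
    (∑ j, -Real.log (η j)) = 0 ∧
    (∑ i, Real.log (∑ j, A i j * Real.exp (-Real.log (η j)))) = ∑ i, Real.log (ξ i) ∧
    ∀ t : Fin N → ℝ, (∑ i, t i) = 0 →
      ∑ i, Real.log (ξ i) ≤ ∑ i, Real.log (∑ j, A i j * Real.exp (t j)) := by
  have hlog : ∑ j, Real.log (η j) = 0 := by
    rw [← Real.log_prod (fun j _ => (hη j).ne'), hnorm, Real.log_one]
  refine ⟨?_, ?_, ?_, fun t ht => ?_⟩
  · rw [Finset.prod_mul_distrib, hnorm, mul_one, Real.log_prod (fun i _ => (hξ i).ne')]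
  · rw [Finset.sum_neg_distrib, hlog, neg_zero]
  · refine Finset.sum_congr rfl fun i _ => congrArg Real.log ?_
    calc ∑ j, A i j * Real.exp (-Real.log (η j)) = ∑ j, B i j * ξ i := by
          refine Finset.sum_congr rfl fun j _ => ?_
          rw [hAB, Real.exp_neg, Real.exp_log (hη j), mul_assoc, mul_inv_cancel₀ (hη j).ne', mul_one]
      _ = ξ i := by rw [← Finset.sum_mul, hrow, one_mul]
  · have hrow_bound : ∀ i, Real.log (ξ i) + ∑ j, B i j * (Real.log (η j) + t j) ≤
        Real.log (∑ j, A i j * Real.exp (t j)) := by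
      intro i
      have hfactor : ∑ j, A i j * Real.exp (t j) =
          ξ i * ∑ j, B i j * Real.exp (Real.log (η j) + t j) := by
        rw [Finset.mul_sum]
        refine Finset.sum_congr rfl fun j _ => ?_
        rw [hAB, Real.exp_add, Real.exp_log (hη j)]
        ring
      have hpos : 0 < ∑ j, A i j * Real.exp (t j) :=
        Finset.sum_pos (fun j _ => mul_pos (hA i j) (Real.exp_pos _)) ⟨i, Finset.mem_univ i⟩
      rw [hfactor] at hpos ⊢
      rw [Real.log_mul (hξ i).ne' (pos_of_mul_pos_right hpos (hξ i).le).ne']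
      gcongr
      exact sum_mul_le_log_sum_mul_exp (hB i) (hrow i) _
    have hmean : ∑ i, ∑ j, B i j * (Real.log (η j) + t j) = 0 := by
      rw [Finset.sum_comm]
      simp_rw [← Finset.sum_mul, hcol, one_mul]
      rw [Finset.sum_add_distrib, hlog, ht, add_zero]
    calc ∑ i, Real.log (ξ i)
        = ∑ i, (Real.log (ξ i) + ∑ j, B i j * (Real.log (η j) + t j)) := by
          rw [Finset.sum_add_distrib, hmean, add_zero]
      _ ≤ _ := Finset.sum_le_sum fun i _ => hrow_bound i
end

section
/- σ is monotone: if A=(a_ij) and A'=(a'_ij) are N×N matrices with strictly positive entries such that a'_ij ≤ a_ij for all i,j, and (ξ,η,B) and (ξ',η',B') are scalings of A and A' respectively, then ∏_{i=1}^N ξ'_i η'_i ≤ ∏_{i=1}^N ξ_i η_i, i.e., σ(A') ≤ σ(A). -/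
/-- `σ` is monotone: if `a'_ij ≤ a_ij` entrywise (both matrices positive)
then `σ(A') ≤ σ(A)`. -/
theorem sigma_monotone
    (N : ℕ) (A A' : Fin N → Fin N → ℝ)
    (hA : ∀ i j, 0 < A i j) (hA' : ∀ i j, 0 < A' i j)
    (hle : ∀ i j, A' i j ≤ A i j)
    (ξ η ξ' η' : Fin N → ℝ) (B B' : Fin N → Fin N → ℝ)
    (hs : IsScaling N A ξ η B) (hs' : IsScaling N A' ξ' η' B') :
    ∏ i, ξ' i * η' i ≤ ∏ i, ξ i * η i := by
  obtain ⟨hξ, hη, -, hrow, -, hAB⟩ := hs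
  obtain ⟨hξ', hη', hB', hrow', hcol', hAB'⟩ := hs'
  have entry_bound (i j : Fin N) :
      B' i j * (Real.log (ξ' i / ξ i) + Real.log (η' j / η j)) ≤ B i j - B' i j := by
    have hx : 0 < ξ' i / ξ i := div_pos (hξ' i) (hξ i)
    have hy : 0 < η' j / η j := div_pos (hη' j) (hη j)
    have hdom : B' i j * (ξ' i / ξ i * (η' j / η j)) ≤ B i j := by
      have h := hle i j
      rw [hAB, hAB', mul_assoc, mul_assoc] at h
      rw [div_mul_div_comm, ← mul_div_assoc, div_le_iff₀ (mul_pos (hξ i) (hη j))]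
      exact h
    rw [← Real.log_mul hx.ne' hy.ne']
    have hlog := mul_le_mul_of_nonneg_left
      (Real.log_le_sub_one_of_pos (mul_pos hx hy)) (hB' i j)
    linarith
  have hsum := Finset.sum_le_sum fun i (_ : i ∈ Finset.univ) =>
    Finset.sum_le_sum fun j (_ : j ∈ Finset.univ) => entry_bound i j
  have hweights :
      ∑ i, ∑ j, B' i j * (Real.log (ξ' i / ξ i) + Real.log (η' j / η j)) =
        ∑ i, Real.log (ξ' i / ξ i) + ∑ j, Real.log (η' j / η j) := by
    simp only [mul_add, Finset.sum_add_distrib]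
    congr 1
    · simp only [← Finset.sum_mul, hrow', one_mul]
    · rw [Finset.sum_comm]
      simp only [← Finset.sum_mul, hcol', one_mul]
  have hpos : 0 < ∏ i, ξ i * η i := Finset.prod_pos fun i _ => mul_pos (hξ i) (hη i)
  have hpos' : 0 < ∏ i, ξ' i * η' i := Finset.prod_pos fun i _ => mul_pos (hξ' i) (hη' i)
  rw [← Real.log_le_log_iff hpos' hpos,
    Real.log_prod fun i _ => (mul_pos (hξ' i) (hη' i)).ne',
    Real.log_prod fun i _ => (mul_pos (hξ i) (hη i)).ne']
  rw [hweights] at hsum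
  simp only [Finset.sum_sub_distrib, hrow, hrow', sub_self, Finset.sum_const_zero,
    Real.log_div (hξ' _).ne' (hξ _).ne', Real.log_div (hη' _).ne' (hη _).ne'] at hsum
  simp only [Real.log_mul (hξ' _).ne' (hη' _).ne', Real.log_mul (hξ _).ne' (hη _).ne',
    Finset.sum_add_distrib]
  linarith
end

section
/- Let r_1,…,r_m and c_1,…,c_n be positive integers with Σ_i r_i = Σ_j c_j = N, let W=(w_ij) and γ=(γ_ij) be m×n matrices with strictly positive entries, and suppose there are positive reals μ_1,…,μ_m, λ_1,…,λ_n and an m×n positive matrix L=(l_ij) such that w_ij γ_ij = l_ij μ_i λ_j for all i,j, with Σ_j l_ij = r_i for each i and Σ_i l_ij = c_j for each j. Then the N×N matrix B whose block R_i×C_j is filled with the constant l_ij/(r_i c_j) is doubly stochastic, and (ξ,η,B) with ξ_p = μ_i r_i for p∈R_i and η_q = λ_j c_j for q∈C_j is a scaling of A(γ); consequently σ(A(γ)) = ∏_{i=1}^m (μ_i r_i)^{r_i} · ∏_{j=1}^n (λ_j c_j)^{c_j}. -/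
/-- A product over `ι` of a function of `f p` is the product over the values of `f`,
each raised to the size of its fibre. -/
theorem prod_comp_eq_prod_pow_card_fiber {ι α M : Type*} [Fintype ι] [Fintype α] [CommMonoid M]
    (f : ι → α) (k : α → ℕ) (hk : ∀ a, Nat.card {p : ι // f p = a} = k a) (g : α → M) :
    ∏ p, g (f p) = ∏ a, g a ^ k a := by
  classical
  rw [← Fintype.prod_fiberwise' f g]
  refine Finset.prod_congr rfl fun a _ => ?_
  rw [Finset.prod_const, ← hk a, Nat.card_eq_fintype_card, Finset.card_univ]

/-- A sum over `ι` of a function of `f p` is the sum over the values of `f`,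
each weighted by the size of its fibre. -/
theorem sum_comp_eq_sum_card_fiber_mul {ι α R : Type*} [Fintype ι] [Fintype α] [Semiring R]
    (f : ι → α) (k : α → ℕ) (hk : ∀ a, Nat.card {p : ι // f p = a} = k a) (g : α → R) :
    ∑ p, g (f p) = ∑ a, (k a : R) * g a := by
  classical
  rw [← Fintype.sum_fiberwise' f g]
  refine Finset.sum_congr rfl fun a _ => ?_
  rw [Finset.sum_const, ← hk a, Nat.card_eq_fintype_card, Finset.card_univ, nsmul_eq_mul]

/-- If the `m × n` matrix `(w_ij γ_ij)` is scaled to row sums `r_i` and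
column sums `c_j`, i.e. `w_ij γ_ij = l_ij μ_i λ_j` with `Σ_j l_ij = r_i`, `Σ_i l_ij = c_j`,
then the `N × N` matrix `B` with block `R_i × C_j` filled with `l_ij/(r_i c_j)` is doubly
stochastic, `(ξ, η, B)` with `ξ_p = μ_i r_i` (`p ∈ R_i`), `η_q = λ_j c_j` (`q ∈ C_j`) is a
scaling of `A(γ)`, and hence `σ(A(γ)) = ∏_i (μ_i r_i)^{r_i} · ∏_j (λ_j c_j)^{c_j}`. -/
theorem sigma_of_block_matrix_via_small_scaling
    (m n N : ℕ) (r : Fin m → ℕ) (c : Fin n → ℕ)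
    (hr : ∀ i, 0 < r i) (hc : ∀ j, 0 < c j)
    (hrN : ∑ i, r i = N) (hcN : ∑ j, c j = N)
    (ρ : Fin N → Fin m) (κ : Fin N → Fin n)
    (hρ : ∀ i, Nat.card {p : Fin N // ρ p = i} = r i)
    (hκ : ∀ j, Nat.card {q : Fin N // κ q = j} = c j)
    (W γ : Fin m → Fin n → ℝ) (hW : ∀ i j, 0 < W i j) (hγ : ∀ i j, 0 < γ i j)
    (μ : Fin m → ℝ) (lam : Fin n → ℝ) (L : Fin m → Fin n → ℝ)
    (hμ : ∀ i, 0 < μ i) (hlam : ∀ j, 0 < lam j) (hL : ∀ i j, 0 < L i j)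
    (hscale : ∀ i j, W i j * γ i j = L i j * μ i * lam j)
    (hLr : ∀ i, ∑ j, L i j = r i) (hLc : ∀ j, ∑ i, L i j = c j) :
    (∀ p, ∑ q, L (ρ p) (κ q) / ((r (ρ p) : ℝ) * (c (κ q) : ℝ)) = 1) ∧
    (∀ q, ∑ p, L (ρ p) (κ q) / ((r (ρ p) : ℝ) * (c (κ q) : ℝ)) = 1) ∧
    IsScaling N (fun p q => W (ρ p) (κ q) * γ (ρ p) (κ q))
      (fun p => μ (ρ p) * (r (ρ p) : ℝ)) (fun q => lam (κ q) * (c (κ q) : ℝ))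
      (fun p q => L (ρ p) (κ q) / ((r (ρ p) : ℝ) * (c (κ q) : ℝ))) ∧
    (∏ p, (μ (ρ p) * (r (ρ p) : ℝ)) * (lam (κ p) * (c (κ p) : ℝ)))
      = (∏ i, (μ i * (r i : ℝ)) ^ (r i)) * ∏ j, (lam j * (c j : ℝ)) ^ (c j) := by
  have hr0 : ∀ i, (0 : ℝ) < r i := fun i => Nat.cast_pos.mpr (hr i)
  have hc0 : ∀ j, (0 : ℝ) < c j := fun j => Nat.cast_pos.mpr (hc j)
  have row_sum : ∀ p, ∑ q, L (ρ p) (κ q) / ((r (ρ p) : ℝ) * (c (κ q) : ℝ)) = 1 := by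
    intro p
    rw [sum_comp_eq_sum_card_fiber_mul κ c hκ
      fun j => L (ρ p) j / ((r (ρ p) : ℝ) * (c j : ℝ))]
    have hterm : ∀ j, (c j : ℝ) * (L (ρ p) j / ((r (ρ p) : ℝ) * (c j : ℝ)))
        = L (ρ p) j / r (ρ p) := by
      intro j
      have := (hc0 j).ne'
      field_simp
    simp_rw [hterm]
    rw [← Finset.sum_div, hLr, div_self (hr0 _).ne']
  have col_sum : ∀ q, ∑ p, L (ρ p) (κ q) / ((r (ρ p) : ℝ) * (c (κ q) : ℝ)) = 1 := by
    intro q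
    rw [sum_comp_eq_sum_card_fiber_mul ρ r hρ
      fun i => L i (κ q) / ((r i : ℝ) * (c (κ q) : ℝ))]
    have hterm : ∀ i, (r i : ℝ) * (L i (κ q) / ((r i : ℝ) * (c (κ q) : ℝ)))
        = L i (κ q) / c (κ q) := by
      intro i
      have := (hr0 i).ne'
      field_simp
    simp_rw [hterm]
    rw [← Finset.sum_div, hLc, div_self (hc0 _).ne']
  refine ⟨row_sum, col_sum, ⟨fun p => mul_pos (hμ _) (hr0 _), fun q => mul_pos (hlam _) (hc0 _),
    fun p q => (div_pos (hL _ _) (mul_pos (hr0 _) (hc0 _))).le, row_sum, col_sum,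
    fun p q => ?_⟩, ?_⟩
  · have := (hr0 (ρ p)).ne'
    have := (hc0 (κ q)).ne'
    simp only [hscale]
    field_simp
  · rw [Finset.prod_mul_distrib,
      prod_comp_eq_prod_pow_card_fiber ρ r hρ fun i => μ i * (r i : ℝ),
      prod_comp_eq_prod_pow_card_fiber κ c hκ fun j => lam j * (c j : ℝ)]
end

section
/- Let r_1,…,r_m and c_1,…,c_n be positive integers with Σ_i r_i = Σ_j c_j = N, let W=(w_ij) be an m×n matrix of non-negative reals, let A(γ) be the associated block matrix, and write P(γ) = per A(γ). Let 0 ≤ δ ≤ 1/(mn). Then (1−mnδ)^{N+mn−1} · ∫_Δ P(γ) dν(γ) ≤ ∫_{Δ_δ} P(γ) dν(γ) ≤ ∫_Δ P(γ) dν(γ), where Δ = {γ∈ℝ^{mn} : γ_ij>0, Σ_{ij} γ_ij = 1}, Δ_δ = {γ : γ_ij>δ, Σ_{ij} γ_ij = 1}, and ν is the Lebesgue measure induced on the hyperplane Σ_{ij} γ_ij = 1 by the Euclidean structure of ℝ^{mn}. -/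
open MeasureTheory

open scoped ENNReal

/-- The open standard simplex has finite Hausdorff measure in codimension one. -/
theorem hausdorffMeasure_simplex_lt_top {ι : Type*} [Fintype ι] [Nonempty ι] :
    μH[(Fintype.card ι : ℝ) - 1] {γ : EuclideanSpace ℝ ι | (∀ p, 0 < γ p) ∧ ∑ p, γ p = 1}
      < ∞ := by
  classical
  obtain ⟨p₀⟩ := ‹Nonempty ι›
  let ι' := {p : ι // p ≠ p₀}
  let g : (ι' → ℝ) → EuclideanSpace ℝ ι := fun x =>
    WithLp.toLp 2 fun p => if h : p = p₀ then 1 - ∑ q, x q else x ⟨p, h⟩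
  have hg : ContDiff ℝ 1 g := by
    refine (PiLp.contDiff_toLp).comp (contDiff_pi.2 fun p => ?_)
    by_cases h : p = p₀
    · simp only [h, dite_true]
      fun_prop
    · simp only [h, dite_false]
      fun_prop
  obtain ⟨K, hK⟩ := hg.locallyLipschitz.locallyLipschitzOn.exists_lipschitzOnWith_of_compact
    (isCompact_Icc (a := (0 : ι' → ℝ)) (b := 1))
  have hcard : (Fintype.card ι : ℝ) - 1 = (Fintype.card ι' : ℝ) := by
    have h1 : Fintype.card ι' = Fintype.card ι - 1 := Set.card_ne_eq p₀
    have h2 : 0 < Fintype.card ι := Fintype.card_pos_iff.2 ⟨p₀⟩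
    rw [h1, Nat.cast_sub h2, Nat.cast_one]
  have hsub : {γ : EuclideanSpace ℝ ι | (∀ p, 0 < γ p) ∧ ∑ p, γ p = 1} ⊆
      g '' Set.Icc 0 1 := by
    rintro γ ⟨hpos, hsum⟩
    refine ⟨fun q => γ q, ⟨fun q => (hpos q).le, fun q => ?_⟩, ?_⟩
    · exact (Finset.single_le_sum (fun p _ => (hpos p).le) (Finset.mem_univ (q : ι))).trans
        hsum.le
    · ext p
      by_cases h : p = p₀
      · subst h
        have := Fintype.sum_eq_add_sum_subtype_ne (fun q => γ q) p
        simp only [g, dite_true]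
        linarith
      · simp [g, h]
  rw [hcard]
  refine (measure_mono hsub).trans_lt
    ((hK.hausdorffMeasure_image_le (Nat.cast_nonneg _)).trans_lt ?_)
  rw [hausdorffMeasure_pi_real]
  exact ENNReal.mul_lt_top (by simp) isCompact_Icc.measure_lt_top

/-- Change of variables under a homothety for integrals against a Hausdorff measure. -/
theorem setIntegral_hausdorffMeasure_homothety_preimage {E : Type*} [NormedAddCommGroup E]
    [NormedSpace ℝ E] [MeasurableSpace E] [BorelSpace E] {d : ℝ} (hd : 0 ≤ d) (x : E) {s : ℝ}
    (hs : 0 < s) (S : Set E) (f : E → ℝ) :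
    ∫ y in S, f y ∂μH[d] =
      s ^ d * ∫ y in AffineMap.homothety x s ⁻¹' S, f (AffineMap.homothety x s y) ∂μH[d] := by
  let e : E ≃ₜ E :=
    { (AffineEquiv.homothetyUnitsMulHom x (Units.mk0 s hs.ne')).toEquiv with
      continuous_toFun := AffineMap.homothety_continuous x s
      continuous_invFun := AffineMap.homothety_continuous x s⁻¹ }
  have hemb : MeasurableEmbedding (AffineMap.homothety x s) := e.measurableEmbedding
  have hsd : s ^ d ≠ 0 := (Real.rpow_pos_of_pos hs d).ne'
  rw [← hemb.setIntegral_map f S, map_homothety_hausdorffMeasure hd x hs.ne',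
    Measure.restrict_smul, integral_smul_nnreal_measure, NNReal.smul_def, NNReal.coe_rpow,
    NNReal.coe_inv, coe_nnnorm, Real.norm_of_nonneg hs.le, Real.inv_rpow hs.le, smul_eq_mul,
    mul_inv_cancel_left₀ hsd]

/-- Comparison of the integrals of a monotone homogeneous function of degree `N` over the open
standard simplex and over its `δ`-interior. -/
theorem integral_simplex_interior_bounds_of_homogeneous {ι : Type*} [Fintype ι] [Nonempty ι]
    {N : ℕ} (hN : 0 < N)
    (P : EuclideanSpace ℝ ι → ℝ) (hP : Continuous P)
    (hmono : ∀ x y : EuclideanSpace ℝ ι, (∀ p, 0 ≤ x p) → (∀ p, x p ≤ y p) → P x ≤ P y)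
    (hhom : ∀ (s : ℝ) (x : EuclideanSpace ℝ ι), P (s • x) = s ^ N * P x)
    {δ : ℝ} (hδ0 : 0 ≤ δ) (hδ1 : Fintype.card ι * δ ≤ 1) :
    (1 - Fintype.card ι * δ) ^ (N + Fintype.card ι - 1) *
        ∫ γ in {γ : EuclideanSpace ℝ ι | (∀ p, 0 < γ p) ∧ ∑ p, γ p = 1}, P γ
          ∂μH[(Fintype.card ι : ℝ) - 1] ≤
      ∫ γ in {γ : EuclideanSpace ℝ ι | (∀ p, δ < γ p) ∧ ∑ p, γ p = 1}, P γ
          ∂μH[(Fintype.card ι : ℝ) - 1] ∧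
    ∫ γ in {γ : EuclideanSpace ℝ ι | (∀ p, δ < γ p) ∧ ∑ p, γ p = 1}, P γ
          ∂μH[(Fintype.card ι : ℝ) - 1] ≤
      ∫ γ in {γ : EuclideanSpace ℝ ι | (∀ p, 0 < γ p) ∧ ∑ p, γ p = 1}, P γ
          ∂μH[(Fintype.card ι : ℝ) - 1] := by
  set K : ℝ := (Fintype.card ι : ℝ) with hKdef
  set Δ : Set (EuclideanSpace ℝ ι) := {γ | (∀ p, 0 < γ p) ∧ ∑ p, γ p = 1} with hΔ
  set D : Set (EuclideanSpace ℝ ι) := {γ | (∀ p, δ < γ p) ∧ ∑ p, γ p = 1} with hD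
  have hcard : 0 < Fintype.card ι := Fintype.card_pos
  have hK : 0 < K := Nat.cast_pos.2 hcard
  have hK1 : K - 1 = ((Fintype.card ι - 1 : ℕ) : ℝ) := by
    rw [Nat.cast_sub hcard, Nat.cast_one]
  have hd : 0 ≤ K - 1 := hK1 ▸ Nat.cast_nonneg _
  have hpos : ∀ x : EuclideanSpace ℝ ι, (∀ p, 0 ≤ x p) → 0 ≤ P x := fun x hx => by
    have h0 : P 0 = 0 := by simpa [hN.ne'] using hhom 0 0
    exact h0 ▸ hmono 0 x (fun _ => le_rfl) hx
  have hmeas : ∀ a : ℝ, MeasurableSet {γ : EuclideanSpace ℝ ι | (∀ p, a < γ p) ∧ ∑ p, γ p = 1} :=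
    fun a => by measurability
  have hsub_closed : Δ ⊆ Metric.closedBall 0 1 := by
    rintro γ ⟨hγ, hsum⟩
    rw [mem_closedBall_zero_iff, EuclideanSpace.norm_eq, Real.sqrt_le_one, ← hsum]
    refine Finset.sum_le_sum fun p _ => ?_
    have hp : γ p ≤ 1 := hsum ▸
      Finset.single_le_sum (fun q _ => (hγ q).le) (Finset.mem_univ p)
    rw [Real.norm_eq_abs, sq_abs]
    nlinarith [hγ p]
  have hint : ∀ Q : EuclideanSpace ℝ ι → ℝ, Continuous Q → IntegrableOn Q Δ μH[K - 1] := by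
    intro Q hQ
    obtain ⟨C, hC⟩ := (isCompact_closedBall (0 : EuclideanSpace ℝ ι) 1).exists_bound_of_continuousOn
      hQ.continuousOn
    exact Measure.integrableOn_of_bounded hausdorffMeasure_simplex_lt_top.ne
      hQ.aestronglyMeasurable (M := C)
      (ae_restrict_of_forall_mem (hmeas 0) fun x hx => hC x (hsub_closed hx))
  have hsub : D ⊆ Δ := fun γ hγ => ⟨fun p => hδ0.trans_lt (hγ.1 p), hγ.2⟩
  refine ⟨?_, setIntegral_mono_set (hint P hP)
    (ae_restrict_of_forall_mem (hmeas 0) fun x hx => hpos x fun p => (hx.1 p).le)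
    hsub.eventuallyLE⟩
  obtain hs | hs := hδ1.eq_or_lt
  · rw [hs, sub_self, zero_pow (by omega), zero_mul]
    exact setIntegral_nonneg (hmeas δ) fun x hx => hpos x fun p => ((hsub hx).1 p).le
  set s : ℝ := 1 - K * δ with hsdef
  have hs0 : 0 < s := sub_pos.2 hs
  let b : EuclideanSpace ℝ ι := WithLp.toLp 2 fun _ => K⁻¹
  have hb : ∀ (γ : EuclideanSpace ℝ ι) p, AffineMap.homothety b s γ p = s * γ p + δ := by
    intro γ p
    simp only [AffineMap.homothety_apply, vsub_eq_sub, vadd_eq_add, PiLp.add_apply,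
      PiLp.smul_apply, PiLp.sub_apply, smul_eq_mul, b, hsdef]
    field_simp
    ring
  have hpre : AffineMap.homothety b s ⁻¹' D = Δ := by
    ext γ
    have hsum : ∑ p, (s * γ p + δ) = 1 ↔ ∑ p, γ p = 1 := by
      rw [Finset.sum_add_distrib, ← Finset.mul_sum, Finset.sum_const, Finset.card_univ,
        nsmul_eq_mul, ← hKdef, ← eq_sub_iff_add_eq, ← hsdef]
      exact mul_eq_left₀ hs0.ne'
    simp [hD, hΔ, hb, hsum, hs0]
  rw [setIntegral_hausdorffMeasure_homothety_preimage hd b hs0 D P, hpre, Nat.add_sub_assoc hcard,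
    add_comm, pow_add, hK1, Real.rpow_natCast, ← hK1, mul_assoc, ← integral_const_mul]
  refine mul_le_mul_of_nonneg_left ?_ (by positivity)
  refine setIntegral_mono_on ((hint P hP).const_mul _)
    (hint _ (hP.comp (AffineMap.homothety_continuous b s))) (hmeas 0) fun γ hγ => ?_
  rw [← hhom]
  refine hmono _ _ (fun p => mul_nonneg hs0.le (hγ.1 p).le) fun p => ?_
  rw [hb]
  simpa using hδ0

/-- Lemma 4.3. With `P(γ) = per A(γ)` and `0 ≤ δ ≤ 1/(mn)`,
`(1−mnδ)^{N+mn−1} ∫_Δ P dν ≤ ∫_{Δ_δ} P dν ≤ ∫_Δ P dν`, where `Δ` is the open standard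
simplex, `Δ_δ` its `δ`-interior, and `ν` the Lebesgue measure induced on the hyperplane
`Σγ_ij = 1` by the Euclidean structure of `ℝ^{mn}` (here realized as the
`(mn−1)`-dimensional Hausdorff measure of the Euclidean space `ℝ^{mn}`). -/
theorem integral_simplex_delta_interior_bounds
    (m n N : ℕ) (hm : 0 < m) (hn : 0 < n)
    (r : Fin m → ℕ) (c : Fin n → ℕ)
    (hr : ∀ i, 0 < r i) (hc : ∀ j, 0 < c j)
    (hrN : ∑ i, r i = N) (hcN : ∑ j, c j = N)
    (W : Fin m → Fin n → ℝ) (hW : ∀ i j, 0 ≤ W i j)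
    (ρ : Fin N → Fin m) (κ : Fin N → Fin n)
    (hρ : ∀ i, Nat.card {p : Fin N // ρ p = i} = r i)
    (hκ : ∀ j, Nat.card {q : Fin N // κ q = j} = c j)
    (δ : ℝ) (hδ0 : 0 ≤ δ) (hδ1 : δ ≤ 1 / (m * n)) :
    (1 - m * n * δ) ^ (N + m * n - 1) *
        ∫ γ in {γ : EuclideanSpace ℝ (Fin m × Fin n) |
              (∀ p, 0 < γ p) ∧ ∑ p, γ p = 1},
          (∑ π : Equiv.Perm (Fin N), ∏ k, W (ρ k) (κ (π k)) * γ (ρ k, κ (π k)))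
          ∂(μH[((m * n : ℝ) - 1)])
      ≤ (∫ γ in {γ : EuclideanSpace ℝ (Fin m × Fin n) |
              (∀ p, δ < γ p) ∧ ∑ p, γ p = 1},
          (∑ π : Equiv.Perm (Fin N), ∏ k, W (ρ k) (κ (π k)) * γ (ρ k, κ (π k)))
          ∂(μH[((m * n : ℝ) - 1)])) ∧
    (∫ γ in {γ : EuclideanSpace ℝ (Fin m × Fin n) |
              (∀ p, δ < γ p) ∧ ∑ p, γ p = 1},
          (∑ π : Equiv.Perm (Fin N), ∏ k, W (ρ k) (κ (π k)) * γ (ρ k, κ (π k)))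
          ∂(μH[((m * n : ℝ) - 1)]))
      ≤ ∫ γ in {γ : EuclideanSpace ℝ (Fin m × Fin n) |
              (∀ p, 0 < γ p) ∧ ∑ p, γ p = 1},
          (∑ π : Equiv.Perm (Fin N), ∏ k, W (ρ k) (κ (π k)) * γ (ρ k, κ (π k)))
          ∂(μH[((m * n : ℝ) - 1)]) := by
  have : Nonempty (Fin m × Fin n) := ⟨⟨0, hm⟩, ⟨0, hn⟩⟩
  have hcard : Fintype.card (Fin m × Fin n) = m * n := by simp
  have hmn : (0 : ℝ) < m * n := by positivity
  have hN : 0 < N := hrN ▸ (hr ⟨0, hm⟩).trans_le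
    (Finset.single_le_sum (fun i _ => Nat.zero_le (r i)) (Finset.mem_univ _))
  have key := integral_simplex_interior_bounds_of_homogeneous (ι := Fin m × Fin n) hN
    (fun γ => ∑ π : Equiv.Perm (Fin N), ∏ k, W (ρ k) (κ (π k)) * γ (ρ k, κ (π k)))
    (by fun_prop)
    (fun x y hx hxy => Finset.sum_le_sum fun π _ => Finset.prod_le_prod
      (fun k _ => mul_nonneg (hW _ _) (hx _))
      (fun k _ => mul_le_mul_of_nonneg_left (hxy _) (hW _ _)))
    (fun s x => by
      simp only [PiLp.smul_apply, smul_eq_mul, mul_left_comm _ s, Finset.prod_mul_distrib,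
        Finset.prod_const, Finset.card_univ, Fintype.card_fin, Finset.mul_sum])
    hδ0 (by rw [hcard]; push_cast; rwa [mul_comm, ← le_div_iff₀ hmn])
  rw [hcard] at key
  push_cast at key
  exact key
end

section
/- Let B=(b_ij) be an N×N matrix with non-negative real entries such that every row sum of B equals 1, and let t_1,…,t_N be positive integers such that b_ij ≤ 1/t_i for all i,j. Then per B ≤ ∏_{i=1}^N (t_i!)^{1/t_i} / t_i. -/
open Finset in
/-- The linear functional `x ↦ ∑ j, x j * c j` on the hypersimplex `0 ≤ x ≤ 1 / t`, `∑ j, x j = 1`,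
is bounded by its value at some vertex. -/
theorem exists_card_eq_sum_mul_le {ι : Type*} [Fintype ι] (x c : ι → ℝ)
    (hx : ∀ j, 0 ≤ x j) (hsum : ∑ j, x j = 1) {t : ℕ} (ht : 0 < t)
    (hbound : ∀ j, x j ≤ 1 / (t : ℝ)) :
    ∃ S : Finset ι, #S = t ∧ ∑ j, x j * c j ≤ ∑ j ∈ S, 1 / (t : ℝ) * c j := by
  classical
  have htR : (0 : ℝ) < t := by exact_mod_cast ht
  have hcard : t ≤ Fintype.card ι := by
    have h : (1 : ℝ) ≤ ∑ _j : ι, 1 / (t : ℝ) :=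
      hsum.symm.trans_le (sum_le_sum fun j _ => hbound j)
    rw [sum_const, card_univ, nsmul_eq_mul, mul_one_div, le_div_iff₀ htR, one_mul] at h
    exact_mod_cast h
  obtain ⟨S, hS, hmax⟩ := exists_max_image (powersetCard t (univ : Finset ι))
    (fun S => ∑ j ∈ S, c j) (powersetCard_nonempty.2 (by simpa using hcard))
  have hSt : #S = t := (mem_powersetCard.1 hS).2
  obtain ⟨i, hi, hmin⟩ := exists_min_image S c (card_pos.1 (hSt ▸ ht))
  have hout : ∀ j, j ∉ S → c j ≤ c i := by
    intro j hj
    have hje : j ∉ S.erase i := fun h => hj (mem_of_mem_erase h)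
    have h := hmax (insert j (S.erase i)) (mem_powersetCard.2 ⟨subset_univ _, by
      rw [card_insert_of_notMem hje, card_erase_of_mem hi]; omega⟩)
    rw [sum_insert hje, ← add_sum_erase S c hi] at h
    linarith
  refine ⟨S, hSt, ?_⟩
  have hle : ∑ j, x j * (c j - c i) ≤ ∑ j ∈ S, 1 / (t : ℝ) * (c j - c i) := by
    rw [← sum_add_sum_compl S]
    have hS : ∑ j ∈ S, x j * (c j - c i) ≤ ∑ j ∈ S, 1 / (t : ℝ) * (c j - c i) :=
      sum_le_sum fun j hj =>
        mul_le_mul_of_nonneg_right (hbound j) (sub_nonneg.2 (hmin j hj))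
    have hSc : ∑ j ∈ Sᶜ, x j * (c j - c i) ≤ 0 := sum_nonpos fun j hj =>
      mul_nonpos_of_nonneg_of_nonpos (hx j) (sub_nonpos.2 (hout j (mem_compl.1 hj)))
    linarith
  simp only [mul_sub, sum_sub_distrib, ← sum_mul, hsum, sum_const, hSt, nsmul_eq_mul] at hle
  rw [mul_one_div_cancel htR.ne'] at hle
  linarith

open Finset in
/-- Laplace expansion of the permanent along a row. -/
theorem sum_perm_prod_eq_sum_row {n : Type*} [Fintype n] [DecidableEq n] (B : n → n → ℝ) (i : n) :
    ∑ π : Equiv.Perm n, ∏ k, B k (π k) =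
      ∑ j, B i j * ∑ π : Equiv.Perm n with π i = j, ∏ k ∈ univ.erase i, B k (π k) := by
  rw [← sum_fiberwise univ (fun π : Equiv.Perm n => π i)]
  refine sum_congr rfl fun j _ => ?_
  rw [mul_sum]
  refine sum_congr rfl fun π hπ => ?_
  rw [← mul_prod_erase univ _ (mem_univ i), (mem_filter.1 hπ).2]

open Finset in
/-- The permanent does not decrease when a row is replaced by a suitable vertex of its
hypersimplex. -/
theorem exists_sum_perm_prod_le_update {n : Type*} [Fintype n] [DecidableEq n] (B : n → n → ℝ)
    (i : n) (hB : ∀ j, 0 ≤ B i j) (hrow : ∑ j, B i j = 1) {t : ℕ} (ht : 0 < t)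
    (hbound : ∀ j, B i j ≤ 1 / (t : ℝ)) :
    ∃ S : Finset n, #S = t ∧ ∑ π : Equiv.Perm n, ∏ k, B k (π k) ≤
      ∑ π : Equiv.Perm n, ∏ k,
        Function.update B i (fun j => if j ∈ S then 1 / (t : ℝ) else 0) k (π k) := by
  obtain ⟨S, hS, hle⟩ := exists_card_eq_sum_mul_le (B i)
    (fun j => ∑ π : Equiv.Perm n with π i = j, ∏ k ∈ univ.erase i, B k (π k)) hB hrow ht hbound
  refine ⟨S, hS, ?_⟩
  rw [sum_perm_prod_eq_sum_row B i, sum_perm_prod_eq_sum_row _ i]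
  refine hle.trans_eq ?_
  simp only [Function.update_self, ite_mul, zero_mul, sum_ite_mem, univ_inter]
  refine sum_congr rfl fun j _ => ?_
  congr 1
  refine sum_congr rfl fun π _ => prod_congr rfl fun k hk => ?_
  rw [Function.update_of_ne (ne_of_mem_erase hk)]

open Finset in
/-- The permanent is bounded by the permanent of a matrix all of whose rows are vertices. -/
theorem exists_sum_perm_prod_le_indicator {n : Type*} [Fintype n] [DecidableEq n] (B : n → n → ℝ)
    (hB : ∀ i j, 0 ≤ B i j) (hrow : ∀ i, ∑ j, B i j = 1) (t : n → ℕ) (ht : ∀ i, 0 < t i)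
    (hbound : ∀ i j, B i j ≤ 1 / (t i : ℝ)) :
    ∃ A : n → Finset n, (∀ i, #(A i) = t i) ∧ ∑ π : Equiv.Perm n, ∏ k, B k (π k) ≤
      ∑ π : Equiv.Perm n, ∏ k, if π k ∈ A k then 1 / (t k : ℝ) else 0 := by
  suffices h : ∀ s : Finset n, ∃ A : n → Finset n, (∀ i ∈ s, #(A i) = t i) ∧
      ∑ π : Equiv.Perm n, ∏ k, B k (π k) ≤ ∑ π : Equiv.Perm n, ∏ k,
        if k ∈ s then (if π k ∈ A k then 1 / (t k : ℝ) else 0) else B k (π k) by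
    simpa using h univ
  intro s
  induction s using Finset.induction_on with
  | empty => exact ⟨fun _ => ∅, by simp, by simp⟩
  | insert a s ha ih =>
    obtain ⟨A, hA, hle⟩ := ih
    obtain ⟨S, hS, hle'⟩ := exists_sum_perm_prod_le_update
      (fun k j => if k ∈ s then (if j ∈ A k then 1 / (t k : ℝ) else 0) else B k j) a
      (by simpa [ha] using hB a) (by simpa [ha] using hrow a) (ht a)
      (by simpa [ha] using hbound a)
    refine ⟨Function.update A a S, fun i hi => ?_, hle.trans (hle'.trans_eq ?_)⟩
    · by_cases h : i = a
      · subst h; simpa using hS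
      · simpa [h] using hA i (mem_of_mem_insert_of_ne hi h)
    · refine sum_congr rfl fun π _ => prod_congr rfl fun k _ => ?_
      by_cases h : k = a
      · subst h; simp
      · simp [h]

open Finset in
/-- Grouping the members of `S` by their image under `f`, each fibre contributes `1`. -/
theorem sum_inv_card_fiber_le {α β : Type*} [DecidableEq β] (S : Finset α) (f : α → β)
    (T : Finset β) (hf : ∀ a ∈ S, f a ∈ T) :
    ∑ a ∈ S, (#{b ∈ S | f b = f a} : ℝ)⁻¹ ≤ #T := by
  rw [← sum_fiberwise_of_maps_to hf, card_eq_sum_ones, Nat.cast_sum]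
  refine sum_le_sum fun k _ => ?_
  calc ∑ a ∈ S with f a = k, (#{b ∈ S | f b = f a} : ℝ)⁻¹
      = ∑ a ∈ S with f a = k, (#{b ∈ S | f b = k} : ℝ)⁻¹ :=
        sum_congr rfl fun a ha => by rw [(mem_filter.1 ha).2]
    _ ≤ ((1 : ℕ) : ℝ) := by
        rw [sum_const, nsmul_eq_mul, Nat.cast_one]
        exact mul_inv_le_one

open Finset in
/-- The entropy of `f` under the uniform distribution on `S` is at most `log #T`. -/
theorem card_mul_log_card_le {α β : Type*} [DecidableEq β] (S : Finset α) (f : α → β)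
    (T : Finset β) (hf : ∀ a ∈ S, f a ∈ T) :
    #S * Real.log #S ≤
      ∑ a ∈ S, (Real.log #T + Real.log #{b ∈ S | f b = f a}) := by
  rcases S.eq_empty_or_nonempty with rfl | hS
  · simp
  have hP : (0 : ℝ) < #S := by exact_mod_cast hS.card_pos
  have hT : (0 : ℝ) < #T := by
    obtain ⟨a, ha⟩ := hS
    exact_mod_cast card_pos.2 ⟨f a, hf a ha⟩
  have hM : ∀ a ∈ S, (0 : ℝ) < #{b ∈ S | f b = f a} := fun a ha =>
    Nat.cast_pos.2 (card_pos.2 ⟨a, mem_filter.2 ⟨ha, rfl⟩⟩)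
  have key : ∑ a ∈ S, (Real.log #S - (Real.log #T + Real.log #{b ∈ S | f b = f a})) ≤ 0 :=
    calc _ ≤ ∑ a ∈ S, (#S / #T * (#{b ∈ S | f b = f a} : ℝ)⁻¹ - 1) := by
            refine sum_le_sum fun a ha => ?_
            rw [← Real.log_mul hT.ne' (hM a ha).ne',
              ← Real.log_div hP.ne' (mul_pos hT (hM a ha)).ne', ← div_eq_mul_inv, div_div]
            exact Real.log_le_sub_one_of_pos (div_pos hP (mul_pos hT (hM a ha)))
      _ = #S / #T * ∑ a ∈ S, (#{b ∈ S | f b = f a} : ℝ)⁻¹ - #S := by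
            rw [sum_sub_distrib, mul_sum]; simp
      _ ≤ #S / #T * #T - #S := by
            gcongr
            exact sum_inv_card_fiber_le S f T hf
      _ = 0 := by rw [div_mul_cancel₀ _ hT.ne', sub_self]
  rw [sum_sub_distrib, sum_const, nsmul_eq_mul] at key
  linarith

open Finset in
/-- Bijections extending `i ↦ k` restrict to bijections of the complements. -/
theorem card_equiv_apply_eq_le {α β : Type*} [Fintype α] [Fintype β] [DecidableEq α]
    [DecidableEq β] (A : α → Finset β) (i : α) (k : β) :
    #{σ ∈ ({σ | ∀ j, σ j ∈ A j} : Finset (α ≃ β)) | σ i = k} ≤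
      #{τ : {j // j ≠ i} ≃ {y // y ≠ k} |
        ∀ j : {j // j ≠ i}, τ j ∈ (A j).subtype (· ≠ k)} := by
  have hne : ∀ σ : α ≃ β, σ i = k → ∀ a, a ≠ i ↔ σ a ≠ k := by
    rintro σ rfl a
    simp
  rw [← Fintype.card_coe, ← Fintype.card_coe]
  refine Fintype.card_le_of_injective (fun σ => ⟨σ.1.subtypeEquiv
    (hne σ.1 (mem_filter.1 σ.2).2), ?_⟩) ?_
  · have h := (mem_filter.1 (mem_filter.1 σ.2).1).2
    simpa using fun j _ => h j
  · intro σ τ h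
    ext j
    by_cases hj : j = i
    · rw [hj, (mem_filter.1 σ.2).2, (mem_filter.1 τ.2).2]
    · have happ := congrArg (fun e => ((e.1 ⟨j, hj⟩ : {y // y ≠ k}) : β)) h
      simpa using happ

/-- The exponent `log (r!) / r` in the Minc–Bregman bound. -/
noncomputable def bregmanExponent (r : ℕ) : ℝ := (r : ℝ)⁻¹ * Real.log r.factorial

theorem mul_bregmanExponent (r : ℕ) : r * bregmanExponent r = Real.log r.factorial := by
  rcases r.eq_zero_or_pos with rfl | h
  · simp
  · rw [bregmanExponent, mul_inv_cancel_left₀ (by positivity)]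

open Finset in
/-- Total contribution of a row with support `T` to the bounds for the minors along `σ`. -/
theorem log_card_add_sum_bregmanExponent {α β : Type*} [Fintype α] [DecidableEq α]
    [DecidableEq β] (σ : α ≃ β) (j : α) (T : Finset β) (hj : σ j ∈ T) :
    Real.log #T + ∑ i ∈ univ.erase j, bregmanExponent (#(T.erase (σ i))) =
      Fintype.card α * bregmanExponent #T := by
  obtain ⟨r, hr⟩ : ∃ r, #T = r + 1 := ⟨#T - 1, by have := card_pos.2 ⟨_, hj⟩; omega⟩
  have hterm : ∀ i, bregmanExponent (#(T.erase (σ i))) =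
      bregmanExponent (r + 1) +
        if σ i ∈ T then bregmanExponent r - bregmanExponent (r + 1) else 0 := by
    intro i
    by_cases h : σ i ∈ T
    · simp [card_erase_of_mem h, hr, h]
    · simp [h, hr]
  have hcount : #{i | σ i ∈ T} = r + 1 := by
    rw [← hr]
    exact card_bij (fun i _ => σ i) (by simp) (fun _ _ _ _ h => σ.injective h)
      (fun b hb => ⟨σ.symm b, by simpa using hb, by simp⟩)
  have hall : ∑ i, bregmanExponent (#(T.erase (σ i))) = Fintype.card α * bregmanExponent (r + 1) +
      (r + 1) * (bregmanExponent r - bregmanExponent (r + 1)) := by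
    simp only [hterm, sum_add_distrib, sum_const, card_univ, nsmul_eq_mul, ← sum_filter, hcount]
    push_cast
    ring
  rw [← add_sum_erase univ _ (mem_univ j), card_erase_of_mem hj, hr, Nat.add_sub_cancel] at hall
  have h0 := mul_bregmanExponent r
  have h1 := mul_bregmanExponent (r + 1)
  rw [Nat.factorial_succ, Nat.cast_mul, Real.log_mul (by positivity) (by positivity)] at h1
  rw [hr]
  push_cast at *
  linarith

open Finset in
/-- **Bregman's theorem** in logarithmic form, for the number of bijections `σ` with `σ i ∈ A i`. -/
theorem log_card_equiv_le {α β : Type*} [Fintype α] [Fintype β] [DecidableEq α] [DecidableEq β]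
    (A : α → Finset β) (hne : ({σ | ∀ j, σ j ∈ A j} : Finset (α ≃ β)).Nonempty) :
    Real.log #({σ | ∀ j, σ j ∈ A j} : Finset (α ≃ β)) ≤ ∑ j, bregmanExponent #(A j) := by
  induction hn : Fintype.card α generalizing α β with
  | zero =>
    have := Fintype.card_eq_zero_iff.1 hn
    have : #({σ | ∀ j, σ j ∈ A j} : Finset (α ≃ β)) ≤ 1 :=
      card_le_one.2 fun σ _ τ _ => Equiv.ext fun a => isEmptyElim a
    rw [Fintype.sum_empty]
    exact Real.log_nonpos (by positivity) (by exact_mod_cast this)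
  | succ n ih =>
    set S : Finset (α ≃ β) := {σ | ∀ j, σ j ∈ A j} with hS
    have hmem : ∀ σ ∈ S, ∀ j, σ j ∈ A j := fun σ hσ => (mem_filter.1 hσ).2
    have hminor : ∀ σ ∈ S, ∀ i, Real.log #{τ ∈ S | τ i = σ i} ≤
        ∑ j ∈ univ.erase i, bregmanExponent #((A j).erase (σ i)) := by
      intro σ hσ i
      have hpos : 0 < #{τ ∈ S | τ i = σ i} := card_pos.2 ⟨σ, mem_filter.2 ⟨hσ, rfl⟩⟩
      have hle := card_equiv_apply_eq_le A i (σ i)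
      refine (Real.log_le_log (by exact_mod_cast hpos) (Nat.cast_le.2 hle)).trans ?_
      refine (ih (fun j : {j // j ≠ i} => (A j).subtype (· ≠ σ i))
        (card_pos.1 (hpos.trans_le hle)) (by simp [hn])).trans_eq ?_
      rw [← sum_subtype (univ.erase i) (p := (· ≠ i)) (by simp)
        (fun j => bregmanExponent #((A j).subtype (· ≠ σ i)))]
      refine sum_congr rfl fun j _ => ?_
      rw [card_subtype, filter_ne']
    have hrow : ∀ σ ∈ S, ∑ i, (Real.log #(A i) + Real.log #{τ ∈ S | τ i = σ i}) ≤
        Fintype.card α * ∑ j, bregmanExponent #(A j) := by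
      intro σ hσ
      calc _ ≤ ∑ i, (Real.log #(A i) +
              ∑ j ∈ univ.erase i, bregmanExponent #((A j).erase (σ i))) :=
            sum_le_sum fun i _ => by gcongr; exact hminor σ hσ i
        _ = ∑ j, (Real.log #(A j) +
              ∑ i ∈ univ.erase j, bregmanExponent #((A j).erase (σ i))) := by
            rw [sum_add_distrib, sum_add_distrib]
            congr 1
            exact sum_comm' fun i j => by simp [ne_comm]
        _ = _ := by
            rw [mul_sum]
            exact sum_congr rfl fun j _ =>
              log_card_add_sum_bregmanExponent σ j (A j) (hmem σ hσ j)
    have htotal : Fintype.card α * (#S * Real.log #S) ≤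
        #S * (Fintype.card α * ∑ j, bregmanExponent #(A j)) := by
      calc _ = ∑ _i : α, (#S : ℝ) * Real.log #S := by simp
        _ ≤ ∑ i, ∑ σ ∈ S, (Real.log #(A i) + Real.log #{τ ∈ S | τ i = σ i}) :=
            sum_le_sum fun i _ =>
              card_mul_log_card_le S (fun σ => σ i) (A i) fun σ hσ => hmem σ hσ i
        _ = ∑ σ ∈ S, ∑ i, (Real.log #(A i) + Real.log #{τ ∈ S | τ i = σ i}) := sum_comm
        _ ≤ ∑ _σ ∈ S, Fintype.card α * ∑ j, bregmanExponent #(A j) := sum_le_sum hrow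
        _ = _ := by rw [sum_const, nsmul_eq_mul]
    have hpos : (0 : ℝ) < Fintype.card α * #S := by
      rw [hn]
      exact_mod_cast Nat.mul_pos n.succ_pos hne.card_pos
    refine le_of_mul_le_mul_left ?_ hpos
    linarith

open Finset in
/-- **Bregman's theorem** for the number of bijections `σ` with `σ i ∈ A i`. -/
theorem card_equiv_le_prod_factorial_rpow {α β : Type*} [Fintype α] [Fintype β] [DecidableEq α]
    [DecidableEq β] (A : α → Finset β) :
    (#({σ | ∀ j, σ j ∈ A j} : Finset (α ≃ β)) : ℝ) ≤
      ∏ j, ((#(A j)).factorial : ℝ) ^ ((#(A j) : ℝ)⁻¹) := by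
  rcases ({σ | ∀ j, σ j ∈ A j} : Finset (α ≃ β)).eq_empty_or_nonempty with h | h
  · rw [h, card_empty, Nat.cast_zero]
    positivity
  · have hfac : ∀ j, (0 : ℝ) < (#(A j)).factorial := fun j => by positivity
    rw [← Real.log_le_log_iff (by exact_mod_cast h.card_pos)
      (prod_pos fun j _ => Real.rpow_pos_of_pos (hfac j) _),
      Real.log_prod fun j _ => (Real.rpow_pos_of_pos (hfac j) _).ne']
    refine (log_card_equiv_le A h).trans_eq (sum_congr rfl fun j _ => ?_)
    rw [Real.log_rpow (hfac j), bregmanExponent]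

/-- continuous extension of the Minc–Bregman bound, after
Samorodnitsky. If `B` is a non-negative `N × N` matrix with all row sums `1` and
`b_ij ≤ 1/t_i` for positive integers `t_i`, then
`per B ≤ ∏_i (t_i!)^{1/t_i} / t_i`. -/
theorem permanent_le_minc_bregman_continuous
    (N : ℕ) (B : Fin N → Fin N → ℝ) (hB : ∀ i j, 0 ≤ B i j)
    (hrow : ∀ i, ∑ j, B i j = 1)
    (t : Fin N → ℕ) (ht : ∀ i, 0 < t i)
    (hbound : ∀ i j, B i j ≤ 1 / (t i : ℝ)) :
    (∑ π : Equiv.Perm (Fin N), ∏ k, B k (π k))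
      ≤ ∏ i, (Nat.factorial (t i) : ℝ) ^ ((t i : ℝ)⁻¹) / (t i : ℝ) := by
  obtain ⟨A, hA, hle⟩ := exists_sum_perm_prod_le_indicator B hB hrow t ht hbound
  refine hle.trans ?_
  have hbreg := card_equiv_le_prod_factorial_rpow A
  simp only [hA] at hbreg
  simp only [Finset.prod_ite_zero, Finset.mem_univ, true_imp_iff, ← Finset.sum_filter,
    Finset.sum_const, nsmul_eq_mul]
  simp only [div_eq_mul_inv, one_mul, Finset.prod_mul_distrib]
  refine mul_le_mul_of_nonneg_right ?_ (Finset.prod_nonneg fun i _ => by positivity)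
  refine Eq.trans_le ?_ hbreg
  congr!
end

section
/- Let t_1,…,t_N be positive integers and let K be the set of N×N matrices B=(b_ij) with non-negative entries such that every row sum equals 1 and b_ij ≤ 1/t_i for all i,j. Then for every B ∈ K there exists B' ∈ K with b'_ij ∈ {0, 1/t_i} for all i,j and per B' ≥ per B; that is, the maximum of the permanent over K is attained at a matrix whose entries in row i lie in {0, 1/t_i}. -/
open Finset

/-- Among the subsets of a fixed size `t`, one of maximal total weight is an upper level set. -/
theorem exists_card_eq_threshold {ι : Type*} [Fintype ι] [DecidableEq ι] (c : ι → ℝ) {t : ℕ}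
    (ht : 0 < t) (hcard : t ≤ Fintype.card ι) :
    ∃ (S : Finset ι) (r : ℝ), S.card = t ∧ (∀ j ∈ S, r ≤ c j) ∧ ∀ j ∉ S, c j ≤ r := by
  obtain ⟨S, hS, hmax⟩ := (univ.powersetCard t).exists_max_image (fun S : Finset ι => ∑ j ∈ S, c j)
    (powersetCard_nonempty.2 (by simpa using hcard))
  have hSt : S.card = t := (mem_powersetCard.1 hS).2
  obtain ⟨a, ha, hmin⟩ := S.exists_min_image c (card_pos.1 (hSt ▸ ht))
  refine ⟨S, c a, hSt, hmin, fun b hb => ?_⟩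
  have hb' : b ∉ S.erase a := fun h => hb (mem_of_mem_erase h)
  have hle := hmax (insert b (S.erase a)) (mem_powersetCard.2 ⟨subset_univ _, by
    rw [card_insert_of_notMem hb', card_erase_of_mem ha, hSt]; omega⟩)
  rw [sum_insert hb', ← add_sum_erase S c ha] at hle
  linarith

/-- A linear functional on the vectors with entries in `[0, 1/t]` and sum `1` is dominated by its
value at such a vector with entries in `{0, 1/t}`. -/
theorem exists_extreme_row {ι : Type*} [Fintype ι] [DecidableEq ι] (c x : ι → ℝ) {t : ℕ}
    (ht : 0 < t) (hx : ∀ j, 0 ≤ x j) (hsum : ∑ j, x j = 1) (hle : ∀ j, x j ≤ 1 / (t : ℝ)) :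
    ∃ y : ι → ℝ, (∀ j, y j = 0 ∨ y j = 1 / (t : ℝ)) ∧ ∑ j, y j = 1 ∧
      ∑ j, x j * c j ≤ ∑ j, y j * c j := by
  have ht' : (0 : ℝ) < t := Nat.cast_pos.2 ht
  have hcard : t ≤ Fintype.card ι := by
    have h : (1 : ℝ) ≤ Fintype.card ι * (1 / (t : ℝ)) := by
      simpa [hsum] using sum_le_sum fun j (_ : j ∈ univ) => hle j
    rw [mul_one_div, le_div_iff₀ ht', one_mul] at h
    exact_mod_cast h
  obtain ⟨S, r, hS, hin, hout⟩ := exists_card_eq_threshold c ht hcard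
  have hy : ∑ j, (if j ∈ S then 1 / (t : ℝ) else 0) = 1 := by
    rw [sum_ite_mem, univ_inter, sum_const, hS, nsmul_eq_mul, mul_one_div_cancel ht'.ne']
  refine ⟨fun j => if j ∈ S then 1 / (t : ℝ) else 0, fun j => ?_, hy, ?_⟩
  · by_cases h : j ∈ S <;> simp [h]
  · have key : ∑ j, x j * (c j - r) ≤ ∑ j, (if j ∈ S then 1 / (t : ℝ) else 0) * (c j - r) := by
      refine sum_le_sum fun j _ => ?_
      by_cases h : j ∈ S
      · rw [if_pos h]
        exact mul_le_mul_of_nonneg_right (hle j) (sub_nonneg.2 (hin j h))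
      · rw [if_neg h, zero_mul]
        exact mul_nonpos_of_nonneg_of_nonpos (hx j) (sub_nonpos.2 (hout j h))
    simpa only [mul_sub, sum_sub_distrib, ← sum_mul, hsum, hy, sub_le_sub_iff_right] using key

/-- The permanent is a linear function of its `i`-th row. -/
theorem sum_perm_prod_update {ι : Type*} [Fintype ι] [DecidableEq ι] (B : ι → ι → ℝ) (i : ι)
    (y : ι → ℝ) :
    ∑ π : Equiv.Perm ι, ∏ k, Function.update B i y k (π k) =
      ∑ j, y j * ∑ π : Equiv.Perm ι with π i = j, ∏ k ∈ univ.erase i, B k (π k) := by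
  rw [← sum_fiberwise univ (fun π : Equiv.Perm ι => π i)]
  refine sum_congr rfl fun j _ => ?_
  rw [mul_sum]
  refine sum_congr rfl fun π hπ => ?_
  rw [← mul_prod_erase univ _ (mem_univ i), Function.update_self, (mem_filter.1 hπ).2]
  congr 1
  refine prod_congr rfl fun k hk => ?_
  rw [Function.update_of_ne (ne_of_mem_erase hk)]

/-- On the class `K` of non-negative `N × N` matrices with all row sums
`1` and `b_ij ≤ 1/t_i`, the maximum of the permanent is attained at a matrix whose
entries in row `i` lie in `{0, 1/t_i}`: for every `B ∈ K` there is such a `B' ∈ K` with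
`per B' ≥ per B`. -/
theorem permanent_max_at_extreme_matrix
    (N : ℕ) (t : Fin N → ℕ) (ht : ∀ i, 0 < t i)
    (B : Fin N → Fin N → ℝ) (hB : ∀ i j, 0 ≤ B i j)
    (hrow : ∀ i, ∑ j, B i j = 1)
    (hbound : ∀ i j, B i j ≤ 1 / (t i : ℝ)) :
    ∃ B' : Fin N → Fin N → ℝ,
      (∀ i j, 0 ≤ B' i j) ∧ (∀ i, ∑ j, B' i j = 1) ∧
      (∀ i j, B' i j ≤ 1 / (t i : ℝ)) ∧
      (∀ i j, B' i j = 0 ∨ B' i j = 1 / (t i : ℝ)) ∧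
      (∑ π : Equiv.Perm (Fin N), ∏ k, B k (π k))
        ≤ ∑ π : Equiv.Perm (Fin N), ∏ k, B' k (π k) := by
  have partially (s : Finset (Fin N)) : ∃ B' : Fin N → Fin N → ℝ,
      (∀ i j, 0 ≤ B' i j) ∧ (∀ i, ∑ j, B' i j = 1) ∧
      (∀ i j, B' i j ≤ 1 / (t i : ℝ)) ∧
      (∀ i ∈ s, ∀ j, B' i j = 0 ∨ B' i j = 1 / (t i : ℝ)) ∧
      (∑ π : Equiv.Perm (Fin N), ∏ k, B k (π k))
        ≤ ∑ π : Equiv.Perm (Fin N), ∏ k, B' k (π k) := by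
    induction s using Finset.induction_on with
    | empty => exact ⟨B, hB, hrow, hbound, by simp, le_rfl⟩
    | insert i s _ ih =>
      obtain ⟨C, hC, hCrow, hCbound, hCs, hper⟩ := ih
      obtain ⟨y, hy, hysum, hyle⟩ := exists_extreme_row
        (fun j => ∑ π : Equiv.Perm (Fin N) with π i = j, ∏ k ∈ univ.erase i, C k (π k))
        (C i) (ht i) (hC i) (hCrow i) (hCbound i)
      have hpos : 0 ≤ 1 / (t i : ℝ) := by positivity
      refine ⟨Function.update C i y, fun k => ?_, fun k => ?_, fun k => ?_, fun k hk => ?_, ?_⟩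
      · rcases eq_or_ne k i with rfl | h
        · intro j
          rw [Function.update_self]
          rcases hy j with h | h <;> rw [h]
          exact hpos
        · simpa only [Function.update_of_ne h] using hC k
      · rcases eq_or_ne k i with rfl | h
        · simpa only [Function.update_self] using hysum
        · simpa only [Function.update_of_ne h] using hCrow k
      · rcases eq_or_ne k i with rfl | h
        · intro j
          rw [Function.update_self]
          rcases hy j with h | h <;> rw [h]
          exact hpos
        · simpa only [Function.update_of_ne h] using hCbound k
      · rcases eq_or_ne k i with rfl | h
        · simpa only [Function.update_self] using hy
        · simpa only [Function.update_of_ne h] using hCs k (mem_of_mem_insert_of_ne hk h)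
      · refine hper.trans ?_
        rw [← sum_perm_prod_update, ← sum_perm_prod_update, Function.update_eq_self] at hyle
        exact hyle
  obtain ⟨B', h₁, h₂, h₃, h₄, h₅⟩ := partially univ
  exact ⟨B', h₁, h₂, h₃, fun i => h₄ i (mem_univ i), h₅⟩
end

section
/- Let r_1,…,r_m and c_1,…,c_n be positive integers with Σ_i r_i = Σ_j c_j = N, and let L=(l_ij) be an m×n matrix of non-negative reals with Σ_j l_ij = r_i for each i and Σ_i l_ij = c_j for each j. Let B be the N×N matrix whose block R_i×C_j is filled with the constant l_ij/(r_i c_j). Then B is doubly stochastic, every entry of B in the rows R_i is at most 1/r_i, every entry of B in the columns C_j is at most 1/c_j, and consequently per B ≤ min{ ∏_{i=1}^m r_i!/r_i^{r_i}, ∏_{j=1}^n c_j!/c_j^{c_j} }. -/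
open Finset in
/-- The permutations `π` with `ρ ∘ π = f` are empty or a coset of the stabilizer of `ρ`. -/
theorem card_perm_comp_eq_le {α ι : Type*} [Fintype α] [DecidableEq α] [Fintype ι] [DecidableEq ι]
    (ρ f : α → ι) :
    #{π : Equiv.Perm α | ρ ∘ π = f} ≤ ∏ i, (Fintype.card {a // ρ a = i}).factorial := by
  rw [← DomMulAct.stabilizer_card ρ, Fintype.card_subtype]
  rcases ({π : Equiv.Perm α | ρ ∘ π = f} : Finset _).eq_empty_or_nonempty with h | ⟨τ, hτ⟩
  · simp [h]
  · simp only [mem_filter, mem_univ, true_and] at hτ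
    refine card_le_card_of_injOn (fun π ↦ π * τ⁻¹) (fun π hπ ↦ ?_) fun _ _ _ _ h ↦ by simpa using h
    simp only [coe_filter, mem_univ, true_and, Set.mem_ofPred_eq] at hπ ⊢
    rw [← hτ] at hπ
    funext a
    simpa using congrFun hπ (τ⁻¹ a)

open Finset in
/-- Summing over permutations is dominated by summing over all maps `α → ι`. -/
theorem sum_perm_prod_le_prod_factorial {α ι : Type*} [Fintype α] [DecidableEq α]
    [Fintype ι] [DecidableEq ι] (ρ : α → ι) (y : ι → α → ℝ) (hy : ∀ i a, 0 ≤ y i a)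
    (hsum : ∀ a, ∑ i, y i a = 1) :
    ∑ π : Equiv.Perm α, ∏ a, y (ρ (π a)) a
      ≤ ∏ i, ((Fintype.card {a // ρ a = i}).factorial : ℝ) := by
  calc ∑ π : Equiv.Perm α, ∏ a, y (ρ (π a)) a
      = ∑ f : α → ι, ∑ π ∈ {π : Equiv.Perm α | ρ ∘ π = f}, ∏ a, y (ρ (π a)) a :=
        (sum_fiberwise univ (fun π : Equiv.Perm α ↦ ρ ∘ π) _).symm
    _ = ∑ f : α → ι, (#{π : Equiv.Perm α | ρ ∘ π = f} : ℝ) * ∏ a, y (f a) a := by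
        refine sum_congr rfl fun f _ ↦ ?_
        rw [← nsmul_eq_mul]
        refine sum_eq_card_nsmul fun π hπ ↦ ?_
        simp only [mem_filter, mem_univ, true_and] at hπ
        simp [← hπ]
    _ ≤ ∑ f : α → ι, (∏ i, ((Fintype.card {a // ρ a = i}).factorial : ℝ)) * ∏ a, y (f a) a := by
        gcongr with f
        · exact prod_nonneg fun a _ ↦ hy _ _
        · exact_mod_cast card_perm_comp_eq_le ρ f
    _ = ∏ i, ((Fintype.card {a // ρ a = i}).factorial : ℝ) := by
        rw [← mul_sum, ← Fintype.prod_sum (fun a i ↦ y i a)]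
        simp [hsum]

/-- Sum of a function over a type, computed along the fibres of a map. -/
theorem sum_comp_eq_sum_card_fiber_mul_s16 {α ι : Type*} [Fintype α] [Fintype ι] [DecidableEq ι]
    (ρ : α → ι) (g : ι → ℝ) :
    ∑ a, g (ρ a) = ∑ i, (Fintype.card {a // ρ a = i} : ℝ) * g i := by
  rw [← Finset.sum_fiberwise (s := Finset.univ) (g := ρ)]
  refine Finset.sum_congr rfl fun i _ ↦ ?_
  rw [Fintype.card_subtype, ← nsmul_eq_mul]
  exact Finset.sum_eq_card_nsmul (by simp +contextual)

/-- A permanent whose rows are constant along the fibres of `ρ` and whose columns sum to `1`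
is at most `∏ s_i! / s_i ^ s_i`, where the `s_i` are the fibre sizes. -/
theorem sum_perm_prod_le_prod_factorial_div_pow {α ι : Type*} [Fintype α] [DecidableEq α]
    [Fintype ι] [DecidableEq ι] (ρ : α → ι) (s : ι → ℕ) (hs : ∀ i, 0 < s i)
    (hρ : ∀ i, Fintype.card {a // ρ a = i} = s i)
    (A : ι → α → ℝ) (hA : ∀ i a, 0 ≤ A i a) (hsum : ∀ b, ∑ a, A (ρ a) b = 1) :
    ∑ π : Equiv.Perm α, ∏ a, A (ρ (π a)) a ≤ ∏ i, ((s i).factorial : ℝ) / (s i : ℝ) ^ s i := by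
  have hpow : ∏ a, (s (ρ a) : ℝ) = ∏ i, (s i : ℝ) ^ s i := by
    rw [← Finset.prod_fiberwise (s := Finset.univ) (g := ρ)]
    refine Finset.prod_congr rfl fun i _ ↦ ?_
    rw [Finset.prod_congr rfl (g := fun _ ↦ (s i : ℝ)) (by simp +contextual),
      Finset.prod_const, ← Fintype.card_subtype, hρ]
  have key := sum_perm_prod_le_prod_factorial ρ (fun i a ↦ (s i : ℝ) * A i a)
    (fun i a ↦ mul_nonneg (Nat.cast_nonneg _) (hA i a)) fun b ↦ by
      simpa [sum_comp_eq_sum_card_fiber_mul_s16 ρ (fun i ↦ A i b), hρ] using hsum b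
  have hpos : 0 < ∏ i, (s i : ℝ) ^ s i :=
    Finset.prod_pos fun i _ ↦ pow_pos (Nat.cast_pos.2 (hs i)) _
  rw [Finset.prod_div_distrib, le_div_iff₀ hpos, ← hpow, Finset.sum_mul]
  simp only [hρ, Finset.prod_mul_distrib] at key
  refine le_of_eq_of_le (Finset.sum_congr rfl fun π _ ↦ ?_) key
  rw [mul_comm, Equiv.prod_comp π fun a ↦ (s (ρ a) : ℝ)]

/-- If `L = (l_ij)` is a non-negative `m × n` matrix with row sums `r_i`
and column sums `c_j`, and `B` is the `N × N` matrix whose block `R_i × C_j` is filled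
with `l_ij/(r_i c_j)`, then `B` is doubly stochastic, its entries in the rows `R_i` are at
most `1/r_i`, its entries in the columns `C_j` are at most `1/c_j`, and consequently
`per B ≤ min{∏_i r_i!/r_i^{r_i}, ∏_j c_j!/c_j^{c_j}}`. -/
theorem block_doubly_stochastic_permanent_upper_bound
    (m n N : ℕ) (r : Fin m → ℕ) (c : Fin n → ℕ)
    (hr : ∀ i, 0 < r i) (hc : ∀ j, 0 < c j)
    (hrN : ∑ i, r i = N) (hcN : ∑ j, c j = N)
    (ρ : Fin N → Fin m) (κ : Fin N → Fin n)
    (hρ : ∀ i, Nat.card {p : Fin N // ρ p = i} = r i)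
    (hκ : ∀ j, Nat.card {q : Fin N // κ q = j} = c j)
    (L : Fin m → Fin n → ℝ) (hL : ∀ i j, 0 ≤ L i j)
    (hLr : ∀ i, ∑ j, L i j = r i) (hLc : ∀ j, ∑ i, L i j = c j)
    (B : Fin N → Fin N → ℝ)
    (hB : ∀ p q, B p q = L (ρ p) (κ q) / ((r (ρ p) : ℝ) * (c (κ q) : ℝ))) :
    (∀ p q, 0 ≤ B p q) ∧
    (∀ p, ∑ q, B p q = 1) ∧ (∀ q, ∑ p, B p q = 1) ∧
    (∀ p q, B p q ≤ 1 / (r (ρ p) : ℝ)) ∧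
    (∀ p q, B p q ≤ 1 / (c (κ q) : ℝ)) ∧
    (∑ π : Equiv.Perm (Fin N), ∏ k, B k (π k))
      ≤ min (∏ i, (Nat.factorial (r i) : ℝ) / (r i : ℝ) ^ (r i))
          (∏ j, (Nat.factorial (c j) : ℝ) / (c j : ℝ) ^ (c j)) := by
  have hr' : ∀ i, (0 : ℝ) < r i := fun i ↦ Nat.cast_pos.2 (hr i)
  have hc' : ∀ j, (0 : ℝ) < c j := fun j ↦ Nat.cast_pos.2 (hc j)
  simp only [Nat.card_eq_fintype_card] at hρ hκ
  have hnonneg : ∀ p q, 0 ≤ B p q := fun p q ↦ by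
    rw [hB]; exact div_nonneg (hL _ _) (mul_pos (hr' _) (hc' _)).le
  have hrow : ∀ p, ∑ q, B p q = 1 := fun p ↦ by
    simp only [hB]
    rw [sum_comp_eq_sum_card_fiber_mul_s16 κ fun j ↦ L (ρ p) j / ((r (ρ p) : ℝ) * c j),
      ← div_self (hr' (ρ p)).ne', ← hLr, Finset.sum_div]
    refine Finset.sum_congr rfl fun j _ ↦ ?_
    rw [hκ, hLr]
    have := (hr' (ρ p)).ne'
    have := (hc' j).ne'
    field_simp
  have hcol : ∀ q, ∑ p, B p q = 1 := fun q ↦ by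
    simp only [hB]
    rw [sum_comp_eq_sum_card_fiber_mul_s16 ρ fun i ↦ L i (κ q) / ((r i : ℝ) * c (κ q)),
      ← div_self (hc' (κ q)).ne', ← hLc, Finset.sum_div]
    refine Finset.sum_congr rfl fun i _ ↦ ?_
    rw [hρ, hLc]
    have := (hr' i).ne'
    have := (hc' (κ q)).ne'
    field_simp
  refine ⟨hnonneg, hrow, hcol, fun p q ↦ ?_, fun p q ↦ ?_, le_min ?_ ?_⟩
  · have h : L (ρ p) (κ q) ≤ c (κ q) :=
      hLc (κ q) ▸ Finset.single_le_sum (fun i _ ↦ hL i _) (Finset.mem_univ (ρ p))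
    rw [hB, div_le_div_iff₀ (mul_pos (hr' _) (hc' _)) (hr' _)]
    nlinarith [hr' (ρ p)]
  · have h : L (ρ p) (κ q) ≤ r (ρ p) :=
      hLr (ρ p) ▸ Finset.single_le_sum (fun j _ ↦ hL _ j) (Finset.mem_univ (κ q))
    rw [hB, div_le_div_iff₀ (mul_pos (hr' _) (hc' _)) (hc' _)]
    nlinarith [hc' (κ q)]
  · have key := sum_perm_prod_le_prod_factorial_div_pow ρ r hr hρ
      (fun i q ↦ L i (κ q) / ((r i : ℝ) * c (κ q)))
      (fun i q ↦ div_nonneg (hL _ _) (mul_pos (hr' _) (hc' _)).le)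
      (fun q ↦ by simpa only [hB] using hcol q)
    refine le_of_eq_of_le ?_ key
    refine Fintype.sum_equiv (Equiv.inv _) _ _ fun π ↦ ?_
    refine Fintype.prod_equiv π _ _ fun k ↦ ?_
    simp [hB]
  · simp only [hB]
    exact sum_perm_prod_le_prod_factorial_div_pow κ c hc hκ
      (fun j p ↦ L (ρ p) j / ((r (ρ p) : ℝ) * c j))
      (fun j p ↦ div_nonneg (hL _ _) (mul_pos (hr' _) (hc' _)).le)
      (fun p ↦ by simpa only [hB] using hrow p)
end

section
/- Let r_1,…,r_m and c_1,…,c_n be positive integers with Σ_i r_i = Σ_j c_j = N and let W=(w_ij) be an m×n matrix of strictly positive reals. Define T(R,C;W) = (1/(r_1!⋯r_m!·c_1!⋯c_n!)) ∫_{ℝ^{mn}_+} per A(γ) · exp(−Σ_{ij} γ_ij) dγ and T'(R,C;W) = (N!/N^N)·(1/(r_1!⋯r_m!·c_1!⋯c_n!)) ∫_{ℝ^{mn}_+} S(γ) · exp(−Σ_{ij} γ_ij) dγ, where S(γ) = exp(inf_{t∈H} f_{A(γ)}(t)). Then T'(R,C;W) ≤ T(R,C;W) ≤ α(R,C)·T'(R,C;W),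 where α(R,C) = (N^N/N!)·min{ ∏_{i=1}^m r_i!/r_i^{r_i}, ∏_{j=1}^n c_j!/c_j^{c_j} }. -/
open MeasureTheory

theorem weighted_sq_sub_quadratic {ι : Type*} [Fintype ι] (M : ι → ι → ℝ)
    (hM : ∀ i j, M i j = M j i) (c y : ι → ℝ) (hc : ∀ i, 0 < c i) :
    2 * (∑ i, y i ^ 2 * (∑ j, M i j * c j) / c i - ∑ i, y i * ∑ j, M i j * y j) =
      ∑ i, ∑ j, M i j * c i * c j * (y i / c i - y j / c j) ^ 2 := by
  have h1 : ∑ i, y i ^ 2 * (∑ j, M i j * c j) / c i = ∑ i, ∑ j, M i j * c j * (y i ^ 2 / c i) := by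
    refine Finset.sum_congr rfl fun i _ => ?_
    rw [mul_div_right_comm, mul_comm, Finset.sum_mul]
  have h2 : ∑ i, y i ^ 2 * (∑ j, M i j * c j) / c i = ∑ i, ∑ j, M i j * c i * (y j ^ 2 / c j) := by
    rw [h1, Finset.sum_comm]
    simp_rw [hM]
  rw [two_mul]
  nth_rewrite 1 [h1]
  rw [h2]
  simp_rw [Finset.mul_sum, ← Finset.sum_sub_distrib, ← Finset.sum_add_distrib]
  refine Finset.sum_congr rfl fun i _ => Finset.sum_congr rfl fun j _ => ?_
  have := (hc i).ne'
  have := (hc j).ne'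
  field_simp
  ring

/-- A symmetric matrix `M` with positive off-diagonal entries is nonpositive on the orthogonal
complement of `M c` as soon as it satisfies the Bochner-type inequality `h` for the positive
vector `c`. -/
theorem quadratic_nonpos_of_orthogonal {ι : Type*} [Fintype ι] [DecidableEq ι] (M : ι → ι → ℝ)
    (hM : ∀ i j, M i j = M j i) (hpos : ∀ i j, i ≠ j → 0 < M i j)
    (c : ι → ℝ) (hc : ∀ i, 0 < c i) (hMc : ∀ i, 0 < ∑ j, M i j * c j)
    (hnn : ∀ i j, 0 ≤ M i j)
    (h : ∀ y : ι → ℝ, ∑ i, y i * ∑ j, M i j * y j ≤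
      ∑ i, c i * (∑ j, M i j * y j) ^ 2 / ∑ j, M i j * c j)
    (x : ι → ℝ) (hx : ∑ i, x i * ∑ j, M i j * c j = 0) :
    ∑ i, x i * ∑ j, M i j * x j ≤ 0 := by
  obtain ⟨d, hd, hd2⟩ : ∃ d : ι → ℝ, (∀ i, 0 < d i) ∧
      ∀ i, d i ^ 2 * (∑ j, M i j * c j) = c i := by
    refine ⟨fun i => √(c i / ∑ j, M i j * c j), fun i => Real.sqrt_pos.2 (div_pos (hc i) (hMc i)),
      fun i => ?_⟩
    have := (hMc i).ne'
    rw [Real.sq_sqrt (div_pos (hc i) (hMc i)).le]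
    field_simp
  set S : Matrix ι ι ℝ := Matrix.of fun i j => d i * M i j * d j with hS
  have hSh : S.IsHermitian := by
    ext i j
    simp only [hS, Matrix.conjTranspose_apply, Matrix.of_apply, star_trivial]
    rw [hM j i]; ring
  set z : EuclideanSpace ℝ ι := WithLp.toLp 2 fun i => x i / d i with hz
  set b := hSh.eigenvectorBasis with hb
  have key : ∀ k, hSh.eigenvalues k * (inner ℝ (b k) z) ^ 2 ≤ 0 := by
    intro k
    by_cases hk : hSh.eigenvalues k ≤ 0
    · exact mul_nonpos_of_nonpos_of_nonneg hk (sq_nonneg _)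
    push Not at hk
    set l := hSh.eigenvalues k with hl
    set v : ι → ℝ := fun i => b k i with hv
    have hev : ∀ i, ∑ j, M i j * (d j * v j) = l * v i / d i := by
      intro i
      have := congrFun (hSh.mulVec_eigenvectorBasis k) i
      simp only [Matrix.mulVec, dotProduct, hS, Matrix.of_apply, Pi.smul_apply, smul_eq_mul] at this
      rw [eq_div_iff (hd i).ne', Finset.sum_mul, hl, hv, ← this]
      refine Finset.sum_congr rfl fun j _ => ?_
      ring
    have hnorm : ∑ i, v i ^ 2 = 1 := by
      have h1 := b.norm_eq_one k
      rw [EuclideanSpace.norm_eq, Real.sqrt_eq_one] at h1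
      simpa using h1
    have hq : ∑ i, (d i * v i) * ∑ j, M i j * (d j * v j) = l := by
      simp_rw [hev]
      refine Eq.trans ?_ (show l * ∑ i, v i ^ 2 = l by rw [hnorm, mul_one])
      rw [Finset.mul_sum]
      refine Finset.sum_congr rfl fun i _ => ?_
      have := (hd i).ne'
      field_simp
    have hl2 : l ≤ l ^ 2 := by
      have h1 := h (fun j => d j * v j)
      rw [hq] at h1
      refine h1.trans_eq ?_
      refine Eq.trans ?_ (show l ^ 2 * ∑ i, v i ^ 2 = l ^ 2 by rw [hnorm, mul_one])
      rw [Finset.mul_sum]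
      refine Finset.sum_congr rfl fun i _ => ?_
      rw [hev, ← hd2 i]
      have := (hd i).ne'
      have := (hMc i).ne'
      field_simp
    have hl1 : 1 ≤ l := by nlinarith
    have hq2 : ∑ i, (d i * v i) ^ 2 * (∑ j, M i j * c j) / c i = 1 := by
      rw [← hnorm]
      refine Finset.sum_congr rfl fun i _ => ?_
      have := (hc i).ne'
      rw [div_eq_iff this, ← hd2 i]
      ring
    have hid := weighted_sq_sub_quadratic M hM c (fun i => d i * v i) hc
    rw [hq2, hq] at hid
    have hterm : ∀ i j, 0 ≤ M i j * c i * c j * (d i * v i / c i - d j * v j / c j) ^ 2 :=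
      fun i j => mul_nonneg (mul_nonneg (mul_nonneg (hnn i j) (hc i).le) (hc j).le) (sq_nonneg _)
    have hzero : ∀ i j, d i * v i / c i = d j * v j / c j := by
      intro i j
      by_cases hij : i = j
      · rw [hij]
      have h1 : M i j * c i * c j * (d i * v i / c i - d j * v j / c j) ^ 2 ≤ 0 :=
        calc _ ≤ ∑ j, M i j * c i * c j * (d i * v i / c i - d j * v j / c j) ^ 2 :=
              Finset.single_le_sum (fun j _ => hterm i j) (Finset.mem_univ j)
          _ ≤ ∑ i, ∑ j, M i j * c i * c j * (d i * v i / c i - d j * v j / c j) ^ 2 :=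
              Finset.single_le_sum (f := fun i => ∑ j, M i j * c i * c j *
                (d i * v i / c i - d j * v j / c j) ^ 2)
                (fun i _ => Finset.sum_nonneg fun j _ => hterm i j) (Finset.mem_univ i)
          _ ≤ 0 := by rw [← hid]; linarith
      have h2 : 0 < M i j * c i * c j := mul_pos (mul_pos (hpos i j hij) (hc i)) (hc j)
      have h3 : (d i * v i / c i - d j * v j / c j) ^ 2 = 0 :=
        le_antisymm (nonpos_of_mul_nonpos_right h1 h2) (sq_nonneg _)
      exact sub_eq_zero.1 (pow_eq_zero_iff two_ne_zero |>.1 h3)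
    have hinner : inner ℝ (b k) z = 0 := by
      rw [PiLp.inner_apply]
      rcases isEmpty_or_nonempty ι with he | ⟨⟨i0⟩⟩
      · simp
      have h1 : ∀ i, inner ℝ (b k i) (z i) =
          (d i0 * v i0 / c i0) * (x i * ∑ j, M i j * c j) := by
        intro i
        rw [hzero i0 i]
        have := (hc i).ne'
        have := (hd i).ne'
        have hc' := hd2 i
        simp only [hz, RCLike.inner_apply, conj_trivial]
        change x i / d i * v i = _
        rw [← hc']
        have := (hMc i).ne'
        field_simp
      simp_rw [h1]
      rw [← Finset.mul_sum, hx, mul_zero]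
    rw [hinner]; simp
  have hfin : ∑ i, x i * ∑ j, M i j * x j = ∑ k, hSh.eigenvalues k * (inner ℝ (b k) z) ^ 2 := by
    have h1 : ∑ i, x i * ∑ j, M i j * x j = inner ℝ (WithLp.toLp 2 (S.mulVec z.ofLp)) z := by
      rw [PiLp.inner_apply]
      refine Finset.sum_congr rfl fun i _ => ?_
      simp only [RCLike.inner_apply, conj_trivial, Matrix.mulVec, dotProduct, hS, Matrix.of_apply, hz]
      have := (hd i).ne'
      rw [Finset.mul_sum, Finset.mul_sum]
      refine Finset.sum_congr rfl fun j _ => ?_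
      have := (hd j).ne'
      field_simp
    rw [h1, ← b.sum_inner_mul_inner]
    refine Finset.sum_congr rfl fun k _ => ?_
    have h2 : inner ℝ (WithLp.toLp 2 (S.mulVec z.ofLp)) (b k) =
        hSh.eigenvalues k * inner ℝ (b k) z := by
      have h3 : S.mulVec (b k).ofLp = hSh.eigenvalues k • (b k).ofLp :=
        hSh.mulVec_eigenvectorBasis k
      have hT : S.transpose = S := by rw [← Matrix.conjTranspose_eq_transpose_of_trivial]; exact hSh
      rw [EuclideanSpace.inner_eq_star_dotProduct, EuclideanSpace.inner_eq_star_dotProduct]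
      simp only [star_trivial]
      rw [Matrix.dotProduct_mulVec, ← Matrix.mulVec_transpose, hT, h3, smul_dotProduct, smul_eq_mul,
        dotProduct_comm]
    rw [h2]; ring
  rw [hfin]
  exact Finset.sum_nonpos fun k _ => key k

/-- The sum, over all ways of choosing distinct elements of `S` for the entries of the list, of the
product of the values of the entries at the chosen elements. -/
noncomputable def injectiveSum {ι : Type*} [DecidableEq ι] : Finset ι → List (ι → ℝ) → ℝ
  | _, [] => 1
  | S, a :: L => ∑ i ∈ S, a i * injectiveSum (S.erase i) L

section InjectiveSum

variable {ι : Type*} [DecidableEq ι]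

theorem injectiveSum_cons (S : Finset ι) (a : ι → ℝ) (L : List (ι → ℝ)) :
    injectiveSum S (a :: L) = ∑ i ∈ S, a i * injectiveSum (S.erase i) L := rfl

theorem injectiveSum_pos (L : List (ι → ℝ)) (hL : ∀ a ∈ L, ∀ i, 0 < a i) :
    ∀ S : Finset ι, L.length ≤ S.card → 0 < injectiveSum S L := by
  induction L with
  | nil => intro S _; simp [injectiveSum]
  | cons a L ih =>
    intro S hS
    rw [List.length_cons] at hS
    have hne : S.Nonempty := Finset.card_pos.1 (by omega)
    refine Finset.sum_pos (fun i hi => mul_pos (hL a (by simp) i) ?_) hne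
    exact ih (fun b hb => hL b (by simp [hb])) _ (by rw [Finset.card_erase_of_mem hi]; omega)

theorem injectiveSum_cons_cons (S : Finset ι) (a b : ι → ℝ) (L : List (ι → ℝ)) :
    injectiveSum S (a :: b :: L) = ∑ i ∈ S, a i * ∑ j ∈ S,
      (if i = j then 0 else injectiveSum ((S.erase i).erase j) L) * b j := by
  rw [injectiveSum_cons]
  refine Finset.sum_congr rfl fun i hi => ?_
  rw [injectiveSum_cons, ← Finset.add_sum_erase S _ hi]
  simp only [if_true, zero_mul, zero_add]
  congr 1
  refine Finset.sum_congr rfl fun j hj => ?_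
  rw [if_neg (Finset.ne_of_mem_erase hj).symm, mul_comm]

theorem injectiveSum_swap (S : Finset ι) (a b : ι → ℝ) (L : List (ι → ℝ)) :
    injectiveSum S (a :: b :: L) = injectiveSum S (b :: a :: L) := by
  rw [injectiveSum_cons_cons, injectiveSum_cons_cons]
  simp_rw [Finset.mul_sum]
  rw [Finset.sum_comm]
  refine Finset.sum_congr rfl fun i _ => Finset.sum_congr rfl fun j _ => ?_
  rw [Finset.erase_right_comm]
  simp only [eq_comm]
  ring

theorem injectiveSum_perm {L L' : List (ι → ℝ)} (h : L.Perm L') :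
    ∀ S : Finset ι, injectiveSum S L = injectiveSum S L' := by
  induction h with
  | nil => intro S; rfl
  | cons a _ ih => intro S; simp only [injectiveSum_cons, ih]
  | swap a b L => intro S; exact injectiveSum_swap S b a L
  | trans _ _ ih₁ ih₂ => intro S; rw [ih₁, ih₂]

theorem injectiveSum_cons_add_smul (S : Finset ι) (a b : ι → ℝ) (s t : ℝ) (L : List (ι → ℝ)) :
    injectiveSum S ((fun i => s * a i + t * b i) :: L) =
      s * injectiveSum S (a :: L) + t * injectiveSum S (b :: L) := by
  simp only [injectiveSum_cons, Finset.mul_sum, ← Finset.sum_add_distrib]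
  exact Finset.sum_congr rfl fun i _ => by ring

theorem quadratic_nonpos_of_orthogonal_on (S : Finset ι) (M : ι → ι → ℝ)
    (hM : ∀ i j, M i j = M j i) (hpos : ∀ i ∈ S, ∀ j ∈ S, i ≠ j → 0 < M i j)
    (c : ι → ℝ) (hc : ∀ i, 0 < c i) (hMc : ∀ i ∈ S, 0 < ∑ j ∈ S, M i j * c j)
    (hnn : ∀ i ∈ S, ∀ j ∈ S, 0 ≤ M i j)
    (h : ∀ y : ι → ℝ, ∑ i ∈ S, y i * ∑ j ∈ S, M i j * y j ≤
      ∑ i ∈ S, c i * (∑ j ∈ S, M i j * y j) ^ 2 / ∑ j ∈ S, M i j * c j)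
    (x : ι → ℝ) (hx : ∑ i ∈ S, x i * ∑ j ∈ S, M i j * c j = 0) :
    ∑ i ∈ S, x i * ∑ j ∈ S, M i j * x j ≤ 0 := by
  have e : ∀ f : ι → ℝ, ∑ i ∈ S, f i = ∑ i : S, f i := fun f => (Finset.sum_coe_sort S f).symm
  simp only [e] at *
  refine quadratic_nonpos_of_orthogonal (fun i j : S => M i j) (fun i j => hM i j)
    (fun i j hij => hpos i i.2 j j.2 fun h => hij (Subtype.ext h)) (fun i => c i) (fun i => hc i)
    (fun i => hMc i i.2) (fun i j => hnn i i.2 j j.2) (fun y => ?_) (fun i => x i) hx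
  have := h (fun i => if hi : i ∈ S then y ⟨i, hi⟩ else 0)
  simpa using this

/-- The Alexandrov–Fenchel inequality for permanents. -/
theorem injectiveSum_mul_le_sq (L : List (ι → ℝ)) (hL : ∀ a ∈ L, ∀ i, 0 < a i) :
    ∀ (S : Finset ι), S.card = L.length + 2 → ∀ (x y : ι → ℝ), (∀ i, 0 < y i) →
      injectiveSum S (x :: x :: L) * injectiveSum S (y :: y :: L) ≤
        injectiveSum S (x :: y :: L) ^ 2 := by
  induction L with
  | nil =>
    intro S hS x y _
    obtain ⟨p, q, hpq, rfl⟩ := Finset.card_eq_two.1 hS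
    have key : ∀ a b : ι → ℝ, injectiveSum {p, q} [a, b] = a p * b q + a q * b p := by
      intro a b
      simp [Finset.sum_pair hpq, hpq, hpq.symm, injectiveSum]
    rw [key, key, key]
    nlinarith [sq_nonneg (x p * y q - x q * y p)]
  | cons c L ih =>
    intro S hS x y hy
    rw [List.length_cons] at hS
    have hc : ∀ i, 0 < c i := hL c (by simp)
    have hL' : ∀ a ∈ L, ∀ i, 0 < a i := fun a ha => hL a (by simp [ha])
    set M : ι → ι → ℝ := fun i j =>
      if i = j then 0 else injectiveSum ((S.erase i).erase j) (c :: L) with hMdef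
    have hQ : ∀ a b : ι → ℝ, injectiveSum S (a :: b :: c :: L) =
        ∑ i ∈ S, a i * ∑ j ∈ S, M i j * b j := fun a b => injectiveSum_cons_cons S a b _
    have hrow : ∀ (b : ι → ℝ), ∀ i ∈ S, ∑ j ∈ S, M i j * b j =
        injectiveSum (S.erase i) (b :: c :: L) := by
      intro b i hi
      rw [injectiveSum_cons, ← Finset.add_sum_erase S _ hi]
      simp only [hMdef, if_true, zero_mul, zero_add]
      refine Finset.sum_congr rfl fun j hj => ?_
      rw [if_neg (Finset.ne_of_mem_erase hj).symm, mul_comm]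
    have hcardi : ∀ i ∈ S, (S.erase i).card = L.length + 2 := fun i hi => by
      rw [Finset.card_erase_of_mem hi]; omega
    have hMc : ∀ i ∈ S, 0 < ∑ j ∈ S, M i j * c j := by
      intro i hi
      rw [hrow c i hi]
      refine injectiveSum_pos _ ?_ _ (by simp [hcardi i hi])
      intro a ha
      rcases List.mem_cons.1 ha with rfl | ha
      · exact hc
      · exact hL a ha
    have hpos : ∀ i ∈ S, ∀ j ∈ S, i ≠ j → 0 < M i j := by
      intro i hi j hj hij
      simp only [hMdef, if_neg hij]
      refine injectiveSum_pos _ hL _ ?_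
      rw [Finset.card_erase_of_mem (Finset.mem_erase.2 ⟨hij.symm, hj⟩), hcardi i hi]
      simp
    have horth : ∀ z : ι → ℝ, injectiveSum S (z :: c :: c :: L) = 0 →
        injectiveSum S (z :: z :: c :: L) ≤ 0 := by
      intro z hz
      rw [hQ] at hz ⊢
      refine quadratic_nonpos_of_orthogonal_on S M ?_ hpos c hc hMc ?_ ?_ z hz
      · intro i j
        simp only [hMdef, eq_comm (a := i), Finset.erase_right_comm (a := i)]
      · intro i hi j hj
        by_cases hij : i = j
        · simp [hMdef, hij]
        · exact (hpos i hi j hj hij).le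
      · intro w
        have hexp : ∑ i ∈ S, w i * ∑ j ∈ S, M i j * w j =
            ∑ i ∈ S, c i * injectiveSum (S.erase i) (w :: w :: L) := by
          rw [← hQ, ← injectiveSum_cons]
          exact injectiveSum_perm
            (((List.Perm.swap c w L).cons w).trans (List.Perm.swap c w (w :: L))) S
        rw [hexp]
        refine Finset.sum_le_sum fun i hi => ?_
        have hMci := hMc i hi
        rw [le_div_iff₀ hMci, mul_assoc]
        refine mul_le_mul_of_nonneg_left ?_ (hc i).le
        rw [hrow w i hi, hrow c i hi]
        exact ih hL' _ (hcardi i hi) w c hc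
    have hposyy : ∀ a : ι → ℝ, (∀ i, 0 < a i) → 0 < injectiveSum S (y :: a :: c :: L) := by
      intro a ha
      refine injectiveSum_pos _ ?_ _ (by simp [hS])
      intro b hb
      rcases List.mem_cons.1 hb with rfl | hb
      · exact hy
      rcases List.mem_cons.1 hb with rfl | hb
      · exact ha
      · exact hL b hb
    have hyy := hposyy y hy
    have hyc := hposyy c hc
    set α := injectiveSum S (y :: c :: c :: L) with hα
    set β := injectiveSum S (x :: c :: c :: L) with hβ
    have hz := horth (fun i => α * x i + (-β) * y i) (by
      rw [injectiveSum_cons_add_smul, ← hα, ← hβ]; ring)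
    rw [injectiveSum_cons_add_smul, injectiveSum_swap S x, injectiveSum_swap S y,
      injectiveSum_cons_add_smul, injectiveSum_cons_add_smul, injectiveSum_swap S y x] at hz
    set X := injectiveSum S (x :: x :: c :: L)
    set Y := injectiveSum S (y :: y :: c :: L)
    set Z := injectiveSum S (x :: y :: c :: L)
    have h1 : (X * Y - Z ^ 2) * α ^ 2 ≤ 0 := by
      have h2 : Y * (α * (α * X + -β * Z) + -β * (α * Z + -β * Y)) ≤ 0 :=
        mul_nonpos_of_nonneg_of_nonpos hyy.le hz
      nlinarith [sq_nonneg (Y * β - Z * α)]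
    have h3 : X * Y - Z ^ 2 ≤ 0 := nonpos_of_mul_nonpos_left h1 (by positivity)
    linarith

theorem pow_mul_le_pow_of_logConcave (m : ℕ → ℝ) (k : ℕ) (hm : ∀ i, i ≤ k + 1 → 0 < m i)
    (h : ∀ i, i + 2 ≤ k + 1 → m i * m (i + 2) ≤ m (i + 1) ^ 2) :
    m 0 ^ k * m (k + 1) ≤ m 1 ^ (k + 1) := by
  have hratio : ∀ i, i ≤ k → m (i + 1) * m 0 ≤ m 1 * m i := by
    intro i
    induction i with
    | zero => intro _; exact le_rfl
    | succ i ih =>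
      intro hi
      have h1 := ih (by omega)
      have h2 := h i (by omega)
      have h3 := hm i (by omega)
      have h4 := hm (i + 1) (by omega)
      have h5 := hm 0 (by omega)
      refine le_of_mul_le_mul_left ?_ h3
      nlinarith [mul_le_mul_of_nonneg_right h2 h5.le, mul_le_mul_of_nonneg_left h1 h4.le]
  have hmain : ∀ i, i ≤ k → m 0 ^ i * m (i + 1) ≤ m 1 ^ (i + 1) := by
    intro i
    induction i with
    | zero => intro _; simp
    | succ i ih =>
      intro hi
      have h1 := ih (by omega)
      have h2 := hratio (i + 1) hi
      have h3 : 0 ≤ m 0 ^ i := pow_nonneg (hm 0 (by omega)).le i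
      have h4 := hm 1 (by omega)
      calc m 0 ^ (i + 1) * m (i + 1 + 1) = m 0 ^ i * (m (i + 1 + 1) * m 0) := by ring
        _ ≤ m 0 ^ i * (m 1 * m (i + 1)) := mul_le_mul_of_nonneg_left h2 h3
        _ = m 1 * (m 0 ^ i * m (i + 1)) := by ring
        _ ≤ m 1 * m 1 ^ (i + 1) := mul_le_mul_of_nonneg_left h1 h4.le
        _ = m 1 ^ (i + 1 + 1) := by ring
  exact hmain k le_rfl

theorem injectiveSum_replicate_pow_le (S : Finset ι) (k : ℕ) (L : List (ι → ℝ))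
    (hL : ∀ a ∈ L, ∀ i, 0 < a i) (hS : S.card = k + 1 + L.length)
    (u w : ι → ℝ) (hu : ∀ i, 0 < u i) (hw : ∀ i, 0 < w i) :
    injectiveSum S (List.replicate (k + 1) u ++ L) ^ k *
        injectiveSum S (List.replicate (k + 1) w ++ L) ≤
      injectiveSum S (w :: (List.replicate k u ++ L)) ^ (k + 1) := by
  have hmem : ∀ i j : ℕ, ∀ a ∈ List.replicate i u ++ (List.replicate j w ++ L), ∀ p, 0 < a p := by
    intro i j a ha p
    simp only [List.mem_append, List.mem_replicate] at ha
    rcases ha with ⟨_, rfl⟩ | ⟨_, rfl⟩ | ha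
    · exact hu p
    · exact hw p
    · exact hL a ha p
  have := pow_mul_le_pow_of_logConcave (fun i => injectiveSum S
    (List.replicate (k + 1 - i) u ++ (List.replicate i w ++ L))) k ?_ ?_
  · simp only [Nat.sub_zero, List.replicate_zero, List.nil_append, Nat.sub_self,
      Nat.add_sub_cancel, List.replicate_one, List.singleton_append] at this
    rwa [injectiveSum_perm (List.perm_middle (a := w))] at this
  · intro i hi
    refine injectiveSum_pos _ (hmem _ _) _ ?_
    simp only [List.length_append, List.length_replicate]
    omega
  · intro i hi
    obtain ⟨j, rfl⟩ : ∃ j, k = i + j + 1 := ⟨k - i - 1, by omega⟩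
    have e0 : i + j + 1 + 1 - i = j + 2 := by omega
    have e1 : i + j + 1 + 1 - (i + 1) = j + 1 := by omega
    have e2 : i + j + 1 + 1 - (i + 2) = j := by omega
    simp only [e0, e1, e2]
    have h := injectiveSum_mul_le_sq (List.replicate j u ++ (List.replicate i w ++ L))
      (hmem j i) S (by simp only [List.length_append, List.length_replicate]; omega) u w hw
    have p1 : (List.replicate (j + 1) u ++ (List.replicate (i + 1) w ++ L)).Perm
        (u :: w :: (List.replicate j u ++ (List.replicate i w ++ L))) := by
      simp only [List.replicate_succ, List.cons_append]
      exact List.perm_middle.cons u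
    have p2 : (List.replicate j u ++ (List.replicate (i + 2) w ++ L)).Perm
        (w :: w :: (List.replicate j u ++ (List.replicate i w ++ L))) := by
      simp only [List.replicate_succ, List.cons_append]
      exact List.perm_middle.trans (List.perm_middle.cons w)
    rw [injectiveSum_perm p1, injectiveSum_perm p2]
    exact h

/-- The capacity inequality of Gurvits. -/
theorem capacity_le_injectiveSum (S : Finset ι) (A : ℕ → ι → ℝ) (hA : ∀ j i, 0 < A j i) (k : ℕ) :
    ∀ (L : List (ι → ℝ)), (∀ a ∈ L, ∀ i, 0 < a i) → S.card = k + L.length →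
      ∀ s : ℝ, (∀ x : ℕ → ℝ, (∀ j, 0 < x j) → s * ∏ j ∈ Finset.range k, x j ≤
        injectiveSum S (List.replicate k (fun i => ∑ j ∈ Finset.range k, x j * A j i) ++ L)) →
      s ≤ (k : ℝ) ^ k * injectiveSum S ((List.range k).map A ++ L) := by
  induction k with
  | zero =>
    intro L _ _ s hs
    simpa using hs 1 (by simp)
  | succ k ih =>
    intro L hL hS s hs
    have hL' : ∀ a ∈ A k :: L, ∀ i, 0 < a i := by
      intro a ha
      rcases List.mem_cons.1 ha with rfl | ha
      · exact hA k
      · exact hL a ha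
    have hmap : (List.range (k + 1)).map A ++ L = (List.range k).map A ++ (A k :: L) := by
      simp [List.range_succ]
    have hkpos : (0 : ℝ) < (k : ℝ) ^ k := by
      rcases k.eq_zero_or_pos with rfl | hk
      · simp
      · positivity
    have hk1 : (0 : ℝ) < ((k : ℝ) + 1) ^ (k + 1) := by positivity
    have hstep := ih (A k :: L) hL' (by simp only [List.length_cons]; omega)
      (s * k ^ k / ((k : ℝ) + 1) ^ (k + 1)) ?_
    · rw [hmap]
      push_cast
      rw [div_le_iff₀ hk1] at hstep
      refine le_of_mul_le_mul_left ?_ hkpos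
      linarith
    intro x hx
    rcases k.eq_zero_or_pos with rfl | hk
    · have := hs 1 (by simp)
      simpa using this
    set u : ι → ℝ := fun i => ∑ j ∈ Finset.range k, x j * A j i with hu
    have hupos : ∀ i, 0 < u i := fun i =>
      Finset.sum_pos (fun j _ => mul_pos (hx j) (hA j i)) (Finset.nonempty_range_iff.2 hk.ne')
    have hmem : ∀ a ∈ List.replicate (k + 1) u ++ L, ∀ i, 0 < a i := by
      intro a ha
      rcases List.mem_append.1 ha with ha | ha
      · rw [(List.mem_replicate.1 ha).2]; exact hupos
      · exact hL a ha
    have hmem' : ∀ a ∈ List.replicate k u ++ (A k :: L), ∀ i, 0 < a i := by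
      intro a ha
      rcases List.mem_append.1 ha with ha | ha
      · rw [(List.mem_replicate.1 ha).2]; exact hupos
      · exact hL' a ha
    set m0 := injectiveSum S (List.replicate (k + 1) u ++ L) with hm0
    set m1 := injectiveSum S (List.replicate k u ++ (A k :: L)) with hm1
    have hm0pos : 0 < m0 := injectiveSum_pos _ hmem _ (by simp [hS])
    have hm1pos : 0 < m1 := injectiveSum_pos _ hmem' _ (by simp [hS]; omega)
    have hk0 : (0 : ℝ) < k := by exact_mod_cast hk
    set t := m0 / (k * m1) with ht
    have htpos : 0 < t := by positivity
    have hwpos : ∀ i, 0 < 1 * u i + t * A k i := fun i => by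
      have := hupos i
      have := hA k i
      positivity
    have hAF := injectiveSum_replicate_pow_le S k L hL hS u (fun i => 1 * u i + t * A k i)
      hupos hwpos
    rw [injectiveSum_cons_add_smul, ← injectiveSum_perm (List.perm_middle (a := A k)),
      ← List.cons_append, ← List.replicate_succ, ← hm0, ← hm1] at hAF
    have hcap := hs (fun j => if j = k then t else x j) (fun j => by
      by_cases hj : j = k
      · simp [hj, htpos]
      · simp [hj, hx j])
    have hw : (fun i => ∑ j ∈ Finset.range (k + 1), (if j = k then t else x j) * A j i) =
        fun i => 1 * u i + t * A k i := by
      funext i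
      rw [Finset.sum_range_succ, if_pos rfl, one_mul]
      congr 1
      refine Finset.sum_congr rfl fun j hj => ?_
      rw [if_neg (Finset.mem_range.1 hj).ne]
    have hprod : ∏ j ∈ Finset.range (k + 1), (if j = k then t else x j) =
        (∏ j ∈ Finset.range k, x j) * t := by
      rw [Finset.prod_range_succ, if_pos rfl]
      congr 1
      refine Finset.prod_congr rfl fun j hj => ?_
      rw [if_neg (Finset.mem_range.1 hj).ne]
    rw [hw, hprod] at hcap
    set π := ∏ j ∈ Finset.range k, x j
    have h1 : m0 ^ k * (s * (π * t)) ≤ (1 * m0 + t * m1) ^ (k + 1) :=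
      (mul_le_mul_of_nonneg_left hcap (by positivity)).trans hAF
    have h2 : 1 * m0 + t * m1 = m0 * ((k + 1) / k) := by
      rw [ht]; field_simp
    rw [h2, ht, mul_pow, div_pow] at h1
    have h3 : m0 ^ k * (s * (π * (m0 / (k * m1)))) =
        m0 ^ (k + 1) * (s * π / (k * m1)) := by
      ring
    rw [h3] at h1
    have h4 := le_of_mul_le_mul_left h1 (by positivity)
    rw [div_le_div_iff₀ (by positivity) (by positivity)] at h4
    rw [div_mul_eq_mul_div, div_le_iff₀ hk1]
    refine le_of_mul_le_mul_left ?_ hk0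
    calc k * (s * k ^ k * π) = s * π * k ^ (k + 1) := by ring
      _ ≤ (k + 1) ^ (k + 1) * (k * m1) := h4
      _ = k * (m1 * (k + 1) ^ (k + 1)) := by ring

theorem injectiveSum_ofFn [Fintype ι] (k : ℕ) :
    ∀ (S : Finset ι) (a : Fin k → ι → ℝ), injectiveSum S (List.ofFn a) =
      ∑ f : Fin k → ι, if Function.Injective f ∧ ∀ j, f j ∈ S then ∏ j, a j (f j) else 0 := by
  induction k with
  | zero =>
    intro S a
    simp [injectiveSum, Function.injective_of_subsingleton]
  | succ k ih =>
    intro S a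
    rw [List.ofFn_succ, injectiveSum_cons, ← (Fin.consEquiv fun _ => ι).sum_comp,
      Fintype.sum_prod_type, ← Finset.sum_subset (Finset.subset_univ S)]
    · refine Finset.sum_congr rfl fun i hi => ?_
      rw [ih, Finset.mul_sum]
      refine Finset.sum_congr rfl fun f _ => ?_
      have hiff : (Function.Injective (Fin.cons i f : Fin (k + 1) → ι) ∧
          ∀ j, (Fin.cons i f : Fin (k + 1) → ι) j ∈ S) ↔
          (Function.Injective f ∧ ∀ j, f j ∈ S.erase i) := by
        rw [Fin.cons_injective_iff, Fin.forall_fin_succ]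
        simp only [Fin.cons_zero, Fin.cons_succ, Finset.mem_erase, Set.mem_range, not_exists]
        constructor
        · rintro ⟨⟨h1, h2⟩, _, h4⟩
          exact ⟨h2, fun j => ⟨h1 j, h4 j⟩⟩
        · rintro ⟨h1, h2⟩
          exact ⟨⟨fun j => (h2 j).1, h1⟩, hi, fun j => (h2 j).2⟩
      simp only [Fin.consEquiv, Equiv.coe_fn_mk, hiff, mul_ite, mul_zero, Fin.prod_univ_succ,
        Fin.cons_zero, Fin.cons_succ]
    · intro i _ hi
      refine Finset.sum_eq_zero fun f _ => if_neg ?_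
      rintro ⟨_, h⟩
      exact hi (h 0)

theorem injectiveSum_univ_ofFn (N : ℕ) (a : Fin N → Fin N → ℝ) :
    injectiveSum Finset.univ (List.ofFn a) = ∑ π : Equiv.Perm (Fin N), ∏ j, a j (π j) := by
  rw [injectiveSum_ofFn, ← Finset.sum_filter]
  symm
  refine Finset.sum_bij (fun π _ => (π : Fin N → Fin N)) ?_ ?_ ?_ ?_
  · intro π _
    simpa using π.injective
  · intro π _ τ _ h
    exact DFunLike.coe_injective h
  · intro f hf
    have hf' : Function.Injective f := by simpa using hf
    exact ⟨Equiv.ofBijective f (Finite.injective_iff_bijective.1 hf'), Finset.mem_univ _, rfl⟩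
  · intro π _
    rfl

end InjectiveSum

/-- The van der Waerden bound in capacity form. -/
theorem capacity_le_permanent (N : ℕ) (A : Fin N → Fin N → ℝ) (hA : ∀ p q, 0 < A p q) (s : ℝ)
    (hs : ∀ x : Fin N → ℝ, (∀ q, 0 < x q) → s * ∏ q, x q ≤ ∏ p, ∑ q, A p q * x q) :
    (Nat.factorial N : ℝ) * s ≤ (N : ℝ) ^ N * ∑ π : Equiv.Perm (Fin N), ∏ k, A k (π k) := by
  set B : ℕ → Fin N → ℝ := fun j p => if h : j < N then A p ⟨j, h⟩ else 1 with hB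
  have hBpos : ∀ j p, 0 < B j p := by
    intro j p
    by_cases h : j < N
    · simp only [hB, dif_pos h]; exact hA _ _
    · simp [hB, h]
  have hBfin : ∀ (j : Fin N) p, B j p = A p j := fun j p => by simp [hB]
  have h := capacity_le_injectiveSum Finset.univ B hBpos N [] (by simp) (by simp)
    (Nat.factorial N * s) ?_
  · refine h.trans_eq ?_
    congr 1
    have : (List.range N).map B ++ [] = List.ofFn fun j p => A p j := by
      rw [List.append_nil]
      apply List.ext_getElem
      · simp
      · intro j h1 h2
        funext p
        have hj : j < N := by simpa using h1
        simp [hB, hj]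
    rw [this, injectiveSum_univ_ofFn, ← Equiv.sum_comp (Equiv.inv (Equiv.Perm (Fin N)))]
    refine Finset.sum_congr rfl fun π _ => ?_
    rw [← Equiv.prod_comp π]
    simp
  · intro x hx
    rw [List.append_nil, ← List.ofFn_const, injectiveSum_univ_ofFn]
    have hprod : ∀ π : Equiv.Perm (Fin N),
        ∏ j, (fun i => ∑ j ∈ Finset.range N, x j * B j i) (π j) =
          ∏ p, ∑ q : Fin N, A p q * x q := by
      intro π
      rw [Equiv.prod_comp π (fun i => ∑ j ∈ Finset.range N, x j * B j i)]
      refine Finset.prod_congr rfl fun p _ => ?_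
      rw [Finset.sum_range]
      refine Finset.sum_congr rfl fun q _ => ?_
      rw [hBfin, mul_comm]
    rw [Finset.sum_congr rfl fun π _ => hprod π, Finset.sum_const, Finset.card_univ,
      Fintype.card_perm, Fintype.card_fin, nsmul_eq_mul, Finset.prod_range, mul_assoc]
    exact mul_le_mul_of_nonneg_left (hs (fun q => x q) fun q => hx q) (by positivity)

theorem prod_comp_eq_prod_pow {m N : ℕ} {r : Fin m → ℕ} {ρ : Fin N → Fin m}
    (hρ : ∀ i, Nat.card {p : Fin N // ρ p = i} = r i) (g : Fin m → ℝ) :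
    ∏ p, g (ρ p) = ∏ i, g i ^ r i := by
  rw [← Finset.prod_fiberwise' Finset.univ ρ g]
  refine Finset.prod_congr rfl fun i _ => ?_
  rw [Finset.prod_const, ← hρ i, Nat.card_eq_fintype_card, Fintype.card_subtype]

theorem sum_comp_eq_sum_mul {m N : ℕ} {r : Fin m → ℕ} {ρ : Fin N → Fin m}
    (hρ : ∀ i, Nat.card {p : Fin N // ρ p = i} = r i) (g : Fin m → ℝ) :
    ∑ p, g (ρ p) = ∑ i, r i * g i := by
  rw [← Finset.sum_fiberwise' Finset.univ ρ g]
  refine Finset.sum_congr rfl fun i _ => ?_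
  rw [Finset.sum_const, ← hρ i, Nat.card_eq_fintype_card, Fintype.card_subtype, nsmul_eq_mul]

theorem card_perm_comp_eq_le_s17 {m N : ℕ} {r : Fin m → ℕ} {ρ : Fin N → Fin m}
    (hρ : ∀ i, Nat.card {p : Fin N // ρ p = i} = r i) (f : Fin N → Fin m) :
    (Finset.univ.filter fun π : Equiv.Perm (Fin N) => ρ ∘ π = f).card ≤
      ∏ i, Nat.factorial (r i) := by
  have hstab : (Finset.univ.filter fun π : Equiv.Perm (Fin N) => ρ ∘ π = ρ).card =
      ∏ i, Nat.factorial (r i) := by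
    rw [← Fintype.card_subtype, DomMulAct.stabilizer_card]
    simp_rw [← hρ, Nat.card_eq_fintype_card]
  rcases (Finset.univ.filter fun π : Equiv.Perm (Fin N) => ρ ∘ π = f).eq_empty_or_nonempty with
    h | ⟨τ, hτ⟩
  · simp [h]
  · rw [← hstab]
    refine Finset.card_le_card_of_injOn (fun π => π * τ⁻¹) ?_ ?_
    · intro π hπ
      simp only [Finset.coe_filter, Finset.mem_univ, true_and, Set.mem_ofPred_eq,
        Finset.mem_filter] at hπ hτ ⊢
      funext p
      have h1 := congrFun (hπ.trans hτ.symm) (τ⁻¹ p)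
      simpa using h1
    · intro π _ π' _ h
      exact mul_right_cancel h

theorem permanent_blockRows_le {m N : ℕ} {r : Fin m → ℕ} {ρ : Fin N → Fin m}
    (hρ : ∀ i, Nat.card {p : Fin N // ρ p = i} = r i) (a : Fin m → Fin N → ℝ)
    (ha : ∀ i q, 0 < a i q) (l : Fin m → ℝ) (hl : ∀ i, 0 < l i) :
    (∑ π : Equiv.Perm (Fin N), ∏ k, a (ρ k) (π k)) * (∏ i, (r i : ℝ) ^ r i) * ∏ p, l (ρ p) ≤
      (∏ i, (Nat.factorial (r i) : ℝ)) * ∏ q, ∑ p, a (ρ p) q * l (ρ p) := by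
  set y : Fin m → Fin N → ℝ := fun i q => r i * (a i q * l i) with hy
  have hy0 : ∀ i q, 0 ≤ y i q := fun i q => by
    have := ha i q
    have := hl i
    positivity
  have hR : ∏ q, ∑ p, a (ρ p) q * l (ρ p) = ∑ f : Fin N → Fin m, ∏ q, y (f q) q := by
    rw [Finset.prod_congr rfl fun q _ => sum_comp_eq_sum_mul hρ fun i => a i q * l i,
      Finset.prod_univ_sum, Fintype.piFinset_univ]
  have hL : (∑ π : Equiv.Perm (Fin N), ∏ k, a (ρ k) (π k)) * (∏ i, (r i : ℝ) ^ r i) *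
      ∏ p, l (ρ p) = ∑ π : Equiv.Perm (Fin N), ∏ q, y (ρ (π q)) q := by
    rw [← prod_comp_eq_prod_pow hρ fun i => (r i : ℝ), Finset.sum_mul, Finset.sum_mul,
      ← Equiv.sum_comp (Equiv.inv (Equiv.Perm (Fin N)))
        (fun π : Equiv.Perm (Fin N) => ∏ q, y (ρ (π q)) q)]
    refine Finset.sum_congr rfl fun π _ => ?_
    rw [← Equiv.prod_comp π (fun q => y _ q), ← Finset.prod_mul_distrib, ← Finset.prod_mul_distrib]
    refine Finset.prod_congr rfl fun k _ => ?_
    have hk : (Equiv.inv (Equiv.Perm (Fin N))) π (π k) = k := by simp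
    simp only [hy, hk]
    ring
  rw [hL, hR, ← Finset.sum_fiberwise Finset.univ
    (fun π : Equiv.Perm (Fin N) => ρ ∘ (π : Fin N → Fin N)), Finset.mul_sum]
  refine Finset.sum_le_sum fun f _ => ?_
  have : ∀ π ∈ Finset.univ.filter (fun π : Equiv.Perm (Fin N) => ρ ∘ π = f),
      ∏ q, y (ρ (π q)) q = ∏ q, y (f q) q := by
    intro π hπ
    rw [Finset.mem_filter] at hπ
    rw [← hπ.2]
    rfl
  rw [Finset.sum_congr rfl this, Finset.sum_const, nsmul_eq_mul]
  refine mul_le_mul_of_nonneg_right ?_ (Finset.prod_nonneg fun q _ => hy0 _ _)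
  exact_mod_cast card_perm_comp_eq_le_s17 hρ f

theorem prod_le_one_of_sum_eq_card {ι : Type*} [Fintype ι] (z : ι → ℝ) (hz : ∀ i, 0 ≤ z i)
    (h : ∑ i, z i = Fintype.card ι) : ∏ i, z i ≤ 1 :=
  calc ∏ i, z i ≤ ∏ i, Real.exp (z i - 1) :=
        Finset.prod_le_prod (fun i _ => hz i) fun i _ => by
          have := Real.add_one_le_exp (z i - 1)
          linarith
    _ = 1 := by
        rw [← Real.exp_sum, Finset.sum_sub_distrib, h]
        simp

/-- One step of Sinkhorn scaling does not increase `∏ (A x) / ∏ x`. -/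
theorem prod_sum_inv_mul_prod_le_one {N : ℕ} (A : Fin N → Fin N → ℝ) (hA : ∀ p q, 0 < A p q)
    (x : Fin N → ℝ) (hx : ∀ q, 0 < x q) :
    (∏ q, ∑ p, A p q * (∑ q', A p q' * x q')⁻¹) * ∏ q, x q ≤ 1 := by
  have hpos : ∀ p, 0 < ∑ q', A p q' * x q' := fun p =>
    Finset.sum_pos (fun q _ => mul_pos (hA p q) (hx q)) ⟨p, Finset.mem_univ p⟩
  rw [← Finset.prod_mul_distrib]
  refine prod_le_one_of_sum_eq_card _ (fun q => ?_) ?_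
  · exact mul_nonneg (Finset.sum_nonneg fun p _ => (mul_pos (hA p q) (inv_pos.2 (hpos p))).le)
      (hx q).le
  · simp_rw [Finset.sum_mul]
    rw [Finset.sum_comm]
    have : ∀ p, ∑ q, A p q * (∑ q', A p q' * x q')⁻¹ * x q = 1 := by
      intro p
      rw [← mul_inv_cancel₀ (hpos p).ne', Finset.sum_mul]
      exact Finset.sum_congr rfl fun q _ => by ring
    simp [this]

theorem permanent_blockRows_mul_prod_le {m N : ℕ} {r : Fin m → ℕ} {ρ : Fin N → Fin m}
    (hρ : ∀ i, Nat.card {p : Fin N // ρ p = i} = r i) (a : Fin m → Fin N → ℝ)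
    (ha : ∀ i q, 0 < a i q) (x : Fin N → ℝ) (hx : ∀ q, 0 < x q) :
    (∑ π : Equiv.Perm (Fin N), ∏ k, a (ρ k) (π k)) * (∏ i, (r i : ℝ) ^ r i) * ∏ q, x q ≤
      (∏ i, (Nat.factorial (r i) : ℝ)) * ∏ p, ∑ q, a (ρ p) q * x q := by
  rcases Nat.eq_zero_or_pos N with rfl | hN
  · simpa using permanent_blockRows_le hρ a ha 1 (by simp)
  have hpos : ∀ i, 0 < ∑ q, a i q * x q := fun i =>
    Finset.sum_pos (fun q _ => mul_pos (ha i q) (hx q)) ⟨⟨0, hN⟩, Finset.mem_univ _⟩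
  have h1 := permanent_blockRows_le hρ a ha (fun i => (∑ q, a i q * x q)⁻¹)
    fun i => inv_pos.2 (hpos i)
  have h2 := prod_sum_inv_mul_prod_le_one (fun p q => a (ρ p) q) (fun p q => ha _ _) x hx
  rw [Finset.prod_inv_distrib] at h1
  set D := ∏ p, ∑ q, a (ρ p) q * x q
  have hD : 0 < D := Finset.prod_pos fun p _ => hpos _
  have hX : 0 < ∏ q, x q := Finset.prod_pos fun q _ => hx q
  set X := ∏ q, x q
  set F := ∏ i, (Nat.factorial (r i) : ℝ)
  have hF : 0 ≤ F := Finset.prod_nonneg fun i _ => by positivity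
  set Y := ∏ q, ∑ p, a (ρ p) q * (∑ q', a (ρ p) q' * x q')⁻¹
  set P := (∑ π : Equiv.Perm (Fin N), ∏ k, a (ρ k) (π k)) * (∏ i, (r i : ℝ) ^ r i)
  calc P * X = (P * D⁻¹) * (D * X) := by field_simp
    _ ≤ (F * Y) * (D * X) := mul_le_mul_of_nonneg_right h1 (by positivity)
    _ = F * D * (Y * X) := by ring
    _ ≤ F * D * 1 := mul_le_mul_of_nonneg_left h2 (by positivity)
    _ = F * D := mul_one _

theorem permanent_blockCols_mul_prod_le {n N : ℕ} {c : Fin n → ℕ} {κ : Fin N → Fin n}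
    (hκ : ∀ j, Nat.card {q : Fin N // κ q = j} = c j) (a : Fin N → Fin n → ℝ)
    (ha : ∀ p j, 0 < a p j) (x : Fin N → ℝ) (hx : ∀ q, 0 < x q) :
    (∑ π : Equiv.Perm (Fin N), ∏ k, a k (κ (π k))) * (∏ j, (c j : ℝ) ^ c j) * ∏ q, x q ≤
      (∏ j, (Nat.factorial (c j) : ℝ)) * ∏ p, ∑ q, a p (κ q) * x q := by
  have hpos : ∀ p, 0 < ∑ q, a p (κ q) * x q := fun p =>
    Finset.sum_pos (fun q _ => mul_pos (ha p _) (hx q)) ⟨p, Finset.mem_univ _⟩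
  have h1 := permanent_blockRows_mul_prod_le hκ (fun j p => a p j) (fun j p => ha p j)
    (fun p => (∑ q, a p (κ q) * x q)⁻¹) fun p => inv_pos.2 (hpos p)
  have h2 := prod_sum_inv_mul_prod_le_one (fun p q => a p (κ q)) (fun p q => ha _ _) x hx
  have hper : ∑ π : Equiv.Perm (Fin N), ∏ k, a (π k) (κ k) =
      ∑ π : Equiv.Perm (Fin N), ∏ k, a k (κ (π k)) := by
    rw [← Equiv.sum_comp (Equiv.inv (Equiv.Perm (Fin N)))]
    refine Finset.sum_congr rfl fun π _ => ?_
    rw [← Equiv.prod_comp π]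
    simp
  rw [Finset.prod_inv_distrib, hper] at h1
  set D := ∏ p, ∑ q, a p (κ q) * x q
  have hD : 0 < D := Finset.prod_pos fun p _ => hpos _
  have hX : 0 < ∏ q, x q := Finset.prod_pos fun q _ => hx q
  set X := ∏ q, x q
  set F := ∏ j, (Nat.factorial (c j) : ℝ)
  have hF : 0 ≤ F := Finset.prod_nonneg fun i _ => by positivity
  set Y := ∏ q, ∑ p, a p (κ q) * (∑ q', a p (κ q') * x q')⁻¹
  set P := (∑ π : Equiv.Perm (Fin N), ∏ k, a k (κ (π k))) * (∏ j, (c j : ℝ) ^ c j)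
  calc P * X = (P * D⁻¹) * (D * X) := by field_simp
    _ ≤ (F * Y) * (D * X) := mul_le_mul_of_nonneg_right h1 (by positivity)
    _ = F * D * (Y * X) := by ring
    _ ≤ F * D * 1 := mul_le_mul_of_nonneg_left h2 (by positivity)
    _ = F * D := mul_one _

section ScalingInvariant

variable {N : ℕ} {A : Fin N → Fin N → ℝ}

theorem permanent_pos (hA : ∀ p q, 0 < A p q) :
    0 < ∑ π : Equiv.Perm (Fin N), ∏ k, A k (π k) :=
  Finset.sum_pos (fun _ _ => Finset.prod_pos fun _ _ => hA _ _) ⟨1, Finset.mem_univ _⟩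

theorem exp_sum_log_eq_prod (hA : ∀ p q, 0 < A p q) (t : Fin N → ℝ) :
    Real.exp (∑ p, Real.log (∑ q, A p q * Real.exp (t q))) =
      ∏ p, ∑ q, A p q * Real.exp (t q) := by
  rw [Real.exp_sum]
  refine Finset.prod_congr rfl fun p _ => Real.exp_log ?_
  exact Finset.sum_pos (fun q _ => mul_pos (hA p q) (Real.exp_pos _)) ⟨p, Finset.mem_univ _⟩

theorem log_permanent_div_le (hA : ∀ p q, 0 < A p q) {C : ℝ} (hC0 : 0 < C)
    (hC : ∀ x : Fin N → ℝ, (∀ q, 0 < x q) →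
      (∑ π : Equiv.Perm (Fin N), ∏ k, A k (π k)) * ∏ q, x q ≤ C * ∏ p, ∑ q, A p q * x q)
    (t : {t : Fin N → ℝ // ∑ i, t i = 0}) :
    Real.log ((∑ π : Equiv.Perm (Fin N), ∏ k, A k (π k)) / C) ≤
      ∑ p, Real.log (∑ q, A p q * Real.exp (t.1 q)) := by
  rw [Real.log_le_iff_le_exp (div_pos (permanent_pos hA) hC0), exp_sum_log_eq_prod hA,
    div_le_iff₀ hC0, mul_comm _ C]
  have := hC (fun q => Real.exp (t.1 q)) fun q => Real.exp_pos _
  rwa [← Real.exp_sum, t.2, Real.exp_zero, mul_one] at this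

theorem permanent_le_mul_exp_iInf (hA : ∀ p q, 0 < A p q) {C : ℝ} (hC0 : 0 < C)
    (hC : ∀ x : Fin N → ℝ, (∀ q, 0 < x q) →
      (∑ π : Equiv.Perm (Fin N), ∏ k, A k (π k)) * ∏ q, x q ≤ C * ∏ p, ∑ q, A p q * x q) :
    ∑ π : Equiv.Perm (Fin N), ∏ k, A k (π k) ≤
      C * Real.exp (⨅ t : {t : Fin N → ℝ // ∑ i, t i = 0},
        ∑ p, Real.log (∑ q, A p q * Real.exp (t.1 q))) := by
  have : Nonempty {t : Fin N → ℝ // ∑ i, t i = 0} := ⟨⟨0, by simp⟩⟩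
  rw [mul_comm, ← div_le_iff₀ hC0, ← Real.log_le_iff_le_exp (div_pos (permanent_pos hA) hC0)]
  exact le_ciInf fun t => log_permanent_div_le hA hC0 hC t

theorem exp_iInf_le_permanent (hA : ∀ p q, 0 < A p q)
    (hbdd : BddBelow (Set.range fun t : {t : Fin N → ℝ // ∑ i, t i = 0} =>
      ∑ p, Real.log (∑ q, A p q * Real.exp (t.1 q)))) :
    (Nat.factorial N : ℝ) * Real.exp (⨅ t : {t : Fin N → ℝ // ∑ i, t i = 0},
        ∑ p, Real.log (∑ q, A p q * Real.exp (t.1 q))) ≤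
      (N : ℝ) ^ N * ∑ π : Equiv.Perm (Fin N), ∏ k, A k (π k) := by
  refine capacity_le_permanent N A hA _ fun x hx => ?_
  set μ := (∑ q, Real.log (x q)) / N with hμ
  have hNμ : N * μ = ∑ q, Real.log (x q) := by
    rcases Nat.eq_zero_or_pos N with rfl | hN
    · simp
    · have : (N : ℝ) ≠ 0 := by positivity
      rw [hμ]; field_simp
  have ht : ∑ q, (Real.log (x q) - μ) = 0 := by
    rw [Finset.sum_sub_distrib, Finset.sum_const, Finset.card_univ, Fintype.card_fin, nsmul_eq_mul,
      hNμ, sub_self]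
  have h1 := Real.exp_le_exp.2 (ciInf_le hbdd ⟨fun q => Real.log (x q) - μ, ht⟩)
  rw [exp_sum_log_eq_prod hA] at h1
  have h2 : ∏ q, x q = Real.exp μ ^ N := by
    rw [← Real.exp_nat_mul, hNμ, Real.exp_sum]
    exact Finset.prod_congr rfl fun q _ => (Real.exp_log (hx q)).symm
  have h3 : ∏ p, ∑ q, A p q * x q =
      (∏ p, ∑ q, A p q * Real.exp (Real.log (x q) - μ)) * Real.exp μ ^ N := by
    have : Real.exp μ ^ N = ∏ _p : Fin N, Real.exp μ := by simp
    rw [this, ← Finset.prod_mul_distrib]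
    refine Finset.prod_congr rfl fun p _ => ?_
    rw [Finset.sum_mul]
    refine Finset.sum_congr rfl fun q _ => ?_
    rw [mul_assoc, ← Real.exp_add, sub_add_cancel, Real.exp_log (hx q)]
  rw [h2, h3]
  exact mul_le_mul_of_nonneg_right h1 (by positivity)

end ScalingInvariant

section Integrability

variable {m n : ℕ}

theorem measurableSet_posOrthant :
    MeasurableSet {γ : Fin m → Fin n → ℝ | ∀ i j, 0 < γ i j} := by
  simp only [Set.ofPred_forall]
  refine MeasurableSet.iInter fun i => MeasurableSet.iInter fun j => ?_
  exact measurableSet_lt measurable_const (by fun_prop)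

theorem integrableOn_exp_neg_half_sum :
    IntegrableOn (fun γ : Fin m → Fin n → ℝ => Real.exp (-(∑ i, ∑ j, γ i j) / 2))
      {γ : Fin m → Fin n → ℝ | ∀ i j, 0 < γ i j} := by
  rw [← integrable_indicator_iff measurableSet_posOrthant]
  have h1 : Integrable ((Set.Ioi (0 : ℝ)).indicator fun x => Real.exp (-x / 2)) := by
    rw [integrable_indicator_iff measurableSet_Ioi]
    have := integrableOn_exp_mul_Ioi (a := -(1 / 2)) (by norm_num) 0
    refine this.congr_fun (fun x _ => ?_) measurableSet_Ioi
    ring_nf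
  have h2 : Integrable (fun γ : Fin m → Fin n → ℝ =>
      ∏ i, ∏ j, (Set.Ioi (0 : ℝ)).indicator (fun x => Real.exp (-x / 2)) (γ i j)) :=
    Integrable.fintype_prod (f := fun (_ : Fin m) (v : Fin n → ℝ) =>
      ∏ j, (Set.Ioi (0 : ℝ)).indicator (fun x => Real.exp (-x / 2)) (v j))
      fun i => Integrable.fintype_prod (f := fun (_ : Fin n) =>
        (Set.Ioi (0 : ℝ)).indicator (fun x => Real.exp (-x / 2))) fun j => h1
  refine h2.congr (Filter.Eventually.of_forall fun γ => ?_)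
  by_cases hγ : ∀ i j, 0 < γ i j
  · rw [Set.indicator_of_mem (show γ ∈ {γ : Fin m → Fin n → ℝ | ∀ i j, 0 < γ i j} from hγ)]
    have : ∀ i j, (Set.Ioi (0 : ℝ)).indicator (fun x => Real.exp (-x / 2)) (γ i j) =
        Real.exp (-(γ i j) / 2) := fun i j => Set.indicator_of_mem (hγ i j) _
    simp only [this, ← Real.exp_sum, ← Finset.sum_div, Finset.sum_neg_distrib]
  · rw [Set.indicator_of_notMem (show γ ∉ {γ : Fin m → Fin n → ℝ | ∀ i j, 0 < γ i j} from hγ)]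
    push Not at hγ
    obtain ⟨i, j, hij⟩ := hγ
    refine Finset.prod_eq_zero (Finset.mem_univ i) (Finset.prod_eq_zero (Finset.mem_univ j) ?_)
    exact Set.indicator_of_notMem (by simpa using hij) _

theorem pow_mul_exp_neg_le (N : ℕ) (s : ℝ) (hs : 0 ≤ s) :
    s ^ N * Real.exp (-s) ≤ 2 ^ N * Nat.factorial N * Real.exp (-s / 2) := by
  have h := Real.pow_div_factorial_le_exp (s / 2) (by positivity) N
  rw [div_le_iff₀ (by positivity), div_pow, div_le_iff₀ (by positivity)] at h
  have e : Real.exp (-s / 2) = Real.exp (s / 2) * Real.exp (-s) := by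
    rw [← Real.exp_add]; ring_nf
  rw [e]
  calc s ^ N * Real.exp (-s) ≤ (Real.exp (s / 2) * Nat.factorial N * 2 ^ N) * Real.exp (-s) :=
        mul_le_mul_of_nonneg_right h (Real.exp_pos _).le
    _ = _ := by ring

theorem integrableOn_permanent_mul_exp {N : ℕ} (W : Fin m → Fin n → ℝ) (ρ : Fin N → Fin m)
    (κ : Fin N → Fin n) :
    IntegrableOn (fun γ : Fin m → Fin n → ℝ =>
      (∑ π : Equiv.Perm (Fin N), ∏ k, W (ρ k) (κ (π k)) * γ (ρ k) (κ (π k))) *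
        Real.exp (-∑ i, ∑ j, γ i j)) {γ : Fin m → Fin n → ℝ | ∀ i j, 0 < γ i j} := by
  simp_rw [Finset.sum_mul]
  refine integrable_finsetSum _ fun π _ => ?_
  refine Integrable.mono' ((integrableOn_exp_neg_half_sum (m := m) (n := n)).const_mul
    (|∏ k, W (ρ k) (κ (π k))| * (2 ^ N * Nat.factorial N))) ?_ ?_
  · exact Measurable.aestronglyMeasurable (by fun_prop)
  · refine (ae_restrict_iff' measurableSet_posOrthant).2 (Filter.Eventually.of_forall fun γ hγ => ?_)
    have hγ' : ∀ i j, 0 < γ i j := hγ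
    have hle : ∀ i j, γ i j ≤ ∑ i, ∑ j, γ i j := fun i j =>
      (Finset.single_le_sum (fun j _ => (hγ' i j).le) (Finset.mem_univ j)).trans
        (Finset.single_le_sum (f := fun i => ∑ j, γ i j)
          (fun i _ => Finset.sum_nonneg fun j _ => (hγ' i j).le) (Finset.mem_univ i))
    set s := ∑ i, ∑ j, γ i j with hs
    have hs0 : 0 ≤ s := Finset.sum_nonneg fun i _ => Finset.sum_nonneg fun j _ => (hγ' i j).le
    have hp0 : 0 ≤ ∏ k, γ (ρ k) (κ (π k)) := Finset.prod_nonneg fun k _ => (hγ' _ _).le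
    have hp : ∏ k, γ (ρ k) (κ (π k)) ≤ s ^ N := by
      refine (Finset.prod_le_prod (fun k _ => (hγ' _ _).le) fun k _ => hle _ _).trans_eq (by simp)
    rw [Finset.prod_mul_distrib, norm_mul, norm_mul, Real.norm_eq_abs, Real.norm_eq_abs,
      Real.norm_eq_abs, abs_of_nonneg hp0, abs_of_pos (Real.exp_pos _), mul_assoc, mul_assoc]
    refine mul_le_mul_of_nonneg_left ?_ (abs_nonneg _)
    exact (mul_le_mul_of_nonneg_right hp (Real.exp_pos _).le).trans (pow_mul_exp_neg_le N s hs0)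

theorem aemeasurable_exp_iInf {N : ℕ} (W : Fin m → Fin n → ℝ) (hW : ∀ i j, 0 < W i j)
    (ρ : Fin N → Fin m) (κ : Fin N → Fin n)
    (hbdd : ∀ γ : Fin m → Fin n → ℝ, (∀ i j, 0 < γ i j) →
      BddBelow (Set.range fun t : {t : Fin N → ℝ // ∑ i, t i = 0} =>
        ∑ p, Real.log (∑ q, W (ρ p) (κ q) * γ (ρ p) (κ q) * Real.exp (t.1 q)))) :
    AEMeasurable (fun γ : Fin m → Fin n → ℝ =>
      Real.exp (⨅ t : {t : Fin N → ℝ // ∑ i, t i = 0},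
        ∑ p, Real.log (∑ q, W (ρ p) (κ q) * γ (ρ p) (κ q) * Real.exp (t.1 q))))
      (volume.restrict {γ : Fin m → Fin n → ℝ | ∀ i j, 0 < γ i j}) := by
  refine Real.measurable_exp.comp_aemeasurable ?_
  rw [aemeasurable_restrict_iff_comap_subtype measurableSet_posOrthant]
  refine Measurable.aemeasurable (UpperSemicontinuous.measurable ?_)
  refine upperSemicontinuous_ciInf (fun γ => hbdd γ.1 γ.2) fun t => Continuous.upperSemicontinuous ?_
  refine continuous_finsetSum _ fun p _ => Continuous.log ?_ fun γ => ?_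
  · refine continuous_finsetSum _ fun q _ => ?_
    refine (continuous_const.mul ?_).mul continuous_const
    exact (continuous_apply_apply _ _).comp continuous_subtype_val
  · exact (Finset.sum_pos (fun q _ => mul_pos (mul_pos (hW _ _) (γ.2 _ _)) (Real.exp_pos _))
      ⟨p, Finset.mem_univ _⟩).ne'

end Integrability

/-- Theorem 1.4. With
`T = (1/(r_1!⋯r_m! c_1!⋯c_n!)) ∫_{ℝ^{mn}_+} per A(γ) e^{−Σγ} dγ` and
`T' = (N!/N^N)(1/(r_1!⋯r_m! c_1!⋯c_n!)) ∫_{ℝ^{mn}_+} S(γ) e^{−Σγ} dγ`, where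
`S(γ) = exp(inf_{t ∈ H} f_{A(γ)}(t)) = σ(A(γ))`, one has
`T' ≤ T ≤ α(R,C)·T'` with
`α(R,C) = (N^N/N!)·min{∏_i r_i!/r_i^{r_i}, ∏_j c_j!/c_j^{c_j}}`. -/
theorem T_between_T'_and_alpha_T'
    (m n N : ℕ) (r : Fin m → ℕ) (c : Fin n → ℕ)
    (hr : ∀ i, 0 < r i) (hc : ∀ j, 0 < c j)
    (hrN : ∑ i, r i = N) (hcN : ∑ j, c j = N)
    (W : Fin m → Fin n → ℝ) (hW : ∀ i j, 0 < W i j)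
    (ρ : Fin N → Fin m) (κ : Fin N → Fin n)
    (hρ : ∀ i, Nat.card {p : Fin N // ρ p = i} = r i)
    (hκ : ∀ j, Nat.card {q : Fin N // κ q = j} = c j)
    (T T' : ℝ)
    (hT : T = (1 / ((∏ i, (Nat.factorial (r i) : ℝ)) * ∏ j, (Nat.factorial (c j) : ℝ))) *
      ∫ γ in {γ : Fin m → Fin n → ℝ | ∀ i j, 0 < γ i j},
        (∑ π : Equiv.Perm (Fin N), ∏ k, W (ρ k) (κ (π k)) * γ (ρ k) (κ (π k))) *
          Real.exp (-∑ i, ∑ j, γ i j))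
    (hT' : T' = ((Nat.factorial N : ℝ) / (N : ℝ) ^ N) *
      (1 / ((∏ i, (Nat.factorial (r i) : ℝ)) * ∏ j, (Nat.factorial (c j) : ℝ))) *
      ∫ γ in {γ : Fin m → Fin n → ℝ | ∀ i j, 0 < γ i j},
        Real.exp (⨅ t : {t : Fin N → ℝ // ∑ i, t i = 0},
            ∑ p, Real.log (∑ q, W (ρ p) (κ q) * γ (ρ p) (κ q) * Real.exp (t.1 q))) *
          Real.exp (-∑ i, ∑ j, γ i j)) :
    T' ≤ T ∧
    T ≤ ((N : ℝ) ^ N / (Nat.factorial N : ℝ)) *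
          min (∏ i, (Nat.factorial (r i) : ℝ) / (r i : ℝ) ^ (r i))
            (∏ j, (Nat.factorial (c j) : ℝ) / (c j : ℝ) ^ (c j)) * T' := by
  have hA : ∀ γ : Fin m → Fin n → ℝ, (∀ i j, 0 < γ i j) → ∀ i j, 0 < W i j * γ i j :=
    fun γ hγ i j => mul_pos (hW i j) (hγ i j)
  have hrow0 : 0 < ∏ i, (Nat.factorial (r i) : ℝ) / (r i : ℝ) ^ (r i) :=
    Finset.prod_pos fun i _ => by have := hr i; positivity
  have hcol0 : 0 < ∏ j, (Nat.factorial (c j) : ℝ) / (c j : ℝ) ^ (c j) :=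
    Finset.prod_pos fun j _ => by have := hc j; positivity
  have hrow : ∀ γ : Fin m → Fin n → ℝ, (∀ i j, 0 < γ i j) → ∀ x : Fin N → ℝ, (∀ q, 0 < x q) →
      (∑ π : Equiv.Perm (Fin N), ∏ k, W (ρ k) (κ (π k)) * γ (ρ k) (κ (π k))) * ∏ q, x q ≤
        (∏ i, (Nat.factorial (r i) : ℝ) / (r i : ℝ) ^ (r i)) *
          ∏ p, ∑ q, W (ρ p) (κ q) * γ (ρ p) (κ q) * x q := by
    intro γ hγ x hx
    have h := permanent_blockRows_mul_prod_le hρ (fun i q => W i (κ q) * γ i (κ q))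
      (fun i q => hA γ hγ _ _) x hx
    have h0 : 0 < ∏ i, (r i : ℝ) ^ r i :=
      Finset.prod_pos fun i _ => by have := hr i; positivity
    rw [Finset.prod_div_distrib, div_mul_eq_mul_div, le_div_iff₀ h0, mul_right_comm]
    exact h
  have hcol : ∀ γ : Fin m → Fin n → ℝ, (∀ i j, 0 < γ i j) → ∀ x : Fin N → ℝ, (∀ q, 0 < x q) →
      (∑ π : Equiv.Perm (Fin N), ∏ k, W (ρ k) (κ (π k)) * γ (ρ k) (κ (π k))) * ∏ q, x q ≤
        (∏ j, (Nat.factorial (c j) : ℝ) / (c j : ℝ) ^ (c j)) *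
          ∏ p, ∑ q, W (ρ p) (κ q) * γ (ρ p) (κ q) * x q := by
    intro γ hγ x hx
    have h := permanent_blockCols_mul_prod_le hκ (fun p j => W (ρ p) j * γ (ρ p) j)
      (fun p j => hA γ hγ _ _) x hx
    have h0 : 0 < ∏ j, (c j : ℝ) ^ c j :=
      Finset.prod_pos fun j _ => by have := hc j; positivity
    rw [Finset.prod_div_distrib, div_mul_eq_mul_div, le_div_iff₀ h0, mul_right_comm]
    exact h
  have hbdd : ∀ γ : Fin m → Fin n → ℝ, (∀ i j, 0 < γ i j) →
      BddBelow (Set.range fun t : {t : Fin N → ℝ // ∑ i, t i = 0} =>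
        ∑ p, Real.log (∑ q, W (ρ p) (κ q) * γ (ρ p) (κ q) * Real.exp (t.1 q))) := by
    intro γ hγ
    refine ⟨_, Set.forall_mem_range.2 fun t => log_permanent_div_le
      (A := fun p q => W (ρ p) (κ q) * γ (ρ p) (κ q)) (fun p q => hA γ hγ _ _) hrow0
      (hrow γ hγ) t⟩
  set M := min (∏ i, (Nat.factorial (r i) : ℝ) / (r i : ℝ) ^ (r i))
    (∏ j, (Nat.factorial (c j) : ℝ) / (c j : ℝ) ^ (c j)) with hM
  set P : (Fin m → Fin n → ℝ) → ℝ := fun γ =>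
    ∑ π : Equiv.Perm (Fin N), ∏ k, W (ρ k) (κ (π k)) * γ (ρ k) (κ (π k)) with hP
  set S : (Fin m → Fin n → ℝ) → ℝ := fun γ =>
    Real.exp (⨅ t : {t : Fin N → ℝ // ∑ i, t i = 0},
      ∑ p, Real.log (∑ q, W (ρ p) (κ q) * γ (ρ p) (κ q) * Real.exp (t.1 q))) with hS
  have hNpos : (0 : ℝ) < (N : ℝ) ^ N := by
    rcases N.eq_zero_or_pos with rfl | h
    · simp
    · positivity
  have hNf : (0 : ℝ) < Nat.factorial N := by positivity
  have hlow : ∀ γ : Fin m → Fin n → ℝ, (∀ i j, 0 < γ i j) →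
      ((Nat.factorial N : ℝ) / (N : ℝ) ^ N) * S γ ≤ P γ := by
    intro γ hγ
    rw [div_mul_eq_mul_div, div_le_iff₀ hNpos, mul_comm (P γ)]
    exact exp_iInf_le_permanent (A := fun p q => W (ρ p) (κ q) * γ (ρ p) (κ q))
      (fun p q => hA γ hγ _ _) (hbdd γ hγ)
  have hup : ∀ γ : Fin m → Fin n → ℝ, (∀ i j, 0 < γ i j) → P γ ≤ M * S γ := by
    intro γ hγ
    have h1 := permanent_le_mul_exp_iInf (A := fun p q => W (ρ p) (κ q) * γ (ρ p) (κ q))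
      (fun p q => hA γ hγ _ _) hrow0 (hrow γ hγ)
    have h2 := permanent_le_mul_exp_iInf (A := fun p q => W (ρ p) (κ q) * γ (ρ p) (κ q))
      (fun p q => hA γ hγ _ _) hcol0 (hcol γ hγ)
    rcases min_choice (∏ i, (Nat.factorial (r i) : ℝ) / (r i : ℝ) ^ (r i))
      (∏ j, (Nat.factorial (c j) : ℝ) / (c j : ℝ) ^ (c j)) with h | h
    · rw [hM, h]; exact h1
    · rw [hM, h]; exact h2
  have hPint : IntegrableOn (fun γ => P γ * Real.exp (-∑ i, ∑ j, γ i j))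
      {γ : Fin m → Fin n → ℝ | ∀ i j, 0 < γ i j} := integrableOn_permanent_mul_exp W ρ κ
  have hSint : IntegrableOn (fun γ => S γ * Real.exp (-∑ i, ∑ j, γ i j))
      {γ : Fin m → Fin n → ℝ | ∀ i j, 0 < γ i j} := by
    refine Integrable.mono' (hPint.const_mul ((N : ℝ) ^ N / Nat.factorial N)) ?_ ?_
    · refine AEMeasurable.aestronglyMeasurable ?_
      refine (aemeasurable_exp_iInf W hW ρ κ hbdd).mul (Measurable.aemeasurable ?_)
      fun_prop
    · refine (ae_restrict_iff' measurableSet_posOrthant).2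
        (Filter.Eventually.of_forall fun γ hγ => ?_)
      have hS0 : 0 < S γ := Real.exp_pos _
      rw [Real.norm_of_nonneg (by positivity), ← mul_assoc]
      refine mul_le_mul_of_nonneg_right ?_ (Real.exp_pos _).le
      have := hlow γ hγ
      rw [div_mul_eq_mul_div, div_le_iff₀ hNpos] at this
      rw [div_mul_eq_mul_div, le_div_iff₀ hNf]
      linarith
  set K := 1 / ((∏ i, (Nat.factorial (r i) : ℝ)) * ∏ j, (Nat.factorial (c j) : ℝ)) with hK
  have hK0 : 0 ≤ K := by positivity
  set IP := ∫ γ in {γ : Fin m → Fin n → ℝ | ∀ i j, 0 < γ i j},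
    P γ * Real.exp (-∑ i, ∑ j, γ i j) with hIP
  set IS := ∫ γ in {γ : Fin m → Fin n → ℝ | ∀ i j, 0 < γ i j},
    S γ * Real.exp (-∑ i, ∑ j, γ i j) with hIS
  have hIlow : ((Nat.factorial N : ℝ) / (N : ℝ) ^ N) * IS ≤ IP := by
    rw [hIS, ← integral_const_mul]
    refine setIntegral_mono_on (hSint.const_mul _) hPint measurableSet_posOrthant fun γ hγ => ?_
    rw [← mul_assoc]
    exact mul_le_mul_of_nonneg_right (hlow γ hγ) (Real.exp_pos _).le
  have hIup : IP ≤ M * IS := by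
    rw [hIS, ← integral_const_mul]
    refine setIntegral_mono_on hPint (hSint.const_mul _) measurableSet_posOrthant fun γ hγ => ?_
    rw [← mul_assoc]
    exact mul_le_mul_of_nonneg_right (hup γ hγ) (Real.exp_pos _).le
  constructor
  · rw [hT, hT']
    calc _ = K * (((Nat.factorial N : ℝ) / (N : ℝ) ^ N) * IS) := by ring
      _ ≤ K * IP := mul_le_mul_of_nonneg_left hIlow hK0
  · rw [hT, hT']
    calc K * IP ≤ K * (M * IS) := mul_le_mul_of_nonneg_left hIup hK0
      _ = _ := by field_simp
end
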